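/- There is an admissible constant C (depending only on n and Γ) such that for every real polynomial p of degree at most n, every γ with min{1, n/2} ≤ |γ| ≤ Γ, every R ≥ 100 and every f ∈ C_c^∞(ℝ²), one has ‖𝒪^R f‖_{L²(ℝ²)} ≤ C · log(log(10+R)) · ‖f‖_{L²(ℝ²)}; in particular 𝒪^R extends to a bounded operator on L²(ℝ²) with norm at most C·log log(10+R). Moreover, if n = 1 the iterated logarithm may be dropped: ‖𝒪^R f‖_{L²(ℝ²)} ≤ C · ‖f‖_{L²(ℝ²)} uniformly in R ≥ 100. -/

import Mathlib

/- STATEMENT 3: log log bound for the singular oscillatory integral operators 𝒪^R. -/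

open MeasureTheory Polynomial

noncomputable section

/-- `β(t) = (1 + t²/4)^(1/2)`. -/
def bet (t : ℝ) : ℝ := Real.sqrt (1 + t ^ 2 / 4)

/-- The phase `Ψ(x,y) = (x₁−y₁)(x₂²+y₂²) − (x₂−y₂)·p(x₁+y₁)`. -/
def Psi (p : Polynomial ℝ) (x y : ℝ × ℝ) : ℝ :=
  (x.1 - y.1) * (x.2 ^ 2 + y.2 ^ 2) - (x.2 - y.2) * p.eval (x.1 + y.1)

/-- `θ(x,y) = β(x₁−y₁)·|x₂+y₂+p′(x₁+y₁)|·(x₂−y₂)`. -/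
def theta (p : Polynomial ℝ) (x y : ℝ × ℝ) : ℝ :=
  bet (x.1 - y.1) * |x.2 + y.2 + p.derivative.eval (x.1 + y.1)| * (x.2 - y.2)

/-- `sin θ(x,y)/(x₂−y₂)`, extended continuously across `x₂ = y₂`. -/
def sinq (p : Polynomial ℝ) (x y : ℝ × ℝ) : ℝ :=
  if x.2 = y.2 then bet (x.1 - y.1) * |x.2 + y.2 + p.derivative.eval (x.1 + y.1)|
  else Real.sin (theta p x y) / (x.2 - y.2)

/-- The kernel of the singular oscillatory integral operator `𝒪^R`. -/
def Oker (p : Polynomial ℝ) (γ R : ℝ) (x y : ℝ × ℝ) : ℂ :=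
  Complex.exp (Complex.I * (γ * Psi p x y : ℝ)) * (sinq p x y : ℝ) *
    ((bet (x.1 - y.1))⁻¹ : ℝ) * (if |x.1 - y.1| ≤ R then 1 else 0)

/-- The operator `𝒪^R`. -/
def Oop (p : Polynomial ℝ) (γ R : ℝ) (f : ℝ × ℝ → ℂ) (x : ℝ × ℝ) : ℂ :=
  ∫ y : ℝ × ℝ, Oker p γ R x y * f y

open FourierTransform

/-- A smooth even bump function, equal to `1` on `[-1/2, 1/2]` and vanishing off `(-1, 1)`. -/
def chiBump : ContDiffBump (0 : ℝ) := ⟨1 / 2, 1, by norm_num, by norm_num⟩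

def chi (z : ℝ) : ℝ := chiBump z

lemma chi_neg (z : ℝ) : chi (-z) = chi z := chiBump.neg z

lemma chi_nonneg (z : ℝ) : 0 ≤ chi z := chiBump.nonneg

lemma chi_le_one (z : ℝ) : chi z ≤ 1 := chiBump.le_one

lemma abs_chi_le_one (z : ℝ) : |chi z| ≤ 1 := by
  rw [abs_of_nonneg (chi_nonneg z)]; exact chi_le_one z

lemma chi_eq_zero {z : ℝ} (h : 1 ≤ |z|) : chi z = 0 :=
  chiBump.zero_of_le_dist (by simpa [chiBump] using h)

lemma chi_eq_one {z : ℝ} (h : |z| ≤ 1 / 2) : chi z = 1 :=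
  chiBump.one_of_mem_closedBall (by simpa [chiBump] using h)

lemma contDiff_chi : ContDiff ℝ (⊤ : ℕ∞) chi := chiBump.contDiff

lemma continuous_chi : Continuous chi := contDiff_chi.continuous

/-- The amplitude `|s| sinc(b s d)`, equal to `sin(b |s| d) / (b d)` when `b d ≠ 0`. -/
def SS (b s d : ℝ) : ℝ := |s| * Real.sinc (b * s * d)

lemma abs_SS_le (b s d : ℝ) : |SS b s d| ≤ |s| := by
  unfold SS
  rw [abs_mul, abs_abs]
  exact mul_le_of_le_one_right (abs_nonneg s) (Real.abs_sinc_le_one _)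

lemma SS_mul (b s d : ℝ) : SS b s d * (b * d) = Real.sin (b * |s| * d) := by
  unfold SS
  have key : Real.sinc (b * s * d) = Real.sinc (b * |s| * d) := by
    rcases abs_choice s with h | h <;> rw [h]
    rw [← Real.sinc_neg]; ring_nf
  rw [key]
  by_cases h0 : b * |s| * d = 0
  · rw [h0, Real.sinc_zero, Real.sin_zero, ← h0]; ring
  · rw [Real.sinc_of_ne_zero h0, mul_comm, ← mul_assoc, mul_right_comm b d, mul_div_cancel₀ _ h0]

lemma abs_SS_mul_le (b s d : ℝ) : |SS b s d| * |b * d| ≤ 1 := by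
  rw [← abs_mul, SS_mul]; exact Real.abs_sin_le_one _

lemma SS_lipschitz (b s s' d : ℝ) : |SS b s d - SS b s' d| ≤ |s - s'| := by
  by_cases h0 : b * d = 0
  · have h1 : ∀ s, SS b s d = |s| := by
      intro s; unfold SS
      have : b * s * d = 0 := by linear_combination s * h0
      rw [this]; simp
    rw [h1, h1]; exact abs_abs_sub_abs_le_abs_sub s s'
  · have h2 : |b * d| > 0 := abs_pos.mpr h0
    refine le_of_mul_le_mul_right ?_ h2
    rw [← abs_mul, sub_mul, SS_mul, SS_mul]
    have h3 : ∀ x y : ℝ, |Real.sin x - Real.sin y| ≤ |x - y| := by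
      intro x y
      simpa [Real.dist_eq] using Real.lipschitzWith_sin.dist_le_mul x y
    refine (h3 _ _).trans ?_
    have : b * |s| * d - b * |s'| * d = (|s| - |s'|) * (b * d) := by ring
    rw [this, abs_mul]
    exact mul_le_mul_of_nonneg_right (abs_abs_sub_abs_le_abs_sub s s') (abs_nonneg _)

@[fun_prop]
lemma continuous_SS {α : Type*} [TopologicalSpace α] {b s d : α → ℝ} (hb : Continuous b)
    (hs : Continuous s) (hd : Continuous d) : Continuous fun a => SS (b a) (s a) (d a) := by
  unfold SS
  exact hs.abs.mul (Real.continuous_sinc.comp ((hb.mul hs).mul hd))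

lemma one_le_bet (t : ℝ) : 1 ≤ bet t := by
  unfold bet; exact Real.one_le_sqrt.mpr (by nlinarith [sq_nonneg t])

lemma bet_pos (t : ℝ) : 0 < bet t := lt_of_lt_of_le one_pos (one_le_bet t)

lemma abs_le_two_bet (t : ℝ) : |t| ≤ 2 * bet t := by
  have : |t| / 2 ≤ bet t := by
    unfold bet; apply Real.le_sqrt_of_sq_le; rw [div_pow, sq_abs]; linarith
  linarith

lemma bet_le (t : ℝ) : bet t ≤ 1 + |t| / 2 := by
  unfold bet
  apply Real.sqrt_le_iff.mpr
  constructor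
  · positivity
  · nlinarith [sq_abs t, abs_nonneg t]

lemma bet_neg (t : ℝ) : bet (-t) = bet t := by simp [bet]

lemma bet_mono {s t : ℝ} (h : |s| ≤ |t|) : bet s ≤ bet t := by
  unfold bet; apply Real.sqrt_le_sqrt
  have := sq_le_sq.mpr h
  linarith

lemma continuous_bet : Continuous bet := by unfold bet; fun_prop

lemma lintegral_mul_sq_le {α : Type*} [MeasurableSpace α] {μ : Measure α} {f g : α → ENNReal}
    (hf : AEMeasurable f μ) (hg : AEMeasurable g μ) :
    (∫⁻ a, f a * g a ∂μ) ^ 2 ≤ (∫⁻ a, f a ^ 2 ∂μ) * ∫⁻ a, g a ^ 2 ∂μ := by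
  have h := ENNReal.lintegral_mul_le_Lp_mul_Lq μ Real.HolderConjugate.two_two hf hg
  simp only [ENNReal.rpow_two, Pi.mul_apply] at h
  calc (∫⁻ a, f a * g a ∂μ) ^ 2
      ≤ ((∫⁻ a, f a ^ 2 ∂μ) ^ (1 / 2 : ℝ) * (∫⁻ a, g a ^ 2 ∂μ) ^ (1 / 2 : ℝ)) ^ 2 := by gcongr
    _ = _ := by
      rw [mul_pow, ← ENNReal.rpow_two, ← ENNReal.rpow_two, ← ENNReal.rpow_mul, ← ENNReal.rpow_mul]
      norm_num

/-- The square of the `L²` norm. -/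
def nsq {α : Type*} [MeasureSpace α] (f : α → ℂ) : ENNReal := ∫⁻ x, ‖f x‖ₑ ^ 2

/-- Measurable and locally bounded functions. -/
structure LocBdd {E : Type*} [Norm E] [MeasurableSpace E] (f : E → ℂ) : Prop where
  meas : Measurable f
  bdd : ∀ R : ℝ, ∃ B : ℝ, ∀ x, ‖x‖ ≤ R → ‖f x‖ ≤ B

/-- Measurable bounded functions of bounded support. -/
structure Nice {E : Type*} [Norm E] [MeasurableSpace E] (f : E → ℂ) : Prop extends LocBdd f where
  supp : ∃ R : ℝ, ∀ x, R < ‖x‖ → f x = 0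

section

variable {E F : Type*} [NormedAddCommGroup E] [MeasurableSpace E] [NormedAddCommGroup F]
  [MeasurableSpace F]

lemma LocBdd.mul {f g : E → ℂ} (hf : LocBdd f) (hg : LocBdd g) : LocBdd fun x => f x * g x := by
  refine ⟨hf.meas.mul hg.meas, fun R => ?_⟩
  obtain ⟨A, hA⟩ := hf.bdd R
  obtain ⟨B, hB⟩ := hg.bdd R
  refine ⟨A * B, fun x hx => ?_⟩
  rw [norm_mul]
  exact mul_le_mul (hA x hx) (hB x hx) (norm_nonneg _) ((norm_nonneg _).trans (hA x hx))

lemma LocBdd.add {f g : E → ℂ} (hf : LocBdd f) (hg : LocBdd g) : LocBdd fun x => f x + g x := by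
  refine ⟨hf.meas.add hg.meas, fun R => ?_⟩
  obtain ⟨A, hA⟩ := hf.bdd R
  obtain ⟨B, hB⟩ := hg.bdd R
  exact ⟨A + B, fun x hx => (norm_add_le _ _).trans (add_le_add (hA x hx) (hB x hx))⟩

lemma LocBdd.of_bound {f : E → ℂ} (hf : Measurable f) (B : ℝ) (h : ∀ x, ‖f x‖ ≤ B) : LocBdd f :=
  ⟨hf, fun _ => ⟨B, fun x _ => h x⟩⟩

lemma LocBdd.const (c : ℂ) : LocBdd fun _ : E => c :=
  .of_bound measurable_const ‖c‖ fun _ => le_rfl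

lemma LocBdd.star {f : E → ℂ} (hf : LocBdd f) : LocBdd fun x => (starRingEnd ℂ) (f x) :=
  ⟨by exact (Complex.continuous_conj.measurable).comp hf.meas,
    fun R => (hf.bdd R).imp fun _ h x hx => by simpa using h x hx⟩

lemma LocBdd.of_continuous [ProperSpace E] [OpensMeasurableSpace E] {f : E → ℂ}
    (hf : Continuous f) : LocBdd f := by
  refine ⟨hf.measurable, fun R => ?_⟩
  obtain ⟨B, hB⟩ := (isCompact_closedBall (0 : E) R).exists_bound_of_continuousOn hf.continuousOn
  exact ⟨B, fun x hx => hB x (by simpa using hx)⟩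

lemma LocBdd.comp [ProperSpace E] [OpensMeasurableSpace E] [OpensMeasurableSpace F]
    [BorelSpace F] {f : F → ℂ} (hf : LocBdd f) {g : E → F} (hg : Continuous g) :
    LocBdd fun x => f (g x) := by
  refine ⟨hf.meas.comp hg.measurable, fun R => ?_⟩
  obtain ⟨B, hB⟩ := (isCompact_closedBall (0 : E) R).exists_bound_of_continuousOn hg.continuousOn
  obtain ⟨B', hB'⟩ := hf.bdd B
  exact ⟨B', fun x hx => hB' _ (hB x (by simpa using hx))⟩

lemma LocBdd.indicator {s : Set E} (hs : MeasurableSet s) :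
    LocBdd (s.indicator fun _ => (1 : ℂ)) :=
  .of_bound (measurable_const.indicator hs) 1 fun x => by
    classical
    rw [Set.indicator_apply]; split_ifs <;> simp

lemma Nice.bounded {f : E → ℂ} (hf : Nice f) : ∃ B : ℝ, 0 ≤ B ∧ ∀ x, ‖f x‖ ≤ B := by
  obtain ⟨R, hR⟩ := hf.supp
  obtain ⟨B, hB⟩ := hf.bdd R
  refine ⟨max B 0, le_max_right _ _, fun x => ?_⟩
  rcases le_or_gt ‖x‖ R with h | h
  · exact (hB x h).trans (le_max_left _ _)
  · simp [hR x h]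

lemma Nice.mul_left {f g : E → ℂ} (hg : Nice g) (hf : LocBdd f) : Nice fun x => f x * g x :=
  ⟨hf.mul hg.toLocBdd, hg.supp.imp fun _ h x hx => by simp [h x hx]⟩

lemma Nice.mul_right {f g : E → ℂ} (hf : Nice f) (hg : LocBdd g) : Nice fun x => f x * g x :=
  ⟨hf.toLocBdd.mul hg, hf.supp.imp fun _ h x hx => by simp [h x hx]⟩

lemma Nice.add {f g : E → ℂ} (hf : Nice f) (hg : Nice g) : Nice fun x => f x + g x := by
  refine ⟨hf.toLocBdd.add hg.toLocBdd, ?_⟩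
  obtain ⟨R, hR⟩ := hf.supp
  obtain ⟨R', hR'⟩ := hg.supp
  refine ⟨max R R', fun x hx => ?_⟩
  rw [hR x ((le_max_left _ _).trans_lt hx), hR' x ((le_max_right _ _).trans_lt hx), add_zero]

lemma Nice.zero : Nice fun _ : E => (0 : ℂ) := ⟨.const 0, 0, fun _ _ => rfl⟩

lemma Nice.const_mul {f : E → ℂ} (hf : Nice f) (c : ℂ) : Nice fun x => c * f x :=
  hf.mul_left (.const c)

lemma Nice.star {f : E → ℂ} (hf : Nice f) : Nice fun x => (starRingEnd ℂ) (f x) :=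
  ⟨hf.toLocBdd.star, hf.supp.imp fun _ h x hx => by simp [h x hx]⟩

lemma Nice.of_fst_snd {f : E × F → ℂ} (hf : LocBdd f) {R R' : ℝ}
    (h : ∀ x y, f (x, y) ≠ 0 → ‖x‖ ≤ R ∧ ‖y‖ ≤ R') : Nice f := by
  refine ⟨hf, max R R', fun x hx => ?_⟩
  by_contra h0
  have := h x.1 x.2 h0
  exact absurd (max_le_max this.1 this.2) (not_le.mpr hx)

lemma Nice.apply_prodMk {f : E × F → ℂ} (hf : Nice f) (x : E) : Nice fun y => f (x, y) := by
  obtain ⟨B, hB, h⟩ := hf.bounded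
  obtain ⟨R, hR⟩ := hf.supp
  exact ⟨.of_bound (hf.meas.comp measurable_prodMk_left) B fun y => h _,
    R, fun y hy => hR _ (hy.trans_le (le_max_right _ _))⟩

end

section

variable {E : Type*} [NormedAddCommGroup E] [MeasureSpace E]
  [ProperSpace E] [IsFiniteMeasureOnCompacts (volume : Measure E)]

lemma Nice.integrable {f : E → ℂ} (hf : Nice f) : Integrable f := by
  obtain ⟨B, hB, h⟩ := hf.bounded
  obtain ⟨R, hR⟩ := hf.supp
  have h1 : IntegrableOn f (Metric.closedBall 0 R) :=
    Measure.integrableOn_of_bounded (isCompact_closedBall _ _).measure_lt_top.ne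
      hf.meas.aestronglyMeasurable (Filter.Eventually.of_forall h)
  exact (integrableOn_iff_integrable_of_support_subset (by
    intro x hx
    by_contra hc
    exact hx (hR x (by simpa using hc)))).mp h1

lemma Nice.memLp {f : E → ℂ} (hf : Nice f) (p : ENNReal) : MemLp f p := by
  obtain ⟨B, hB, h⟩ := hf.bounded
  exact MemLp.mono_exponent_of_measure_support_ne_top
    (memLp_top_of_bound hf.meas.aestronglyMeasurable B (Filter.Eventually.of_forall h))
    (s := Metric.closedBall 0 hf.supp.choose)
    (fun x hx => hf.supp.choose_spec x (by simpa using hx))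
    (isCompact_closedBall _ _).measure_lt_top.ne le_top

lemma Nice.nsq_lt_top {f : E → ℂ} (hf : Nice f) : nsq f < ⊤ := by
  have h := ((hf.star).mul_left hf.toLocBdd).integrable.hasFiniteIntegral
  unfold nsq
  refine lt_of_eq_of_lt ?_ h
  congr 1; ext x
  rw [enorm_mul, pow_two]; simp

lemma enorm_integral_mul_sq_le {E : Type*} [MeasureSpace E] {f g : E → ℂ} (hf : AEMeasurable f) (hg : AEMeasurable g) :
    ‖∫ x, f x * g x‖ₑ ^ 2 ≤ nsq f * nsq g := by
  refine le_trans ?_ (lintegral_mul_sq_le hf.enorm hg.enorm)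
  gcongr
  refine (enorm_integral_le_lintegral_enorm _).trans_eq ?_
  simp only [enorm_mul]

lemma nsq_eq_enorm_integral {f : E → ℂ} (hf : Nice f) :
    nsq f = ‖∫ x, f x * (starRingEnd ℂ) (f x)‖ₑ := by
  have h0 : ∀ x, f x * (starRingEnd ℂ) (f x) = ((‖f x‖ ^ 2 : ℝ) : ℂ) := by
    intro x; rw [Complex.mul_conj']; norm_cast
  have hi : Integrable fun x => ‖f x‖ ^ 2 := by
    have := ((hf.star).mul_left hf.toLocBdd).integrable.norm
    refine this.congr (Filter.Eventually.of_forall fun x => ?_)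
    simp [pow_two]
  rw [funext h0, integral_complex_ofReal, ← ofReal_norm, Complex.norm_real,
    Real.norm_of_nonneg (integral_nonneg fun x => by positivity),
    ofReal_integral_eq_lintegral_ofReal hi (Filter.Eventually.of_forall fun x => by positivity)]
  unfold nsq
  congr 1; ext x
  rw [ENNReal.ofReal_pow (norm_nonneg _), ofReal_norm]

lemma nsq_star {E : Type*} [MeasureSpace E] (f : E → ℂ) : nsq (fun x => (starRingEnd ℂ) (f x)) = nsq f := by
  unfold nsq; simp

lemma nsq_le_of_dual {f : E → ℂ} (hf : Nice f) {B : ENNReal}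
    (h : ∀ g : E → ℂ, Nice g → ‖∫ x, f x * g x‖ₑ ^ 2 ≤ B * nsq g) : nsq f ≤ B := by
  have h1 := h _ hf.star
  rw [← nsq_eq_enorm_integral hf, nsq_star, pow_two] at h1
  by_cases h0 : nsq f = 0
  · rw [h0]; exact zero_le
  · exact (ENNReal.mul_le_mul_iff_left h0 hf.nsq_lt_top.ne).mp h1

lemma Nice.integral_right {F : Type*} [NormedAddCommGroup F] [MeasurableSpace F] [SFinite (volume : Measure E)]
    {f : F × E → ℂ} (hf : Nice f) : Nice fun x => ∫ y, f (x, y) := by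
  obtain ⟨B, hB, h⟩ := hf.bounded
  obtain ⟨R, hR⟩ := hf.supp
  refine ⟨.of_bound (hf.meas.stronglyMeasurable.integral_prod_right').measurable
    (B * volume.real (Metric.closedBall (0 : E) R)) fun x => ?_, R, fun x hx => ?_⟩
  · have : ∫ y, f (x, y) = ∫ y in Metric.closedBall (0 : E) R, f (x, y) := by
      rw [setIntegral_eq_integral_of_forall_compl_eq_zero]
      intro y hy
      exact hR _ ((by simpa using hy : R < ‖y‖).trans_le (le_max_right _ _))
    rw [this]
    exact norm_setIntegral_le_of_norm_le_const (isCompact_closedBall _ _).measure_lt_top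
      fun y _ => h _
  · rw [← integral_zero E ℂ]
    congr 1; ext y
    exact hR _ (hx.trans_le (le_max_left _ _))

end

lemma schur_sq {α β : Type*} [MeasurableSpace α] [MeasurableSpace β] {μ : Measure α}
    {ν : Measure β} [SFinite μ] [SFinite ν] {f : α → ENNReal} {g : β → ENNReal}
    {k : α × β → ENNReal} (hf : Measurable f) (hg : Measurable g) (hk : Measurable k)
    {A B : ENNReal} (hA : ∀ x, ∫⁻ y, k (x, y) ∂ν ≤ A) (hB : ∀ y, ∫⁻ x, k (x, y) ∂μ ≤ B) :
    (∫⁻ x, ∫⁻ y, f x * k (x, y) * g y ∂ν ∂μ) ^ 2 ≤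
      A * B * (∫⁻ x, f x ^ 2 ∂μ) * ∫⁻ y, g y ^ 2 ∂ν := by
  have hm : Measurable fun z : α × β => f z.1 * k z ^ (1 / 2 : ℝ) := by fun_prop
  have hm' : Measurable fun z : α × β => k z ^ (1 / 2 : ℝ) * g z.2 := by fun_prop
  have hk2 : ∀ z, (k z ^ (1 / 2 : ℝ)) ^ 2 = k z := by
    intro z; rw [← ENNReal.rpow_two, ← ENNReal.rpow_mul]; norm_num
  have e1 : ∫⁻ x, ∫⁻ y, f x * k (x, y) * g y ∂ν ∂μ =
      ∫⁻ z, (f z.1 * k z ^ (1 / 2 : ℝ)) * (k z ^ (1 / 2 : ℝ) * g z.2) ∂(μ.prod ν) := by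
    rw [lintegral_prod _ (by fun_prop)]
    congr 1; ext x; congr 1; ext y
    conv_lhs => rw [← hk2 (x, y)]
    ring
  rw [e1]
  refine (lintegral_mul_sq_le hm.aemeasurable hm'.aemeasurable).trans ?_
  simp only [mul_pow, hk2]
  rw [lintegral_prod _ (by fun_prop), lintegral_prod_symm _ (by fun_prop)]
  have a1 : ∫⁻ x, ∫⁻ y, f x ^ 2 * k (x, y) ∂ν ∂μ ≤ (∫⁻ x, f x ^ 2 ∂μ) * A := by
    rw [← lintegral_mul_const _ (by fun_prop)]
    refine lintegral_mono fun x => ?_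
    rw [lintegral_const_mul _ (by fun_prop)]
    gcongr; exact hA x
  have a2 : ∫⁻ y, ∫⁻ x, k (x, y) * g y ^ 2 ∂μ ∂ν ≤ B * (∫⁻ y, g y ^ 2 ∂ν) := by
    rw [← lintegral_const_mul _ (by fun_prop)]
    refine lintegral_mono fun y => ?_
    rw [lintegral_mul_const _ (by fun_prop)]
    gcongr; exact hB y
  calc _ ≤ _ := mul_le_mul' a1 a2
    _ = _ := by ring

section Plancherel

open FourierTransform SchwartzMap

lemma fourier_toLp_ae_eq {f : ℝ → ℂ} (hf : Integrable f) (hf2 : MemLp f 2) :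
    (𝓕 (hf2.toLp f) : Lp ℂ 2 (volume : Measure ℝ)) =ᵐ[volume] 𝓕 f := by
  have hcont : Continuous (𝓕 f) := by
    exact VectorFourier.fourierIntegral_continuous Real.continuous_fourierChar
      (by exact continuous_inner) hf
  refine ae_eq_of_integral_contDiff_smul_eq ?_ hcont.locallyIntegrable ?_
  · exact (Lp.memLp _).locallyIntegrable (by norm_num)
  · intro g g_smooth g_cpt
    have hg₁ : HasCompactSupport (Complex.ofRealCLM ∘ g) := g_cpt.comp_left rfl
    have hg₂ : ContDiff ℝ (⊤ : ℕ∞) (Complex.ofRealCLM ∘ g) := by fun_prop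
    set G : 𝓢(ℝ, ℂ) := hg₁.toSchwartzMap hg₂ with hG
    have hGg : ∀ x, G x = (g x : ℂ) := fun x => by simp [hG]
    have e1 : ∫ x, g x • (𝓕 (hf2.toLp f) : Lp ℂ 2 (volume : Measure ℝ)) x =
        Lp.toTemperedDistribution (𝓕 (hf2.toLp f)) G := by
      rw [Lp.toTemperedDistribution_apply]; simp [hGg]
    rw [e1, ← Lp.fourier_toTemperedDistribution_eq, TemperedDistribution.fourier_apply,
      Lp.toTemperedDistribution_apply]
    have e2 : ∫ x, (𝓕 G) x • (hf2.toLp f) x = ∫ x, 𝓕 (G : ℝ → ℂ) x • f x := by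
      refine integral_congr_ae ?_
      filter_upwards [hf2.coeFn_toLp] with x hx
      rw [hx, SchwartzMap.fourier_coe]
    rw [e2]
    have e3 := VectorFourier.integral_fourierIntegral_smul_eq_flip (μ := volume) (ν := volume)
      (L := innerₗ ℝ) Real.continuous_fourierChar (by exact continuous_inner) G.integrable hf
    have e4 : ∫ x, 𝓕 (G : ℝ → ℂ) x • f x = ∫ x, G x • 𝓕 f x := by
      simpa using! e3
    rw [e4]
    simp [hGg]

lemma integral_mul_conj_fourier {f g : ℝ → ℂ} (hf : Nice f) (hg : Nice g) :
    ∫ x, f x * (starRingEnd ℂ) (g x) = ∫ ξ, 𝓕 f ξ * (starRingEnd ℂ) (𝓕 g ξ) := by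
  have h := Lp.inner_fourier_eq ((hg.memLp 2).toLp g) ((hf.memLp 2).toLp f)
  rw [L2.inner_def, L2.inner_def] at h
  have e1 : ∫ x, f x * (starRingEnd ℂ) (g x) =
      ∫ x, inner ℂ ((hg.memLp 2).toLp g x) ((hf.memLp 2).toLp f x) := by
    refine integral_congr_ae ?_
    filter_upwards [(hf.memLp 2).coeFn_toLp, (hg.memLp 2).coeFn_toLp] with x h1 h2
    rw [h1, h2]; simp
  rw [e1, ← h]
  refine integral_congr_ae ?_
  filter_upwards [fourier_toLp_ae_eq hf.integrable (hf.memLp 2),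
    fourier_toLp_ae_eq hg.integrable (hg.memLp 2)] with x h1 h2
  rw [h1, h2]; simp

lemma nsq_fourier {f : ℝ → ℂ} (hf : Nice f) : nsq (𝓕 f) = nsq f := by
  have h := Lp.norm_fourier_eq ((hf.memLp 2).toLp f)
  rw [Lp.norm_def, Lp.norm_def] at h
  have h1 := (ENNReal.toReal_eq_toReal_iff' (Lp.eLpNorm_ne_top _) (Lp.eLpNorm_ne_top _)).mp h
  rw [eLpNorm_congr_ae (fourier_toLp_ae_eq hf.integrable (hf.memLp 2)),
    eLpNorm_congr_ae (hf.memLp 2).coeFn_toLp] at h1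
  have key : ∀ g : ℝ → ℂ, nsq g = eLpNorm g 2 volume ^ 2 := by
    intro g
    rw [eLpNorm_eq_lintegral_rpow_enorm_toReal (by norm_num) (by norm_num)]
    unfold nsq
    rw [← ENNReal.rpow_two, ← ENNReal.rpow_mul]
    simp
  rw [key, key, h1]

open Convolution in
lemma fourier_conv {k h : ℝ → ℂ} (hk : Nice k) (hh : Nice h) (ξ : ℝ) :
    𝓕 (fun y => ∫ x, k (y - x) * h x) ξ = 𝓕 k ξ * 𝓕 h ξ := by
  rw [← Real.fourier_mul_convolution_eq hk.integrable hh.integrable]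
  have : (fun y => ∫ x, k (y - x) * h x) = k ⋆[ContinuousLinearMap.mul ℂ ℂ] h := by
    ext y
    rw [convolution_eq_swap]
    rfl
  rw [this]

lemma fourier_eq_exp (f : ℝ → ℂ) (ξ : ℝ) :
    𝓕 f ξ = ∫ x, Complex.exp (Complex.I * (-(2 * Real.pi * ξ) * x : ℝ)) * f x := by
  rw [Real.fourier_eq']
  congr 1; ext x
  rw [smul_eq_mul]
  congr 2
  simp; ring

end Plancherel

lemma norm_exp_I_mul (x : ℝ) : ‖Complex.exp (Complex.I * (x : ℝ))‖ = 1 := by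
  rw [mul_comm]; exact Complex.norm_exp_ofReal_mul_I x

lemma hasDerivAt_exp_I {φ : ℝ → ℝ} {φ' x : ℝ} (h : HasDerivAt φ φ' x) :
    HasDerivAt (fun x => Complex.exp (Complex.I * (φ x : ℝ)))
      (Complex.exp (Complex.I * (φ x : ℝ)) * (Complex.I * (φ' : ℝ))) x :=
  (h.ofReal_comp.const_mul Complex.I).cexp

/-- Rapid decay of oscillatory integrals, locally uniformly over a smooth family of amplitudes. -/
lemma exists_pow_mul_norm_integral_exp_le {E : Type*} [NormedAddCommGroup E] [NormedSpace ℝ E]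
    {P : Set E} (hP : IsCompact P) {R : ℝ} (hR : 0 < R) (m : ℕ) (F : E × ℝ → ℂ)
    (hF : ContDiff ℝ (⊤ : ℕ∞) F) (hs : ∀ p z, R < |z| → F (p, z) = 0) :
    ∃ C : ℝ, 0 ≤ C ∧ ∀ p ∈ P, ∀ ω : ℝ,
      |ω| ^ m * ‖∫ z, F (p, z) * Complex.exp (Complex.I * (ω * z : ℝ))‖ ≤ C := by
  induction m generalizing F with
  | zero =>
    obtain ⟨B, hB⟩ := (hP.prod (isCompact_Icc (a := -R) (b := R))).exists_bound_of_continuousOn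
      hF.continuous.continuousOn
    refine ⟨max B 0 * (2 * R), by positivity, fun p hp ω => ?_⟩
    have e : ∫ z, F (p, z) * Complex.exp (Complex.I * (ω * z : ℝ)) =
        ∫ z in Set.Icc (-R) R, F (p, z) * Complex.exp (Complex.I * (ω * z : ℝ)) := by
      rw [setIntegral_eq_integral_of_forall_compl_eq_zero]
      intro z hz
      rw [hs p z, zero_mul]
      by_contra! hc
      exact hz (abs_le.mp hc)
    rw [pow_zero, one_mul, e]
    refine (norm_setIntegral_le_of_norm_le_const (C := max B 0) (by simp) ?_).trans ?_
    · intro z hz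
      rw [norm_mul, norm_exp_I_mul, mul_one]
      exact (hB (p, z) ⟨hp, hz⟩).trans (le_max_left _ _)
    · rw [measureReal_def, Real.volume_Icc, ENNReal.toReal_ofReal (by linarith)]
      exact le_of_eq (by ring)
  | succ m ih =>
    set G : E × ℝ → ℂ := fun q => fderiv ℝ F q (0, 1) with hG
    have hGs : ContDiff ℝ (⊤ : ℕ∞) G :=
      (hF.fderiv_right (m := (⊤ : ℕ∞)) (by norm_cast)).clm_apply contDiff_const
    have hder : ∀ p z, HasDerivAt (fun z => F (p, z)) (G (p, z)) z := by
      intro p z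
      have h1 : HasFDerivAt F (fderiv ℝ F (p, z)) (p, z) :=
        (hF.differentiable (by simp)).differentiableAt.hasFDerivAt
      exact h1.comp_hasDerivAt z ((hasDerivAt_const z p).prodMk (hasDerivAt_id z))
    have hG0 : ∀ p z, R < |z| → G (p, z) = 0 := by
      intro p z hz
      have h1 : (fun z => F (p, z)) =ᶠ[nhds z] fun _ => 0 := by
        filter_upwards [(isOpen_lt continuous_const continuous_abs).mem_nhds hz] with y hy
        exact hs p y hy
      exact (hder p z).unique ((hasDerivAt_const z (0 : ℂ)).congr_of_eventuallyEq h1)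
    obtain ⟨C, hC, h⟩ := ih G hGs hG0
    refine ⟨C, hC, fun p hp ω => ?_⟩
    have hnice : ∀ H : E × ℝ → ℂ, ContDiff ℝ (⊤ : ℕ∞) H → (∀ p z, R < |z| → H (p, z) = 0) →
        Nice fun z => H (p, z) := fun H hH h0 =>
      ⟨.of_continuous (hH.continuous.comp (by fun_prop)), R, fun z hz => h0 p z hz⟩
    have hexp : LocBdd fun z : ℝ => Complex.exp (Complex.I * (ω * z : ℝ)) :=
      .of_continuous (by fun_prop)
    have hibp := integral_mul_deriv_eq_deriv_mul_of_integrable (A := ℂ) (fun z _ => hder p z)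
      (fun z _ => hasDerivAt_exp_I (φ := fun z => ω * z) (by simpa using (hasDerivAt_id z).const_mul ω))
      ((hnice F hF hs).mul_right (hexp.mul (.const _))).integrable
      ((hnice G hGs hG0).mul_right hexp).integrable
      ((hnice F hF hs).mul_right hexp).integrable
    have h2 : |ω| * ‖∫ z, F (p, z) * Complex.exp (Complex.I * (ω * z : ℝ))‖ =
        ‖∫ z, G (p, z) * Complex.exp (Complex.I * (ω * z : ℝ))‖ := by
      rw [← norm_neg (∫ z, G (p, z) * _), ← hibp]
      simp only [← mul_assoc]
      rw [integral_mul_const]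
      rw [integral_mul_const, norm_mul, norm_mul]
      simp [mul_comm]
    rw [pow_succ, mul_assoc, h2]
    exact h p hp ω

lemma sinc_eq_integral (v : ℝ) :
    ((Real.sinc v : ℝ) : ℂ) = 1 / 2 * ∫ η in (-1 : ℝ)..1, Complex.exp (Complex.I * (η * v : ℝ)) := by
  by_cases hv : v = 0
  · subst hv; norm_num
  have hc : Complex.I * v ≠ 0 := mul_ne_zero Complex.I_ne_zero (by exact_mod_cast hv)
  have h := integral_exp_mul_complex (a := -1) (b := 1) hc
  have e : ∀ η : ℝ, Complex.exp (Complex.I * (η * v : ℝ)) = Complex.exp (Complex.I * v * η) := by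
    intro η; congr 1; push_cast; ring
  simp only [e]
  rw [h, Real.sinc_of_ne_zero hv]
  push_cast
  rw [Complex.sin]
  have hv' : (v : ℂ) ≠ 0 := by exact_mod_cast hv
  field_simp
  ring_nf
  simp

/-- A uniform integrable majorant for the Fourier transform of the cut-off. -/
lemma exists_norm_integral_chi_exp_le : ∃ C : ℝ, 0 ≤ C ∧ ∀ ω : ℝ,
    ‖∫ z, (chi z : ℂ) * Complex.exp (Complex.I * (ω * z : ℝ))‖ ≤ C * (1 + ω ^ 2)⁻¹ := by
  have hF : ContDiff ℝ (⊤ : ℕ∞) fun q : ℝ × ℝ => (chi q.2 : ℂ) :=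
    Complex.ofRealCLM.contDiff.comp (contDiff_chi.comp contDiff_snd)
  have hs : ∀ p z : ℝ, 1 < |z| → (fun q : ℝ × ℝ => (chi q.2 : ℂ)) (p, z) = 0 := by
    intro p z hz; simp [chi_eq_zero hz.le]
  obtain ⟨A, hA, h0⟩ := exists_pow_mul_norm_integral_exp_le (isCompact_singleton (x := (0 : ℝ)))
    one_pos 0 _ hF hs
  obtain ⟨B, hB, h2⟩ := exists_pow_mul_norm_integral_exp_le (isCompact_singleton (x := (0 : ℝ)))
    one_pos 2 _ hF hs
  refine ⟨A + B, by positivity, fun ω => ?_⟩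
  have e0 := h0 0 rfl ω
  have e2 := h2 0 rfl ω
  simp only [sq_abs] at e0 e2
  rw [← div_eq_mul_inv, le_div_iff₀ (by positivity)]
  nlinarith

lemma exists_norm_integral_SS_chi_le : ∃ C : ℝ, 0 ≤ C ∧ ∀ b δ l ν : ℝ, 0 < b → 0 < δ →
    ‖∫ d, Complex.exp (Complex.I * (ν * d : ℝ)) * (SS b l d : ℂ) * (chi (d / δ) : ℂ)‖ ≤ C / b := by
  obtain ⟨C, hC, h⟩ := exists_norm_integral_chi_exp_le
  refine ⟨C * Real.pi, by positivity, fun b δ l ν hb hδ => ?_⟩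
  set κ := b * l * δ with hκ
  set ω := ν * δ with hω
  have hscale : ∫ d, Complex.exp (Complex.I * (ν * d : ℝ)) * (SS b l d : ℂ) * (chi (d / δ) : ℂ) =
      (δ * |l| / 2 : ℝ) * ∫ η in (-1 : ℝ)..1,
        ∫ z, (chi z : ℂ) * Complex.exp (Complex.I * ((κ * η + ω) * z : ℝ)) := by
    have e1 := Measure.integral_comp_mul_left
      (fun d : ℝ => Complex.exp (Complex.I * (ν * d : ℝ)) * (SS b l d : ℂ) * (chi (d / δ) : ℂ)) δ
    rw [abs_inv, abs_of_pos hδ] at e1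
    have e2 : ∫ d, Complex.exp (Complex.I * (ν * d : ℝ)) * (SS b l d : ℂ) * (chi (d / δ) : ℂ) =
        δ • ∫ z : ℝ, Complex.exp (Complex.I * (ν * (δ * z) : ℝ)) * (SS b l (δ * z) : ℂ) *
          (chi (δ * z / δ) : ℂ) := by
      rw [e1, smul_smul, mul_inv_cancel₀ hδ.ne', one_smul]
    have e3 : ∀ z : ℝ, Complex.exp (Complex.I * (ν * (δ * z) : ℝ)) * (SS b l (δ * z) : ℂ) *
          (chi (δ * z / δ) : ℂ) = (|l| / 2 : ℝ) * ∫ η in (-1 : ℝ)..1,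
            (chi z : ℂ) * Complex.exp (Complex.I * ((κ * η + ω) * z : ℝ)) := by
      intro z
      rw [mul_div_cancel_left₀ _ hδ.ne', SS]
      push_cast
      rw [sinc_eq_integral, intervalIntegral.integral_const_mul]
      have : ∀ η : ℝ, Complex.exp (Complex.I * (((κ * η + ω) * z : ℝ) : ℂ)) =
          Complex.exp (Complex.I * (ν * (δ * z) : ℝ)) *
            Complex.exp (Complex.I * (η * (b * l * (δ * z)) : ℝ)) := by
        intro η; rw [← Complex.exp_add]; congr 1; push_cast [hκ, hω]; ring
      have h' : ∀ η : ℝ, Complex.exp (Complex.I * ((κ * η + ω) * z)) =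
          Complex.exp (Complex.I * (ν * (δ * z) : ℝ)) *
            Complex.exp (Complex.I * (η * (b * l * (δ * z)) : ℝ)) := by
        intro η; rw [← this]; push_cast; rfl
      simp only [h']
      rw [intervalIntegral.integral_const_mul]
      push_cast
      ring
    rw [e2]
    simp only [e3]
    rw [integral_const_mul]
    rw [intervalIntegral.integral_of_le (by norm_num : (-1 : ℝ) ≤ 1)]
    simp only [intervalIntegral.integral_of_le (by norm_num : (-1 : ℝ) ≤ 1)]
    rw [integral_integral_swap]
    · rw [Complex.real_smul, ← mul_assoc]; push_cast; ring
    · have hm : Measurable fun q : ℝ × ℝ =>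
          (chi q.1 : ℂ) * Complex.exp (Complex.I * ((κ * q.2 + ω) * q.1 : ℝ)) := by
        have := continuous_chi
        exact Continuous.measurable (by fun_prop)
      have hb : Integrable fun z : ℝ => (chi z : ℂ) := by
        have : Nice fun z : ℝ => (chi z : ℂ) := ⟨.of_continuous (by
          have := continuous_chi; fun_prop), 1, fun z hz => by
            rw [chi_eq_zero (by simpa using hz.le)]; simp⟩
        exact this.integrable
      refine Integrable.mono' (hb.norm.mul_prod (integrable_const (1 : ℝ))) hm.aestronglyMeasurable
        (Filter.Eventually.of_forall fun q => ?_)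
      simp only [Function.uncurry]
      rw [norm_mul, norm_exp_I_mul]
  rw [hscale, norm_mul]
  have hint : ‖∫ η in (-1 : ℝ)..1,
      ∫ z, (chi z : ℂ) * Complex.exp (Complex.I * ((κ * η + ω) * z : ℝ))‖ * |κ| ≤ C * Real.pi := by
    by_cases hk : κ = 0
    · rw [hk]; simp; positivity
    have hg : Integrable fun η : ℝ => C * (1 + (κ * η + ω) ^ 2)⁻¹ := by
      have h1 : Integrable fun η : ℝ => (1 + (η + ω) ^ 2)⁻¹ :=
        integrable_inv_one_add_sq.comp_add_right ω
      exact (h1.comp_mul_left' hk).const_mul C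
    have hb : ‖∫ η in (-1 : ℝ)..1,
      ∫ z, (chi z : ℂ) * Complex.exp (Complex.I * ((κ * η + ω) * z : ℝ))‖ ≤
        ∫ η : ℝ, C * (1 + (κ * η + ω) ^ 2)⁻¹ := by
      refine (intervalIntegral.norm_integral_le_of_norm_le (by norm_num)
        (Filter.Eventually.of_forall fun η _ => h (κ * η + ω)) hg.intervalIntegrable).trans ?_
      rw [intervalIntegral.integral_of_le (by norm_num)]
      exact setIntegral_le_integral hg (Filter.Eventually.of_forall fun η => by positivity)
    have hv : ∫ η : ℝ, C * (1 + (κ * η + ω) ^ 2)⁻¹ = C * (|κ|⁻¹ * Real.pi) := by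
      rw [integral_const_mul, Measure.integral_comp_mul_left (fun v : ℝ => (1 + (v + ω) ^ 2)⁻¹) κ,
        integral_add_right_eq_self (fun v : ℝ => (1 + v ^ 2)⁻¹), integral_univ_inv_one_add_sq,
        abs_inv, smul_eq_mul]
    rw [hv] at hb
    calc _ ≤ C * (|κ|⁻¹ * Real.pi) * |κ| := by gcongr
      _ = C * Real.pi := by
        have : |κ| ≠ 0 := abs_ne_zero.mpr hk
        field_simp
  have hk : |κ| = b * |l| * δ := by rw [hκ, abs_mul, abs_mul, abs_of_pos hb, abs_of_pos hδ]
  rw [hk] at hint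
  rw [le_div_iff₀ hb, Complex.norm_real, Real.norm_of_nonneg (by positivity)]
  have := norm_nonneg (∫ η in (-1 : ℝ)..1,
      ∫ z, (chi z : ℂ) * Complex.exp (Complex.I * ((κ * η + ω) * z : ℝ)))
  nlinarith [Real.pi_pos]

lemma norm_exp_I_sub_one_le (x : ℝ) : ‖Complex.exp (Complex.I * (x : ℝ)) - 1‖ ≤ |x| := by
  exact Real.norm_exp_I_mul_ofReal_sub_one_le

lemma exists_norm_integral_frozen_le : ∃ C : ℝ, 0 ≤ C ∧ ∀ b δ l ν α : ℝ, 0 < b → 0 < δ →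
    ‖∫ d, Complex.exp (Complex.I * (ν * d + α * d ^ 2 : ℝ)) * (SS b (l - d) d : ℂ) *
      (chi (d / δ) : ℂ)‖ ≤ C * (1 / b * (1 + b * δ ^ 2 + |α| * δ ^ 2)) := by
  obtain ⟨C, hC, h⟩ := exists_norm_integral_SS_chi_le
  refine ⟨C + 2, by positivity, fun b δ l ν α hb hδ => ?_⟩
  have hcs := @continuous_SS ℝ _
  have hcc := continuous_chi
  have hnice : ∀ F : ℝ → ℂ, Continuous F → Nice fun d => F d * (chi (d / δ) : ℂ) := by
    intro F hF
    refine ⟨.of_continuous (by fun_prop), δ, fun d hd => ?_⟩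
    rw [chi_eq_zero, Complex.ofReal_zero, mul_zero]
    rw [abs_div, abs_of_pos hδ, le_div_iff₀ hδ, one_mul]; exact hd.le
  have hn1 : Nice fun d => Complex.exp (Complex.I * (ν * d + α * d ^ 2 : ℝ)) *
      (SS b (l - d) d : ℂ) * (chi (d / δ) : ℂ) := by
    refine hnice (fun d => Complex.exp (Complex.I * (ν * d + α * d ^ 2 : ℝ)) * (SS b (l - d) d : ℂ)) ?_
    have := hcs (b := fun _ => b) (s := fun d => l - d) (d := fun d => d) (by fun_prop)
      (by fun_prop) (by fun_prop)
    fun_prop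
  have hn2 : Nice fun d => Complex.exp (Complex.I * (ν * d : ℝ)) *
      (SS b l d : ℂ) * (chi (d / δ) : ℂ) := by
    refine hnice (fun d => Complex.exp (Complex.I * (ν * d : ℝ)) * (SS b l d : ℂ)) ?_
    have := hcs (b := fun _ => b) (s := fun d => l) (d := fun d => d) (by fun_prop)
      (by fun_prop) (by fun_prop)
    fun_prop
  have hpt : ∀ d : ℝ, ‖Complex.exp (Complex.I * (ν * d + α * d ^ 2 : ℝ)) *
      (SS b (l - d) d : ℂ) * (chi (d / δ) : ℂ) - Complex.exp (Complex.I * (ν * d : ℝ)) *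
      (SS b l d : ℂ) * (chi (d / δ) : ℂ)‖ ≤
      (Set.Icc (-δ) δ).indicator (fun _ => (|α| / b + 1) * δ) d := by
    intro d
    by_cases hd : |d| ≤ δ
    · rw [Set.indicator_of_mem (Set.mem_Icc.mpr (abs_le.mp hd))]
      have e : Complex.exp (Complex.I * (ν * d + α * d ^ 2 : ℝ)) *
          (SS b (l - d) d : ℂ) * (chi (d / δ) : ℂ) - Complex.exp (Complex.I * (ν * d : ℝ)) *
          (SS b l d : ℂ) * (chi (d / δ) : ℂ) =
          Complex.exp (Complex.I * (ν * d : ℝ)) * (chi (d / δ) : ℂ) *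
          ((Complex.exp (Complex.I * (α * d ^ 2 : ℝ)) - 1) * (SS b (l - d) d : ℂ) +
            ((SS b (l - d) d - SS b l d : ℝ) : ℂ)) := by
        have : Complex.exp (Complex.I * (ν * d + α * d ^ 2 : ℝ)) =
          Complex.exp (Complex.I * (ν * d : ℝ)) * Complex.exp (Complex.I * (α * d ^ 2 : ℝ)) := by
          rw [← Complex.exp_add]; congr 1; push_cast; ring
        rw [this]; push_cast; ring
      rw [e, norm_mul, norm_mul, norm_exp_I_mul, one_mul, Complex.norm_real]
      have h1 : ‖chi (d / δ)‖ ≤ 1 := abs_chi_le_one _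
      refine (mul_le_of_le_one_left (norm_nonneg _) h1).trans ((norm_add_le _ _).trans ?_)
      rw [norm_mul, Complex.norm_real, Complex.norm_real, Real.norm_eq_abs, Real.norm_eq_abs]
      have h2 := norm_exp_I_sub_one_le (α * d ^ 2)
      have h3 := SS_lipschitz b (l - d) l d
      have h4 := abs_SS_mul_le b (l - d) d
      rw [abs_mul, abs_of_pos hb] at h4
      rw [abs_mul, abs_pow] at h2
      have h5 : |l - d - l| = |d| := by rw [← abs_neg]; ring_nf
      rw [h5] at h3
      have h6 : |SS b (l - d) d| * |d| ≤ 1 / b := by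
        rw [le_div_iff₀ hb]; linarith
      calc _ ≤ |α| * |d| ^ 2 * |SS b (l - d) d| + |d| := by gcongr
        _ = |α| * |d| * (|SS b (l - d) d| * |d|) + |d| := by ring
        _ ≤ |α| * |d| * (1 / b) + |d| := by gcongr
        _ = (|α| / b + 1) * |d| := by ring
        _ ≤ _ := by gcongr
    · rw [Set.indicator_of_notMem (fun h => hd (abs_le.mpr (Set.mem_Icc.mp h))), chi_eq_zero]
      · simp
      · rw [abs_div, abs_of_pos hδ, le_div_iff₀ hδ, one_mul]; exact (not_le.mp hd).le
  have hind : Integrable ((Set.Icc (-δ) δ).indicator fun _ => (|α| / b + 1) * δ) :=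
    (integrable_indicator_iff measurableSet_Icc).mpr (integrableOn_const (by simp))
  have hdiff := norm_integral_le_of_norm_le hind (Filter.Eventually.of_forall hpt)
  rw [integral_sub hn1.integrable hn2.integrable, integral_indicator measurableSet_Icc,
    setIntegral_const, measureReal_def, Real.volume_Icc,
    ENNReal.toReal_ofReal (by linarith), smul_eq_mul] at hdiff
  have h0 := h b δ l ν hb hδ
  calc _ ≤ _ := norm_le_norm_add_norm_sub' _ _
    _ ≤ C / b + (δ - -δ) * ((|α| / b + 1) * δ) := add_le_add h0 hdiff
    _ ≤ C / b + 2 * (1 / b * (b * δ ^ 2 + |α| * δ ^ 2)) := by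
      apply le_of_eq; field_simp; ring
    _ ≤ _ := by
      have : 0 ≤ 1 / b := by positivity
      have h3 : 0 ≤ 1 / b * (b * δ ^ 2 + |α| * δ ^ 2) := by positivity
      have e1 : C / b = C * (1 / b) := by ring
      rw [e1]
      nlinarith

attribute [fun_prop] continuous_chi continuous_SS continuous_bet

/-- The model kernel on the line with quadratic phase. -/
def kap (α Q P b δ y x : ℝ) : ℂ :=
  Complex.exp (Complex.I * (-(α * (y ^ 2 - x ^ 2) + Q * (y - x)) : ℝ)) *
    (SS b (y + x + P) (y - x) : ℂ) * (chi ((y - x) / δ) : ℂ)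

/-- The convolution kernel obtained from `kap` by freezing the variable `y` at `c`. -/
def kapFrozen (α Q P b δ c d : ℝ) : ℂ :=
  Complex.exp (Complex.I * (-(d * (α * (2 * c - d) + Q)) : ℝ)) *
    (SS b (2 * c - d + P) d : ℂ) * (chi (d / δ) : ℂ)

/-- The sharp window of half-width `L`. -/
def win (L z : ℝ) : ℂ := (Set.Icc (-L) L).indicator (fun _ => (1 : ℂ)) z

lemma continuous_kap (α Q P b δ : ℝ) : Continuous fun q : ℝ × ℝ => kap α Q P b δ q.1 q.2 := by
  unfold kap; fun_prop

lemma chi_div_eq_zero {δ d : ℝ} (hδ : 0 < δ) (h : δ ≤ |d|) : chi (d / δ) = 0 := by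
  apply chi_eq_zero
  rwa [abs_div, abs_of_pos hδ, le_div_iff₀ hδ, one_mul]

lemma win_of_le {L z : ℝ} (h : |z| ≤ L) : win L z = 1 :=
  Set.indicator_of_mem (Set.mem_Icc.mpr (abs_le.mp h)) _

lemma win_of_lt {L z : ℝ} (h : L < |z|) : win L z = 0 :=
  Set.indicator_of_notMem (fun h' => absurd (abs_le.mpr (Set.mem_Icc.mp h')) (not_le.mpr h)) _

lemma norm_win_le (L z : ℝ) : ‖win L z‖ ≤ 1 := by
  rcases le_or_gt |z| L with h | h
  · simp [win_of_le h]
  · simp [win_of_lt h]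

@[fun_prop]
lemma measurable_win (L : ℝ) : Measurable (win L) := measurable_const.indicator measurableSet_Icc

lemma locBdd_win (L c : ℝ) : LocBdd fun x => win L (x - c) :=
  .of_bound (by fun_prop) 1 fun x => norm_win_le _ _

lemma locBdd_chi (w c : ℝ) : LocBdd fun y => (chi ((y - c) / w) : ℂ) :=
  .of_continuous (by fun_prop)

lemma integral_chi_pos : 0 < ∫ z, chi z := chiBump.integral_pos

lemma integral_chi_window {w : ℝ} (hw : 0 < w) (y : ℝ) :
    ∫ c, (chi ((y - c) / w) : ℂ) = ((w * ∫ z, chi z : ℝ) : ℂ) := by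
  rw [integral_complex_ofReal]
  congr 1
  rw [integral_sub_left_eq_self (fun z => chi (z / w)) volume y]
  rw [Measure.integral_comp_div chi w, abs_of_pos hw, smul_eq_mul]

lemma nice_kapFrozen {δ : ℝ} (hδ : 0 < δ) (α Q P b c : ℝ) : Nice (kapFrozen α Q P b δ c) := by
  have hc : Continuous (kapFrozen α Q P b δ c) := by unfold kapFrozen; fun_prop
  refine ⟨.of_continuous hc, δ, fun d hd => ?_⟩
  rw [kapFrozen, chi_div_eq_zero hδ hd.le, Complex.ofReal_zero, mul_zero]

lemma nice_integral_kap {δ : ℝ} (hδ : 0 < δ) (α Q P b : ℝ) {a : ℝ → ℂ} (ha : Nice a) :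
    Nice fun y => ∫ x, kap α Q P b δ y x * a x := by
  refine Nice.integral_right (f := fun q : ℝ × ℝ => kap α Q P b δ q.1 q.2 * a q.2) ?_
  obtain ⟨R, hR⟩ := ha.supp
  refine Nice.of_fst_snd (R := R + δ) (R' := R)
    ((LocBdd.of_continuous (continuous_kap α Q P b δ)).mul
      (ha.toLocBdd.comp continuous_snd)) ?_
  intro y x h
  have h1 : ‖x‖ ≤ R := by
    by_contra! hc; exact h (by simp [hR x hc])
  refine ⟨?_, h1⟩
  have h2 : |y - x| < δ := by
    by_contra! hc; exact h (by simp [kap, chi_div_eq_zero hδ hc])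
  rw [Real.norm_eq_abs] at *
  have := abs_add_le (y - x) x
  rw [sub_add_cancel] at this
  linarith

lemma norm_kap_sub_kapFrozen_le {α Q P b δ c y x w : ℝ} (hb : 0 < b) (h : |y - c| ≤ w) :
    ‖kap α Q P b δ y x - kapFrozen α Q P b δ c (y - x)‖ ≤ 2 * w * (1 + |α| / b) := by
  set d := y - x with hd
  have hx : x = y - d := by rw [hd]; ring
  set θ := -(d * (α * (2 * c - d) + Q)) with hθ
  have e1 : -(α * (y ^ 2 - x ^ 2) + Q * (y - x)) = θ + -(2 * α * d * (y - c)) := by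
    rw [hθ, hx]; ring
  have e : kap α Q P b δ y x - kapFrozen α Q P b δ c d =
      Complex.exp (Complex.I * (θ : ℝ)) * (chi (d / δ) : ℂ) *
      ((Complex.exp (Complex.I * (-(2 * α * d * (y - c)) : ℝ)) - 1) * (SS b (y + x + P) d : ℂ) +
        ((SS b (y + x + P) d - SS b (2 * c - d + P) d : ℝ) : ℂ)) := by
    have : Complex.exp (Complex.I * (θ + -(2 * α * d * (y - c)) : ℝ)) =
        Complex.exp (Complex.I * (θ : ℝ)) *
          Complex.exp (Complex.I * (-(2 * α * d * (y - c)) : ℝ)) := by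
      rw [← Complex.exp_add]; congr 1; push_cast; ring
    rw [kap, kapFrozen, e1, this, ← hd, ← hθ]; push_cast; ring
  rw [e, norm_mul, norm_mul, norm_exp_I_mul, one_mul, Complex.norm_real]
  have h1 : ‖chi (d / δ)‖ ≤ 1 := abs_chi_le_one _
  refine (mul_le_of_le_one_left (norm_nonneg _) h1).trans ((norm_add_le _ _).trans ?_)
  rw [norm_mul, Complex.norm_real, Complex.norm_real, Real.norm_eq_abs, Real.norm_eq_abs]
  have h2 := norm_exp_I_sub_one_le (-(2 * α * d * (y - c)))
  rw [abs_neg, abs_mul, abs_mul, abs_mul, abs_two] at h2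
  have h3 := SS_lipschitz b (y + x + P) (2 * c - d + P) d
  have h5 : |y + x + P - (2 * c - d + P)| = 2 * |y - c| := by
    rw [← abs_two, ← abs_mul]; congr 1; rw [hx]; simp; ring
  rw [h5] at h3
  have h4 := abs_SS_mul_le b (y + x + P) d
  rw [abs_mul, abs_of_pos hb] at h4
  have h6 : |SS b (y + x + P) d| * |d| ≤ 1 / b := by
    rw [le_div_iff₀ hb]; linarith
  have hw : 0 ≤ w := (abs_nonneg _).trans h
  calc _ ≤ 2 * |α| * |d| * |y - c| * |SS b (y + x + P) d| + 2 * |y - c| := by gcongr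
    _ = 2 * |α| * |y - c| * (|SS b (y + x + P) d| * |d|) + 2 * |y - c| := by ring
    _ ≤ 2 * |α| * w * (1 / b) + 2 * w := by gcongr
    _ = _ := by ring

lemma exists_enorm_fourier_kapFrozen_le : ∃ C : ℝ, 0 ≤ C ∧ ∀ α Q P b δ c ξ : ℝ, 0 < b → 0 < δ →
    ‖𝓕 (kapFrozen α Q P b δ c) ξ‖ ≤ C * (1 / b * (1 + b * δ ^ 2 + |α| * δ ^ 2)) := by
  obtain ⟨C, hC, h⟩ := exists_norm_integral_frozen_le
  refine ⟨C, hC, fun α Q P b δ c ξ hb hδ => ?_⟩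
  refine le_of_eq_of_le ?_ (h b δ (2 * c + P) (-(2 * Real.pi * ξ + 2 * c * α + Q)) α hb hδ)
  rw [fourier_eq_exp]
  congr 2; ext d
  rw [kapFrozen, ← mul_assoc, ← mul_assoc, ← Complex.exp_add,
    show 2 * c - d + P = 2 * c + P - d by ring]
  congr 3
  push_cast; ring

lemma enorm_complex_ofReal {x : ℝ} (hx : 0 ≤ x) : ‖(x : ℂ)‖ₑ = ENNReal.ofReal x := by
  rw [← ofReal_norm, Complex.norm_real, Real.norm_of_nonneg hx]

lemma lintegral_nsq_window_le {f q : ℝ → ℂ} (hf : Measurable f) (hq : Measurable q) {L : ℝ}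
    (h1 : ∀ z, ‖q z‖ ≤ 1) (h2 : ∀ z, L < |z| → q z = 0) :
    ∫⁻ c, nsq (fun x => f x * q (x - c)) ≤ ENNReal.ofReal (2 * L) * nsq f := by
  unfold nsq
  rw [lintegral_lintegral_swap (by
    have : Measurable fun z : ℝ × ℝ => ‖f z.2 * q (z.2 - z.1)‖ₑ ^ 2 := by fun_prop
    exact this.aemeasurable)]
  rw [← lintegral_const_mul _ (by fun_prop)]
  refine lintegral_mono fun x => ?_
  simp only [enorm_mul, mul_pow]
  rw [lintegral_const_mul _ (by fun_prop), mul_comm]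
  gcongr
  calc ∫⁻ c, ‖q (x - c)‖ₑ ^ 2 ≤ ∫⁻ c, (Set.Icc (x - L) (x + L)).indicator (fun _ => 1) c := by
        refine lintegral_mono fun c => ?_
        by_cases hc : |x - c| ≤ L
        · rw [abs_le] at hc
          rw [Set.indicator_of_mem (by constructor <;> linarith)]
          refine pow_le_one₀ zero_le ?_
          rw [← enorm_one (G := ℂ), enorm_le_iff_norm_le]
          simpa using h1 (x - c)
        · simp [h2 _ (not_le.mp hc)]
    _ = _ := by
        rw [lintegral_indicator measurableSet_Icc, setLIntegral_const, one_mul, Real.volume_Icc]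
        congr 1; ring

lemma nice_integral_kapFrozen {δ : ℝ} (hδ : 0 < δ) (α Q P b c : ℝ) {a : ℝ → ℂ} (ha : Nice a) :
    Nice fun y => ∫ x, kapFrozen α Q P b δ c (y - x) * a x := by
  refine Nice.integral_right
    (f := fun q : ℝ × ℝ => kapFrozen α Q P b δ c (q.1 - q.2) * a q.2) ?_
  obtain ⟨R, hR⟩ := ha.supp
  have hc : Continuous fun q : ℝ × ℝ => kapFrozen α Q P b δ c (q.1 - q.2) := by
    unfold kapFrozen; fun_prop
  refine Nice.of_fst_snd (R := R + δ) (R' := R)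
    ((LocBdd.of_continuous hc).mul (ha.toLocBdd.comp continuous_snd)) ?_
  intro y x h
  have h1 : ‖x‖ ≤ R := by
    by_contra! hc; exact h (by simp [hR x hc])
  refine ⟨?_, h1⟩
  have h2 : |y - x| < δ := by
    by_contra! hc; exact h (by simp [kapFrozen, chi_div_eq_zero hδ hc])
  rw [Real.norm_eq_abs] at *
  have := abs_add_le (y - x) x
  rw [sub_add_cancel] at this
  linarith

lemma enorm_integral_kap_sub_le {α Q P b δ w : ℝ} (hb : 0 < b) (hδ : 0 < δ) {a : ℝ → ℂ}
    (ha : Nice a) {y c : ℝ} (hy : |y - c| ≤ w) :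
    ‖(∫ x, kap α Q P b δ y x * a x) -
        ∫ x, kapFrozen α Q P b δ c (y - x) * (a x * win (δ + w) (x - c))‖ₑ ≤
      ∫⁻ x, ENNReal.ofReal (2 * w * (1 + |α| / b)) * (‖win δ (y - x)‖ₑ * ‖a x‖ₑ) := by
  have hk1 : Continuous fun x => kap α Q P b δ y x := by unfold kap; fun_prop
  have hk2 : Continuous fun x => kapFrozen α Q P b δ c (y - x) := by unfold kapFrozen; fun_prop
  have hi1 := (ha.mul_left (LocBdd.of_continuous hk1)).integrable
  have hi2 := ((ha.mul_right (locBdd_win (δ + w) c)).mul_left (LocBdd.of_continuous hk2)).integrable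
  rw [← integral_sub hi1 hi2]
  refine (enorm_integral_le_lintegral_enorm _).trans (lintegral_mono fun x => ?_)
  by_cases hx : |y - x| ≤ δ
  · have h1 : win (δ + w) (x - c) = 1 := by
      refine win_of_le ?_
      have := abs_add_le (y - c) (x - y)
      rw [abs_sub_comm x y] at this
      have e : y - c + (x - y) = x - c := by ring
      rw [e] at this; linarith
    rw [h1, mul_one, ← sub_mul, enorm_mul, win_of_le hx, enorm_one, one_mul]
    gcongr
    rw [← ofReal_norm]
    exact ENNReal.ofReal_le_ofReal (norm_kap_sub_kapFrozen_le hb hy)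
  · push Not at hx
    simp [kap, kapFrozen, chi_div_eq_zero hδ hx.le]

/-- Pairing of a window with the model operator, in frequency space, up to a Schur-type error. -/
lemma enorm_integral_kap_le {C : ℝ}
    (hC : ∀ α Q P b δ c ξ : ℝ, 0 < b → 0 < δ →
      ‖𝓕 (kapFrozen α Q P b δ c) ξ‖ ≤ C * (1 / b * (1 + b * δ ^ 2 + |α| * δ ^ 2)))
    {α Q P b δ w : ℝ} (hb : 0 < b) (hδ : 0 < δ) (hw : 0 < w) {G a : ℝ → ℂ} (hG : Nice G)
    (ha : Nice a) :
    ENNReal.ofReal (w * ∫ z, chi z) * ‖∫ y, G y * ∫ x, kap α Q P b δ y x * a x‖ₑ ≤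
      ENNReal.ofReal (C * (1 / b * (1 + b * δ ^ 2 + |α| * δ ^ 2))) *
        (∫⁻ c, ∫⁻ ξ, ‖𝓕 (fun y => (starRingEnd ℂ) (G y * (chi ((y - c) / w) : ℂ))) ξ‖ₑ *
          ‖𝓕 (fun x => a x * win (δ + w) (x - c)) ξ‖ₑ) +
      ENNReal.ofReal (w * ∫ z, chi z) * (ENNReal.ofReal (2 * w * (1 + |α| / b)) *
        ∫⁻ y, ∫⁻ x, ‖G y‖ₑ * ‖win δ (y - x)‖ₑ * ‖a x‖ₑ) := by
  set g : ℝ → ℂ := fun y => G y * ∫ x, kap α Q P b δ y x * a x with hg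
  have hgn : Nice g := hG.mul_right (nice_integral_kap hδ α Q P b ha).toLocBdd
  set E0 := 2 * w * (1 + |α| / b) with hE0
  have hE00 : 0 ≤ E0 := by positivity
  have hswap : ENNReal.ofReal (w * ∫ z, chi z) * ‖∫ y, g y‖ₑ =
      ‖∫ c, ∫ y, (chi ((y - c) / w) : ℂ) * g y‖ₑ := by
    rw [integral_integral_swap]
    · simp only [integral_mul_const, integral_chi_window hw]
      rw [integral_const_mul, enorm_mul, enorm_complex_ofReal (mul_nonneg hw.le integral_chi_pos.le)]
    · obtain ⟨R, hR⟩ := hgn.supp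
      have : Nice fun q : ℝ × ℝ => (chi ((q.2 - q.1) / w) : ℂ) * g q.2 := by
        refine Nice.of_fst_snd (R := R + w) (R' := R)
          ((LocBdd.of_continuous (by fun_prop)).mul (hgn.toLocBdd.comp continuous_snd)) ?_
        intro c y h
        have h1 : ‖y‖ ≤ R := by
          by_contra! hc; exact h (by simp [hR y hc])
        refine ⟨?_, h1⟩
        have h2 : |y - c| < w := by
          by_contra! hc; exact h (by simp [chi_div_eq_zero hw hc])
        rw [Real.norm_eq_abs] at *
        have := abs_add_le (c - y) y
        rw [sub_add_cancel, abs_sub_comm] at this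
        linarith
      exact this.integrable
  rw [hswap]
  have hmeas : Measurable fun c : ℝ => ∫⁻ y, ∫⁻ x, ENNReal.ofReal (chi ((y - c) / w)) *
      (ENNReal.ofReal E0 * (‖G y‖ₑ * ‖win δ (y - x)‖ₑ * ‖a x‖ₑ)) := by
    have h1 := hG.meas
    have h2 := ha.meas
    have h3 : Measurable fun q : (ℝ × ℝ) × ℝ => ENNReal.ofReal (chi ((q.1.2 - q.1.1) / w)) *
      (ENNReal.ofReal E0 * (‖G q.1.2‖ₑ * ‖win δ (q.1.2 - q.2)‖ₑ * ‖a q.2‖ₑ)) := by fun_prop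
    exact (h3.lintegral_prod_right').lintegral_prod_right'
  have hpt : ∀ c, ‖∫ y, (chi ((y - c) / w) : ℂ) * g y‖ₑ ≤
      ENNReal.ofReal (C * (1 / b * (1 + b * δ ^ 2 + |α| * δ ^ 2))) *
        (∫⁻ ξ, ‖𝓕 (fun y => (starRingEnd ℂ) (G y * (chi ((y - c) / w) : ℂ))) ξ‖ₑ *
          ‖𝓕 (fun x => a x * win (δ + w) (x - c)) ξ‖ₑ) +
      ∫⁻ y, ∫⁻ x, ENNReal.ofReal (chi ((y - c) / w)) *
        (ENNReal.ofReal E0 * (‖G y‖ₑ * ‖win δ (y - x)‖ₑ * ‖a x‖ₑ)) := by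
    intro c
    set Gc : ℝ → ℂ := fun y => (starRingEnd ℂ) (G y * (chi ((y - c) / w) : ℂ)) with hGc
    set ac : ℝ → ℂ := fun x => a x * win (δ + w) (x - c) with hac
    have hGcn : Nice Gc := (hG.mul_right (locBdd_chi w c)).star
    have hacn : Nice ac := ha.mul_right (locBdd_win _ c)
    have hkn := nice_kapFrozen hδ α Q P b c
    set m : ℝ → ℂ := fun y => ∫ x, kapFrozen α Q P b δ c (y - x) * ac x with hm
    have hmn : Nice m := nice_integral_kapFrozen hδ α Q P b c hacn
    have hmain : ∫ y, m y * (starRingEnd ℂ) (Gc y) =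
        ∫ ξ, 𝓕 (kapFrozen α Q P b δ c) ξ * 𝓕 ac ξ * (starRingEnd ℂ) (𝓕 Gc ξ) := by
      rw [integral_mul_conj_fourier hmn hGcn]
      simp only [hm, fourier_conv hkn hacn]
    have hmain2 : ‖∫ y, m y * (starRingEnd ℂ) (Gc y)‖ₑ ≤
        ENNReal.ofReal (C * (1 / b * (1 + b * δ ^ 2 + |α| * δ ^ 2))) *
        (∫⁻ ξ, ‖𝓕 Gc ξ‖ₑ * ‖𝓕 ac ξ‖ₑ) := by
      rw [hmain]
      refine (enorm_integral_le_lintegral_enorm _).trans ?_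
      rw [← lintegral_const_mul' _ _ ENNReal.ofReal_ne_top]
      refine lintegral_mono fun ξ => ?_
      rw [enorm_mul, enorm_mul, mul_assoc, RCLike.enorm_conj, mul_comm (‖𝓕 ac ξ‖ₑ)]
      gcongr
      rw [← ofReal_norm]
      exact ENNReal.ofReal_le_ofReal (hC α Q P b δ c ξ hb hδ)
    have hdiff : ‖∫ y, (chi ((y - c) / w) : ℂ) * g y - m y * (starRingEnd ℂ) (Gc y)‖ₑ ≤
        ∫⁻ y, ∫⁻ x, ENNReal.ofReal (chi ((y - c) / w)) *
          (ENNReal.ofReal E0 * (‖G y‖ₑ * ‖win δ (y - x)‖ₑ * ‖a x‖ₑ)) := by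
      refine (enorm_integral_le_lintegral_enorm _).trans (lintegral_mono fun y => ?_)
      have e1 : (chi ((y - c) / w) : ℂ) * g y - m y * (starRingEnd ℂ) (Gc y) =
          (chi ((y - c) / w) : ℂ) * (G y * ((∫ x, kap α Q P b δ y x * a x) - m y)) := by
        simp only [hg, hGc, Complex.conj_conj]; ring
      rw [e1, enorm_mul, enorm_mul, enorm_complex_ofReal (chi_nonneg _), lintegral_const_mul' _ _ ENNReal.ofReal_ne_top]
      by_cases hy : w ≤ |y - c|
      · simp [chi_div_eq_zero hw hy]
      push Not at hy
      gcongr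
      simp only [mul_left_comm _ ‖G y‖ₑ, mul_assoc]
      rw [lintegral_const_mul' _ _ enorm_ne_top]
      gcongr
      exact enorm_integral_kap_sub_le hb hδ ha hy.le
    have hi1 : Integrable fun y => (chi ((y - c) / w) : ℂ) * g y :=
      (hgn.mul_left (locBdd_chi w c)).integrable
    have hi2 : Integrable fun y => m y * (starRingEnd ℂ) (Gc y) :=
      (hmn.mul_right hGcn.star.toLocBdd).integrable
    rw [integral_sub hi1 hi2] at hdiff
    calc ‖∫ y, (chi ((y - c) / w) : ℂ) * g y‖ₑ
        = ‖(∫ y, m y * (starRingEnd ℂ) (Gc y)) + ((∫ y, (chi ((y - c) / w) : ℂ) * g y) -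
            ∫ y, m y * (starRingEnd ℂ) (Gc y))‖ₑ := by rw [add_sub_cancel]
      _ ≤ _ := enorm_add_le _ _
      _ ≤ _ := add_le_add hmain2 hdiff
  refine (enorm_integral_le_lintegral_enorm _).trans ((lintegral_mono hpt).trans ?_)
  rw [lintegral_add_right _ hmeas, lintegral_const_mul' _ _ ENNReal.ofReal_ne_top]
  refine add_le_add le_rfl ?_
  rw [lintegral_lintegral_swap (by
    have h1 := hG.meas
    have h2 := ha.meas
    have h3 : Measurable fun q : (ℝ × ℝ) × ℝ => ENNReal.ofReal (chi ((q.1.2 - q.1.1) / w)) *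
      (ENNReal.ofReal E0 * (‖G q.1.2‖ₑ * ‖win δ (q.1.2 - q.2)‖ₑ * ‖a q.2‖ₑ)) := by fun_prop
    exact h3.lintegral_prod_right'.aemeasurable)]
  rw [← lintegral_const_mul' _ _ ENNReal.ofReal_ne_top,
    ← lintegral_const_mul' _ _ ENNReal.ofReal_ne_top]
  refine lintegral_mono fun y => ?_
  have hf : ∀ c : ℝ, ∫⁻ x, ENNReal.ofReal (chi ((y - c) / w)) *
        (ENNReal.ofReal E0 * (‖G y‖ₑ * ‖win δ (y - x)‖ₑ * ‖a x‖ₑ)) =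
      ENNReal.ofReal (chi ((y - c) / w)) * (ENNReal.ofReal E0 *
        ∫⁻ x, ‖G y‖ₑ * ‖win δ (y - x)‖ₑ * ‖a x‖ₑ) := fun c => by
    rw [lintegral_const_mul' _ _ ENNReal.ofReal_ne_top,
      lintegral_const_mul' _ _ ENNReal.ofReal_ne_top]
  simp only [hf]
  rw [lintegral_mul_const _ (by fun_prop)]
  gcongr
  have hi : ∫⁻ c, ENNReal.ofReal (chi ((y - c) / w)) = ENNReal.ofReal (w * ∫ z, chi z) := by
    rw [lintegral_sub_left_eq_self (fun z => ENNReal.ofReal (chi (z / w))) y,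
      ← ofReal_integral_eq_lintegral_ofReal]
    · rw [Measure.integral_comp_div chi w, abs_of_pos hw, smul_eq_mul]
    · have h1 : Nice fun z => (chi (z / w) : ℂ) :=
        ⟨.of_continuous (by fun_prop), w, fun z hz => by simp [chi_div_eq_zero hw hz.le]⟩
      exact h1.integrable.re
    · exact Filter.Eventually.of_forall fun z => chi_nonneg _
  exact hi.le

lemma lintegral_win_le (δ y : ℝ) :
    ∫⁻ x, ‖win δ (y - x)‖ₑ ≤ ENNReal.ofReal (2 * δ) := by
  rw [lintegral_sub_left_eq_self (fun z => ‖win δ z‖ₑ) y]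
  calc ∫⁻ z, ‖win δ z‖ₑ ≤ ∫⁻ z, (Set.Icc (-δ) δ).indicator (fun _ => 1) z := by
        refine lintegral_mono fun z => ?_
        unfold win
        by_cases h : z ∈ Set.Icc (-δ) δ <;> simp [h]
    _ = _ := by
        rw [lintegral_indicator measurableSet_Icc, setLIntegral_const, one_mul, Real.volume_Icc]
        congr 1; ring

lemma lintegral_win_pairing_sq_le {δ : ℝ} (hδ : 0 ≤ δ) {G a : ℝ → ℂ} (hG : Measurable G)
    (ha : Measurable a) :
    (∫⁻ y, ∫⁻ x, ‖G y‖ₑ * ‖win δ (y - x)‖ₑ * ‖a x‖ₑ) ^ 2 ≤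
      ENNReal.ofReal ((2 * δ) ^ 2) * nsq G * nsq a := by
  have h := schur_sq (μ := volume) (ν := volume) (f := fun y => ‖G y‖ₑ) (g := fun x => ‖a x‖ₑ)
    (k := fun q : ℝ × ℝ => ‖win δ (q.1 - q.2)‖ₑ) (A := ENNReal.ofReal (2 * δ))
    (B := ENNReal.ofReal (2 * δ)) (by fun_prop) (by fun_prop) (by fun_prop)
    (fun y => lintegral_win_le δ y) (fun x => by
      refine le_of_eq_of_le ?_ (lintegral_win_le δ x)
      congr 1; ext y
      rcases le_or_gt |y - x| δ with h | h
      · rw [win_of_le h, win_of_le (by rwa [abs_sub_comm])]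
      · rw [win_of_lt h, win_of_lt (by rwa [abs_sub_comm])])
  rwa [← ENNReal.ofReal_mul (by positivity), ← pow_two] at h

lemma ENNReal.add_sq_le_four_mul (x y : ENNReal) : (x + y) ^ 2 ≤ 4 * (x ^ 2 + y ^ 2) := by
  have key : ∀ x y : ENNReal, x ≤ y → (x + y) ^ 2 ≤ 4 * (x ^ 2 + y ^ 2) := by
    intro x y h
    calc (x + y) ^ 2 ≤ (y + y) ^ 2 := by gcongr
      _ = 4 * y ^ 2 := by ring
      _ ≤ _ := by gcongr; exact le_add_self
  rcases le_total x y with h | h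
  · exact key x y h
  · rw [add_comm x, add_comm (x ^ 2)]; exact key y x h

lemma lintegral_lintegral_mul_sq_le {α β : Type*} [MeasurableSpace α] [MeasurableSpace β]
    {μ : Measure α} {ν : Measure β} [SFinite ν] {f g : α → β → ENNReal}
    (hf : Measurable fun q : α × β => f q.1 q.2) (hg : Measurable fun q : α × β => g q.1 q.2) :
    (∫⁻ a, ∫⁻ b, f a b * g a b ∂ν ∂μ) ^ 2 ≤
      (∫⁻ a, ∫⁻ b, f a b ^ 2 ∂ν ∂μ) * ∫⁻ a, ∫⁻ b, g a b ^ 2 ∂ν ∂μ := by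
  have h := lintegral_mul_sq_le (μ := μ.prod ν) hf.aemeasurable hg.aemeasurable
  have hfg : Measurable fun q : α × β => f q.1 q.2 * g q.1 q.2 := hf.mul hg
  rwa [lintegral_prod _ hfg.aemeasurable, lintegral_prod _ (hf.pow_const 2).aemeasurable,
    lintegral_prod _ (hg.pow_const 2).aemeasurable] at h

lemma measurable_fourier_param {Z : Type*} [MeasurableSpace Z] {F : Z → ℝ → ℂ}
    (hF : Measurable fun q : Z × ℝ => F q.1 q.2) :
    Measurable fun q : Z × ℝ => 𝓕 (F q.1) q.2 := by
  simp only [fourier_eq_exp]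
  have h : Measurable fun q : (Z × ℝ) × ℝ =>
      Complex.exp (Complex.I * (-(2 * Real.pi * q.1.2) * q.2 : ℝ)) * F q.1.1 q.2 := by
    have h1 : Measurable fun q : (Z × ℝ) × ℝ => F q.1.1 q.2 :=
      hF.comp (by fun_prop : Measurable fun q : (Z × ℝ) × ℝ => (q.1.1, q.2))
    have h2 : Measurable fun q : (Z × ℝ) × ℝ =>
      Complex.exp (Complex.I * (-(2 * Real.pi * q.1.2) * q.2 : ℝ)) := by fun_prop
    exact h2.mul h1
  exact h.stronglyMeasurable.integral_prod_right'.measurable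

lemma nsq_const_mul {E : Type*} [MeasureSpace E] (c : ℂ) (f : E → ℂ) :
    nsq (fun x => c * f x) = ‖c‖ₑ ^ 2 * nsq f := by
  unfold nsq
  simp only [enorm_mul, mul_pow]
  exact lintegral_const_mul' _ _ (by finiteness)

lemma nsq_congr_enorm {E : Type*} [MeasureSpace E] {f g : E → ℂ} (h : ∀ x, ‖f x‖ₑ = ‖g x‖ₑ) :
    nsq f = nsq g := by
  unfold nsq; simp only [h]

lemma enorm_exp_I_mul (x : ℝ) : ‖Complex.exp (Complex.I * (x : ℝ))‖ₑ = 1 := by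
  rw [← ofReal_norm, norm_exp_I_mul, ENNReal.ofReal_one]

lemma measurable_window_fourier {G q : ℝ → ℂ} (hG : Measurable G) (hq : Measurable q) :
    Measurable fun z : ℝ × ℝ => 𝓕 (fun x => G x * q (x - z.1)) z.2 :=
  measurable_fourier_param (F := fun c x => G x * q (x - c)) (by fun_prop)

lemma kap_eq_mul (α Q P b δ y x : ℝ) : kap α Q P b δ y x =
    Complex.exp (Complex.I * (-(α * y ^ 2 + Q * y) : ℝ)) * (kap 0 0 P b δ y x *
      Complex.exp (Complex.I * (α * x ^ 2 + Q * x : ℝ))) := by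
  unfold kap
  have : Complex.exp (Complex.I * (-(α * (y ^ 2 - x ^ 2) + Q * (y - x)) : ℝ)) =
      Complex.exp (Complex.I * (-(α * y ^ 2 + Q * y) : ℝ)) *
      Complex.exp (Complex.I * (α * x ^ 2 + Q * x : ℝ)) := by
    rw [← Complex.exp_add]; congr 1; push_cast; ring
  rw [this]
  simp
  ring

lemma lintegral_window_pairing_sq_le {G a : ℝ → ℂ} (hG : Nice G) (ha : Nice a) {w L : ℝ}
    (hw : 0 < w) :
    (∫⁻ c, ∫⁻ ξ, ‖𝓕 (fun y => (starRingEnd ℂ) (G y * (chi ((y - c) / w) : ℂ))) ξ‖ₑ *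
          ‖𝓕 (fun x => a x * win L (x - c)) ξ‖ₑ) ^ 2 ≤
      (ENNReal.ofReal (2 * w) * nsq G) * (ENNReal.ofReal (2 * L) * nsq a) := by
  refine (lintegral_lintegral_mul_sq_le ?_ ?_).trans ?_
  · have h1 := hG.meas
    have := measurable_fourier_param
      (F := fun (c : ℝ) y => (starRingEnd ℂ) (G y * (chi ((y - c) / w) : ℂ))) (by
        have h2 : Measurable fun q : ℝ × ℝ => G q.2 * (chi ((q.2 - q.1) / w) : ℂ) := by fun_prop
        exact Complex.continuous_conj.measurable.comp h2)
    exact this.enorm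
  · exact (measurable_window_fourier ha.meas (measurable_win L)).enorm
  · gcongr ?_ * ?_
    · have : ∀ c, ∫⁻ ξ, ‖𝓕 (fun y => (starRingEnd ℂ) (G y * (chi ((y - c) / w) : ℂ))) ξ‖ₑ ^ 2 =
          nsq (fun y => G y * (chi ((y - c) / w) : ℂ)) := by
        intro c
        have h := nsq_fourier (hG.mul_right (locBdd_chi w c)).star
        rw [nsq_star] at h
        exact h
      simp only [this]
      refine lintegral_nsq_window_le (q := fun z => (chi (z / w) : ℂ)) hG.meas (by fun_prop) ?_ ?_
      · intro z; rw [Complex.norm_real]; exact abs_chi_le_one _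
      · intro z hz; rw [chi_div_eq_zero hw hz.le]; simp
    · have : ∀ c, ∫⁻ ξ, ‖𝓕 (fun x => a x * win L (x - c)) ξ‖ₑ ^ 2 =
          nsq (fun x => a x * win L (x - c)) := fun c =>
        nsq_fourier (ha.mul_right (locBdd_win L c))
      simp only [this]
      exact lintegral_nsq_window_le ha.meas (measurable_win L) (norm_win_le L)
        fun z hz => win_of_lt hz

lemma exists_nsq_kap_zero_le : ∃ C : ℝ, 0 < C ∧ ∀ (P b δ : ℝ) (a : ℝ → ℂ), 0 < b → 0 < δ → Nice a →
    nsq (fun y => ∫ x, kap 0 0 P b δ y x * a x) ≤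
      ENNReal.ofReal ((C * (1 / b * (1 + b * δ ^ 2))) ^ 2) * nsq a := by
  obtain ⟨C, hC0, hC⟩ := exists_enorm_fourier_kapFrozen_le
  set I := ∫ z, chi z with hI
  have hIpos : 0 < I := integral_chi_pos
  refine ⟨6 * C / I + 8, by positivity, fun P b δ a hb hδ ha => ?_⟩
  refine nsq_le_of_dual (nice_integral_kap hδ _ _ _ _ ha) fun G hG => ?_
  have hJ := enorm_integral_kap_le hC (α := 0) (Q := 0) (P := P) hb hδ hδ hG ha
  have h1 := lintegral_window_pairing_sq_le hG ha (L := δ + δ) hδ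
  have h2 := lintegral_win_pairing_sq_le (δ := δ) hδ.le hG.meas ha.meas
  simp only [mul_comm _ (G _)]
  set J := ‖∫ y, G y * ∫ x, kap 0 0 P b δ y x * a x‖ₑ
  set S := ∫⁻ c, ∫⁻ ξ, ‖𝓕 (fun y => (starRingEnd ℂ) (G y * (chi ((y - c) / δ) : ℂ))) ξ‖ₑ *
          ‖𝓕 (fun x => a x * win (δ + δ) (x - c)) ξ‖ₑ
  set W := ∫⁻ y, ∫⁻ x, ‖G y‖ₑ * ‖win δ (y - x)‖ₑ * ‖a x‖ₑ
  simp only [abs_zero, zero_mul, add_zero, zero_div, mul_one] at hJ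
  rw [← hI] at hJ
  set D := 1 / b * (1 + b * δ ^ 2) with hD
  have hDpos : 0 < D := by positivity
  have hDδ : δ ^ 2 ≤ D := by
    rw [hD]; field_simp; linarith
  have hsq : ENNReal.ofReal ((δ * I) ^ 2) * J ^ 2 ≤
      ENNReal.ofReal ((δ * I) ^ 2) * (ENNReal.ofReal (((6 * C / I + 8) * D) ^ 2) * nsq a * nsq G) := by
    calc ENNReal.ofReal ((δ * I) ^ 2) * J ^ 2 = (ENNReal.ofReal (δ * I) * J) ^ 2 := by
          rw [mul_pow (ENNReal.ofReal _), ENNReal.ofReal_pow (by positivity)]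
      _ ≤ _ := pow_le_pow_left' hJ 2
      _ ≤ _ := ENNReal.add_sq_le_four_mul _ _
      _ = 4 * (ENNReal.ofReal (C * D) ^ 2 * S ^ 2 +
          ENNReal.ofReal (δ * I) ^ 2 * (ENNReal.ofReal (2 * δ) ^ 2 * W ^ 2)) := by
          simp only [mul_pow]
      _ ≤ 4 * (ENNReal.ofReal (C * D) ^ 2 * ((ENNReal.ofReal (2 * δ) * nsq G) *
            (ENNReal.ofReal (2 * (δ + δ)) * nsq a)) +
          ENNReal.ofReal (δ * I) ^ 2 * (ENNReal.ofReal (2 * δ) ^ 2 *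
            (ENNReal.ofReal ((2 * δ) ^ 2) * nsq G * nsq a))) := by gcongr
      _ = ENNReal.ofReal (4 * ((C * D) ^ 2 * (2 * δ) * (2 * (δ + δ)) +
            (δ * I) ^ 2 * (2 * δ) ^ 2 * (2 * δ) ^ 2)) * (nsq a * nsq G) := by
          have e : ∀ x y z u v t : ℝ, 0 ≤ x → 0 ≤ y → 0 ≤ z → 0 ≤ u → 0 ≤ v → 0 ≤ t →
              ENNReal.ofReal (4 * (x ^ 2 * y * z + u ^ 2 * v ^ 2 * t)) =
              4 * (ENNReal.ofReal x ^ 2 * ENNReal.ofReal y * ENNReal.ofReal z +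
                ENNReal.ofReal u ^ 2 * ENNReal.ofReal v ^ 2 * ENNReal.ofReal t) := by
            intro x y z u v t hx hy hz hu hv ht
            rw [ENNReal.ofReal_mul (by norm_num), ENNReal.ofReal_add (by positivity) (by positivity),
              ENNReal.ofReal_mul (by positivity), ENNReal.ofReal_mul (by positivity),
              ENNReal.ofReal_mul (by positivity), ENNReal.ofReal_mul (by positivity),
              ENNReal.ofReal_pow hx, ENNReal.ofReal_pow hu, ENNReal.ofReal_pow hv,
              ENNReal.ofReal_ofNat]
          rw [e _ _ _ _ _ _ (by positivity) (by positivity) (by positivity) (by positivity)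
            (by positivity) (by positivity)]
          ring
      _ ≤ ENNReal.ofReal ((δ * I) ^ 2 * ((6 * C / I + 8) * D) ^ 2) * (nsq a * nsq G) := by
          refine mul_le_mul_left (ENNReal.ofReal_le_ofReal ?_) _
          have e : (δ * I) ^ 2 * ((6 * C / I + 8) * D) ^ 2 =
              δ ^ 2 * ((6 * C + 8 * I) * D) ^ 2 := by field_simp
          rw [e]
          have h3 : (δ * I) ^ 2 * (2 * δ) ^ 2 * (2 * δ) ^ 2 ≤ δ ^ 2 * I ^ 2 * (16 * D ^ 2) := by
            have : (δ ^ 2) ^ 2 ≤ D ^ 2 := by gcongr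
            calc _ = δ ^ 2 * I ^ 2 * (16 * (δ ^ 2) ^ 2) := by ring
              _ ≤ _ := by gcongr
          have h4 : 0 ≤ δ ^ 2 * D ^ 2 * (C * I) := by positivity
          have h5 : 0 ≤ δ ^ 2 * D ^ 2 * C ^ 2 := by positivity
          nlinarith
      _ = _ := by
          rw [ENNReal.ofReal_mul (by positivity)]; ring
  have hne : ENNReal.ofReal ((δ * I) ^ 2) ≠ 0 := by
    rw [ne_eq, ENNReal.ofReal_eq_zero, not_le]; positivity
  exact (ENNReal.mul_le_mul_iff_right hne ENNReal.ofReal_ne_top).mp hsq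

lemma exists_nsq_kap_le : ∃ C : ℝ, 0 < C ∧ ∀ (α Q P b δ : ℝ) (a : ℝ → ℂ), 0 < b → 0 < δ → Nice a →
    nsq (fun y => ∫ x, kap α Q P b δ y x * a x) ≤
      ENNReal.ofReal ((C * (1 / b * (1 + b * δ ^ 2))) ^ 2) * nsq a := by
  obtain ⟨C, hC, h⟩ := exists_nsq_kap_zero_le
  refine ⟨C, hC, fun α Q P b δ a hb hδ ha => ?_⟩
  have hx := h P b δ (fun x => Complex.exp (Complex.I * (α * x ^ 2 + Q * x : ℝ)) * a x) hb hδ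
    (ha.mul_left (LocBdd.of_continuous (by fun_prop)))
  rw [nsq_congr_enorm (f := fun x => Complex.exp (Complex.I * (α * x ^ 2 + Q * x : ℝ)) * a x)
    (g := a) (fun x => by rw [enorm_mul, enorm_exp_I_mul, one_mul])] at hx
  refine le_of_eq_of_le (nsq_congr_enorm fun y => ?_) hx
  simp only [kap_eq_mul α Q P b δ, mul_assoc]
  rw [integral_const_mul, enorm_mul, enorm_exp_I_mul, one_mul]

lemma exists_norm_chi_sub_le : ∃ K : ℝ, 0 ≤ K ∧ ∀ z z' : ℝ, |chi z - chi z'| ≤ K * |z - z'| := by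
  obtain ⟨K, hK⟩ := ContDiff.lipschitzWith_of_hasCompactSupport (𝕂 := ℝ)
    (HasCompactSupport.intro (isCompact_Icc (a := (-1 : ℝ)) (b := 1)) (fun z hz =>
      chi_eq_zero (by
        by_contra h
        exact hz (Set.mem_Icc.mpr (abs_le.mp (not_le.mp h).le))))) contDiff_chi (by norm_num)
  refine ⟨K, K.2, fun z z' => ?_⟩
  have := hK.dist_le_mul z z'
  rwa [Real.dist_eq, Real.dist_eq] at this

/-- The Fourier integral of a compactly supported Lipschitz function. -/
lemma abs_mul_norm_integral_lipschitz_le {A : ℝ → ℂ} {K : ℝ} (hK : 0 ≤ K)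
    (hA : ∀ z z', ‖A z - A z'‖ ≤ K * |z - z'|) (hs : ∀ z, 1 ≤ |z| → A z = 0) (ω : ℝ) :
    |ω| * ‖∫ z, A z * Complex.exp (Complex.I * (ω * z : ℝ))‖ ≤ 8 * K := by
  by_cases hω : ω = 0
  · subst hω; simp; positivity
  have hAc : Continuous A := by
    have : LipschitzWith ⟨K, hK⟩ A := LipschitzWith.of_dist_le_mul fun z z' => by
      rw [dist_eq_norm, Real.dist_eq]; exact hA z z'
    exact this.continuous
  have hnice : Nice A := ⟨.of_continuous hAc, 1, fun z hz => hs z (by simpa using hz.le)⟩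
  set h := Real.pi / ω with hh
  set F := fun z => A z * Complex.exp (Complex.I * (ω * z : ℝ))
  have hF : Nice F := hnice.mul_right (.of_continuous (by fun_prop))
  have hsh : ∀ z, F (z + h) = -(A (z + h) * Complex.exp (Complex.I * (ω * z : ℝ))) := by
    intro z
    simp only [F]
    have : Complex.exp (Complex.I * (ω * (z + h) : ℝ)) =
        -Complex.exp (Complex.I * (ω * z : ℝ)) := by
      have e : Complex.I * (ω * (z + h) : ℝ) = Complex.I * (ω * z : ℝ) + Real.pi * Complex.I := by
        have : ω * (z + h) = ω * z + Real.pi := by rw [hh]; field_simp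
        rw [this]; push_cast; ring
      rw [e, Complex.exp_add, Complex.exp_pi_mul_I]; ring
    rw [this]; ring
  have h2 : (2 : ℂ) * ∫ z, F z =
      ∫ z, (A z - A (z + h)) * Complex.exp (Complex.I * (ω * z : ℝ)) := by
    have e : ∀ z, (A z - A (z + h)) * Complex.exp (Complex.I * (ω * z : ℝ)) = F z + F (z + h) := by
      intro z; rw [hsh]; simp only [F]; ring
    simp only [e]
    rw [integral_add hF.integrable (hF.integrable.comp_add_right h),
      integral_add_right_eq_self F h]
    ring
  have hI : ∀ t : ℝ, ∫ z, (Set.Icc (-1 : ℝ) 1).indicator (fun _ => K * |h|) (z + t) =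
      2 * (K * |h|) := by
    intro t
    rw [integral_add_right_eq_self (fun z => (Set.Icc (-1 : ℝ) 1).indicator (fun _ => K * |h|) z),
      integral_indicator measurableSet_Icc, setIntegral_const, measureReal_def, Real.volume_Icc,
      ENNReal.toReal_ofReal (by norm_num), smul_eq_mul]
    ring
  have hint : Integrable ((Set.Icc (-1 : ℝ) 1).indicator fun _ => K * |h|) :=
    (integrable_indicator_iff measurableSet_Icc).mpr (integrableOn_const (by simp))
  have hb : ‖(2 : ℂ) * ∫ z, F z‖ ≤ 2 * (K * |h|) + 2 * (K * |h|) := by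
    rw [h2]
    have h0 := hI 0
    simp only [add_zero] at h0
    nth_rewrite 1 [← h0]
    rw [← hI h, ← integral_add hint (hint.comp_add_right h)]
    refine norm_integral_le_of_norm_le (hint.add (hint.comp_add_right h))
      (Filter.Eventually.of_forall fun z => ?_)
    rw [norm_mul, norm_exp_I_mul, mul_one]
    have hpos : 0 ≤ K * |h| := by positivity
    have h3 := hA z (z + h)
    have e3 : |z - (z + h)| = |h| := by rw [← abs_neg]; ring_nf
    rw [e3] at h3
    have hnn : ∀ z : ℝ, 0 ≤ (Set.Icc (-1 : ℝ) 1).indicator (fun _ => K * |h|) z :=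
      fun z => Set.indicator_nonneg (fun _ _ => hpos) z
    by_cases hz : |z| ≤ 1
    · rw [Set.indicator_of_mem (Set.mem_Icc.mpr (abs_le.mp hz))]
      linarith [hnn (z + h)]
    by_cases hz' : |z + h| ≤ 1
    · have := Set.indicator_of_mem (Set.mem_Icc.mpr (abs_le.mp hz')) (fun _ : ℝ => K * |h|)
      rw [this]
      linarith [hnn z]
    · rw [hs z (not_le.mp hz).le, hs _ (not_le.mp hz').le, sub_zero, norm_zero]
      exact add_nonneg (hnn _) (hnn _)
  rw [norm_mul, Complex.norm_ofNat] at hb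
  have hωh : |ω| * |h| = Real.pi := by
    rw [← abs_mul, hh, mul_div_cancel₀ _ hω, abs_of_pos Real.pi_pos]
  have h4 : ‖∫ z, F z‖ ≤ 2 * (K * |h|) := by linarith
  calc _ ≤ |ω| * (2 * (K * |h|)) := by gcongr
    _ = 2 * K * (|ω| * |h|) := by ring
    _ ≤ 8 * K := by rw [hωh]; nlinarith [Real.pi_le_four]

/-- Uniform decay of model oscillatory integrals with smooth amplitude. -/
lemma exists_norm_integral_smooth_le : ∃ C : ℝ, 0 ≤ C ∧ ∀ ν ν₀ μ μ₀ ε ω : ℝ, |ν| ≤ 1 → |ν₀| ≤ 1 →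
    |μ| ≤ 1 → |μ₀| ≤ 2 → |ε| ≤ 1 → |ω| ^ 4 * ‖∫ z, ((chi z * chi (μ * z + μ₀) *
      (1 + ν * z + ν₀) : ℝ) : ℂ) * Complex.exp (Complex.I * (ε * z ^ 2 + ω * z : ℝ))‖ ≤ C := by
  let F : (ℝ × ℝ × ℝ × ℝ × ℝ) × ℝ → ℂ := fun q =>
    ((chi q.2 * chi (q.1.2.2.1 * q.2 + q.1.2.2.2.1) * (1 + q.1.1 * q.2 + q.1.2.1) : ℝ) : ℂ) *
      Complex.exp (Complex.I * (q.1.2.2.2.2 * q.2 ^ 2 : ℝ))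
  have hF : ContDiff ℝ (⊤ : ℕ∞) F := by
    have h1 : ContDiff ℝ (⊤ : ℕ∞) fun q : (ℝ × ℝ × ℝ × ℝ × ℝ) × ℝ =>
        chi (q.1.2.2.1 * q.2 + q.1.2.2.2.1) := contDiff_chi.comp (by fun_prop)
    have h2 : ContDiff ℝ (⊤ : ℕ∞) fun q : (ℝ × ℝ × ℝ × ℝ × ℝ) × ℝ => chi q.2 :=
      contDiff_chi.comp (by fun_prop)
    have h3 : ContDiff ℝ (⊤ : ℕ∞) fun q : (ℝ × ℝ × ℝ × ℝ × ℝ) × ℝ =>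
        (1 + q.1.1 * q.2 + q.1.2.1) := by fun_prop
    have h4 : ContDiff ℝ (⊤ : ℕ∞) fun q : (ℝ × ℝ × ℝ × ℝ × ℝ) × ℝ =>
        (q.1.2.2.2.2 * q.2 ^ 2) := by fun_prop
    exact (Complex.ofRealCLM.contDiff.comp ((h2.mul h1).mul h3)).mul
      ((contDiff_const.mul (Complex.ofRealCLM.contDiff.comp h4)).cexp)
  obtain ⟨C, hC, h⟩ := exists_pow_mul_norm_integral_exp_le
    ((isCompact_Icc (a := (-1 : ℝ)) (b := 1)).prod ((isCompact_Icc (a := (-1 : ℝ)) (b := 1)).prod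
      ((isCompact_Icc (a := (-1 : ℝ)) (b := 1)).prod ((isCompact_Icc (a := (-2 : ℝ)) (b := 2)).prod
        (isCompact_Icc (a := (-1 : ℝ)) (b := 1)))))) one_pos 4 F hF (by
      intro p z hz
      simp only [F]
      rw [chi_eq_zero hz.le]; simp)
  refine ⟨C, hC, fun ν ν₀ μ μ₀ ε ω h1 h2 h3 h4 h5 => ?_⟩
  have := h (ν, ν₀, μ, μ₀, ε) ⟨abs_le.mp h1, abs_le.mp h2, abs_le.mp h3, abs_le.mp h4,
    abs_le.mp h5⟩ ω
  convert this using 5 with z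
  simp only [F]
  have e : Complex.exp (Complex.I * (ε * z ^ 2 + ω * z : ℝ)) =
      Complex.exp (Complex.I * (ε * z ^ 2 : ℝ)) * Complex.exp (Complex.I * (ω * z : ℝ)) := by
    rw [← Complex.exp_add]; congr 1; push_cast; ring
  rw [e]; push_cast; ring

lemma norm_mul_sub_mul_le {a a' b b' : ℂ} {A B K L D : ℝ} (ha : ‖a‖ ≤ A) (hb' : ‖b'‖ ≤ B)
    (h1 : ‖a - a'‖ ≤ K * D) (h2 : ‖b - b'‖ ≤ L * D) :
    ‖a * b - a' * b'‖ ≤ (A * L + K * B) * D := by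
  have e : a * b - a' * b' = a * (b - b') + (a - a') * b' := by ring
  rw [e]
  refine (norm_add_le _ _).trans ?_
  rw [norm_mul, norm_mul]
  have : ‖a‖ * ‖b - b'‖ ≤ A * (L * D) :=
    mul_le_mul ha h2 (norm_nonneg _) ((norm_nonneg _).trans ha)
  have h3 : ‖a - a'‖ * ‖b'‖ ≤ K * D * B :=
    mul_le_mul h1 hb' (norm_nonneg _) ((norm_nonneg _).trans h1)
  linarith

/-- The projection of the line onto `[-1, 1]`. -/
def clampOne (z : ℝ) : ℝ := max (-1) (min 1 z)

lemma abs_clampOne_le (z : ℝ) : |clampOne z| ≤ 1 := by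
  unfold clampOne
  rw [abs_le]
  exact ⟨le_max_left _ _, max_le (by norm_num) (min_le_left _ _)⟩

lemma clampOne_of_le {z : ℝ} (h : |z| ≤ 1) : clampOne z = z := by
  unfold clampOne
  rw [min_eq_right (abs_le.mp h).2, max_eq_right (abs_le.mp h).1]

lemma abs_clampOne_sub_le (z z' : ℝ) : |clampOne z - clampOne z'| ≤ |z - z'| := by
  unfold clampOne
  have h1 := abs_max_sub_max_le_abs (min 1 z) (min 1 z') (-1)
  have h2 := abs_min_sub_min_le_max 1 z 1 z'
  rw [max_comm (-1), max_comm (-1)]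
  refine h1.trans (h2.trans ?_)
  simp

lemma norm_exp_I_sub_exp_I_le (x y : ℝ) :
    ‖Complex.exp (Complex.I * (x : ℝ)) - Complex.exp (Complex.I * (y : ℝ))‖ ≤ |x - y| := by
  have e : Complex.exp (Complex.I * (x : ℝ)) - Complex.exp (Complex.I * (y : ℝ)) =
      Complex.exp (Complex.I * (y : ℝ)) * (Complex.exp (Complex.I * ((x - y : ℝ) : ℂ)) - 1) := by
    rw [mul_sub, ← Complex.exp_add, mul_one]
    congr 2; push_cast; ring
  rw [e, norm_mul, norm_exp_I_mul, one_mul]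
  exact norm_exp_I_sub_one_le _

/-- Uniform decay of model oscillatory integrals with Lipschitz amplitude. -/
lemma exists_norm_integral_abs_le : ∃ C : ℝ, 0 ≤ C ∧ ∀ l l' μ μ₀ ε ω : ℝ, |l| ≤ 1 → |l'| ≤ 1 →
    |μ| ≤ 1 → |ε| ≤ 1 → |ω| * ‖∫ z, ((chi z * chi (μ * z + μ₀) *
      |l + l' * z| : ℝ) : ℂ) * Complex.exp (Complex.I * (ε * z ^ 2 + ω * z : ℝ))‖ ≤ C := by
  obtain ⟨K, hK, h⟩ := exists_norm_chi_sub_le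
  refine ⟨8 * (2 * (2 * K + 1) + 4), by positivity, fun l l' μ μ₀ ε ω hl hl' hμ hε => ?_⟩
  let A : ℝ → ℂ := fun z => (((chi z : ℂ) * (chi (μ * z + μ₀) : ℂ)) *
    ((|l + l' * clampOne z| : ℝ) : ℂ)) *
    Complex.exp (Complex.I * (ε * clampOne z ^ 2 : ℝ))
  have hcl := abs_clampOne_le
  have hc1 : ∀ z : ℝ, ‖(chi z : ℂ)‖ ≤ 1 := fun z => by
    rw [Complex.norm_real]; exact abs_chi_le_one _
  have hs2 : ∀ z : ℝ, ‖((|l + l' * clampOne z| : ℝ) : ℂ)‖ ≤ 2 := fun z => by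
    rw [Complex.norm_real, Real.norm_eq_abs, abs_abs]
    refine (abs_add_le _ _).trans ?_
    rw [abs_mul]
    nlinarith [hcl z, abs_nonneg l', abs_nonneg (clampOne z)]
  have hA : ∀ z z', ‖A z - A z'‖ ≤ (2 * (2 * K + 1) + 4) * |z - z'| := by
    intro z z'
    have h1 : ‖(chi z : ℂ) - (chi z' : ℂ)‖ ≤ K * |z - z'| := by
      rw [← Complex.ofReal_sub, Complex.norm_real]; exact h _ _
    have h2 : ‖(chi (μ * z + μ₀) : ℂ) - (chi (μ * z' + μ₀) : ℂ)‖ ≤ K * |z - z'| := by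
      rw [← Complex.ofReal_sub, Complex.norm_real]
      refine (h _ _).trans ?_
      have : μ * z + μ₀ - (μ * z' + μ₀) = μ * (z - z') := by ring
      rw [this, abs_mul]
      gcongr
      exact mul_le_of_le_one_left (abs_nonneg _) hμ
    have h3 : ‖((|l + l' * clampOne z| : ℝ) : ℂ) - ((|l + l' * clampOne z'| : ℝ) : ℂ)‖ ≤
        1 * |z - z'| := by
      rw [← Complex.ofReal_sub, Complex.norm_real, Real.norm_eq_abs]
      refine (abs_abs_sub_abs_le_abs_sub _ _).trans ?_
      have : l + l' * clampOne z - (l + l' * clampOne z') = l' * (clampOne z - clampOne z') := by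
        ring
      rw [this, abs_mul]
      exact mul_le_mul hl' (abs_clampOne_sub_le _ _) (abs_nonneg _) zero_le_one
    have h4 : ‖Complex.exp (Complex.I * (ε * clampOne z ^ 2 : ℝ)) -
        Complex.exp (Complex.I * (ε * clampOne z' ^ 2 : ℝ))‖ ≤ 2 * |z - z'| := by
      refine (norm_exp_I_sub_exp_I_le _ _).trans ?_
      have : ε * clampOne z ^ 2 - ε * clampOne z' ^ 2 =
        ε * ((clampOne z + clampOne z') * (clampOne z - clampOne z')) := by ring
      rw [this, abs_mul, abs_mul]
      have h5 : |clampOne z + clampOne z'| ≤ 2 := by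
        linarith [abs_add_le (clampOne z) (clampOne z'), hcl z, hcl z']
      calc _ ≤ 1 * (2 * |z - z'|) := by
            exact mul_le_mul hε (mul_le_mul h5 (abs_clampOne_sub_le _ _) (abs_nonneg _) zero_le_two)
              (by positivity) zero_le_one
        _ = _ := one_mul _
    have m1 := norm_mul_sub_mul_le (hc1 z) (hc1 (μ * z' + μ₀)) h1 h2
    have n1 : ‖(chi z : ℂ) * (chi (μ * z + μ₀) : ℂ)‖ ≤ 1 := by
      rw [norm_mul]; exact mul_le_one₀ (hc1 _) (norm_nonneg _) (hc1 _)
    have m2 := norm_mul_sub_mul_le n1 (hs2 z') m1 h3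
    have n2 : ‖(chi z : ℂ) * (chi (μ * z + μ₀) : ℂ) * ((|l + l' * clampOne z| : ℝ) : ℂ)‖ ≤ 2 := by
      rw [norm_mul]
      have := mul_le_mul n1 (hs2 z) (norm_nonneg _) zero_le_one
      linarith
    have m3 := norm_mul_sub_mul_le n2 (norm_exp_I_mul _).le m2 h4
    refine m3.trans ?_
    nlinarith [abs_nonneg (z - z')]
  have key := abs_mul_norm_integral_lipschitz_le (by positivity) hA (fun z hz => by
    simp only [A]; rw [chi_eq_zero hz]; simp) ω
  convert key using 4
  ext z
  simp only [A]
  by_cases hz : |z| ≤ 1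
  · rw [clampOne_of_le hz]
    have e : Complex.exp (Complex.I * (ε * z ^ 2 + ω * z : ℝ)) =
        Complex.exp (Complex.I * (ε * z ^ 2 : ℝ)) * Complex.exp (Complex.I * (ω * z : ℝ)) := by
      rw [← Complex.exp_add]; congr 1; push_cast; ring
    rw [e, ← mul_assoc]
    push_cast; ring
  · rw [chi_eq_zero (not_le.mp hz).le]; simp

/-- The combined estimate for the integral in the rescaled variable. -/
lemma exists_norm_integral_window_le : ∃ C : ℝ, 0 ≤ C ∧ ∀ l a b w δ g ε ω L : ℝ,
    0 < b → 0 < w → w ≤ δ → 0 < L → L ≤ |g| → |a| ≤ δ + w → 2 * b * |l| ≤ |g| → |ε| ≤ 1 →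
    w * |g| / 2 ≤ |ω| → w * ‖∫ z, ((chi z * chi ((w * z - a) / δ) *
      |l + w * z + a| : ℝ) : ℂ) * Complex.exp (Complex.I * (ε * z ^ 2 + ω * z : ℝ))‖ ≤
      C * ((1 / (b * w * (w * L) ^ 2) + δ) / |g|) := by
  obtain ⟨C₁, hC₁, h1⟩ := exists_norm_integral_smooth_le
  obtain ⟨C₂, hC₂, h2⟩ := exists_norm_integral_abs_le
  refine ⟨8 * C₁ + 20 * C₂, by positivity, fun l a b w δ g ε ω L hb hw hwδ hL hLg ha hl hε hω => ?_⟩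
  have hδ : 0 < δ := hw.trans_le hwδ
  have hg : 0 < |g| := hL.trans_le hLg
  have hω0 : 0 < |ω| := lt_of_lt_of_le (by positivity) hω
  have ec : ∀ z, (w * z - a) / δ = w / δ * z + -a / δ := fun z => by field_simp; ring
  have hμ : |w / δ| ≤ 1 := by
    rw [abs_of_pos (by positivity)]; exact (div_le_one hδ).mpr hwδ
  rcases le_or_gt (4 * (w + δ)) |l| with hc | hc
  · have hl0 : l ≠ 0 := by
      intro h; rw [h, abs_zero] at hc; linarith
    have hlp : 0 < |l| := abs_pos.mpr hl0
    have h := h1 (w / l) (a / l) (w / δ) (-a / δ) ε ω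
      (by rw [abs_div, abs_of_pos hw, div_le_one hlp]; linarith)
      (by rw [abs_div, div_le_one hlp]; linarith) hμ
      (by rw [abs_div, abs_neg, abs_of_pos hδ, div_le_iff₀ hδ]; linarith) hε
    have e : ∀ z, ((chi z * chi ((w * z - a) / δ) * |l + w * z + a| : ℝ) : ℂ) *
          Complex.exp (Complex.I * (ε * z ^ 2 + ω * z : ℝ)) = (|l| : ℝ) *
        (((chi z * chi (w / δ * z + -a / δ) * (1 + w / l * z + a / l) : ℝ) : ℂ) *
          Complex.exp (Complex.I * (ε * z ^ 2 + ω * z : ℝ))) := by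
      intro z
      rw [ec]
      by_cases hz : |z| ≤ 1
      · have e1 : l + w * z + a = l * (1 + w / l * z + a / l) := by field_simp
        have e2 : 0 ≤ 1 + w / l * z + a / l := by
          have e3 : |w / l * z + a / l| ≤ 1 := by
            have : w / l * z + a / l = (w * z + a) / l := by ring
            rw [this, abs_div, div_le_one hlp]
            have := abs_add_le (w * z) a
            rw [abs_mul, abs_of_pos hw] at this
            nlinarith [abs_nonneg z]
          linarith [(abs_le.mp e3).1]
        rw [e1, abs_mul, abs_of_nonneg e2]
        push_cast; ring
      · rw [chi_eq_zero (not_le.mp hz).le]; simp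
    simp only [e]
    rw [integral_const_mul, norm_mul, Complex.norm_real, Real.norm_eq_abs, abs_abs]
    set N := ‖∫ z, ((chi z * chi (w / δ * z + -a / δ) * (1 + w / l * z + a / l) : ℝ) : ℂ) *
          Complex.exp (Complex.I * (ε * z ^ 2 + ω * z : ℝ))‖
    have hN : N ≤ C₁ * 16 / (w * |g|) ^ 4 := by
      rw [le_div_iff₀ (by positivity)]
      have : (w * |g| / 2) ^ 4 ≤ |ω| ^ 4 := by gcongr
      have h5 : (w * |g| / 2) ^ 4 * N ≤ C₁ := (by gcongr : _ ≤ |ω| ^ 4 * N).trans h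
      nlinarith
    have hl' : |l| ≤ |g| / (2 * b) := by rw [le_div_iff₀ (by positivity)]; linarith
    calc w * (|l| * N) ≤ w * (|g| / (2 * b) * (C₁ * 16 / (w * |g|) ^ 4)) := by gcongr
      _ = 8 * C₁ * (1 / (b * w * (w * |g|) ^ 2) / |g|) := by field_simp; ring
      _ ≤ 8 * C₁ * (1 / (b * w * (w * L) ^ 2) / |g|) := by gcongr
      _ ≤ (8 * C₁ + 20 * C₂) * ((1 / (b * w * (w * L) ^ 2) + δ) / |g|) := by
        gcongr <;> nlinarith
  · have h := h2 ((l + a) / (10 * δ)) (w / (10 * δ)) (w / δ) (-a / δ) ε ω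
      (by
        rw [abs_div, abs_of_pos (by positivity : 0 < 10 * δ), div_le_one (by positivity)]
        linarith [abs_add_le l a])
      (by
        rw [abs_div, abs_of_pos (by positivity : 0 < 10 * δ), div_le_one (by positivity),
          abs_of_pos hw]
        linarith) hμ hε
    have e : ∀ z, ((chi z * chi ((w * z - a) / δ) * |l + w * z + a| : ℝ) : ℂ) *
          Complex.exp (Complex.I * (ε * z ^ 2 + ω * z : ℝ)) = (10 * δ : ℝ) *
        (((chi z * chi (w / δ * z + -a / δ) * |(l + a) / (10 * δ) + w / (10 * δ) * z| : ℝ) : ℂ) *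
          Complex.exp (Complex.I * (ε * z ^ 2 + ω * z : ℝ))) := by
      intro z
      rw [ec]
      have e1 : l + w * z + a = (10 * δ) * ((l + a) / (10 * δ) + w / (10 * δ) * z) := by
        field_simp; ring
      rw [e1, abs_mul, abs_of_pos (by positivity : 0 < 10 * δ)]
      push_cast; ring
    simp only [e]
    rw [integral_const_mul, norm_mul, Complex.norm_real, Real.norm_eq_abs,
      abs_of_pos (by positivity : 0 < 10 * δ)]
    set N := ‖∫ z, ((chi z * chi (w / δ * z + -a / δ) *
      |(l + a) / (10 * δ) + w / (10 * δ) * z| : ℝ) : ℂ) *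
          Complex.exp (Complex.I * (ε * z ^ 2 + ω * z : ℝ))‖
    have hN : N ≤ C₂ * 2 / (w * |g|) := by
      rw [le_div_iff₀ (by positivity)]
      have h5 : (w * |g| / 2) * N ≤ C₂ := (by gcongr : _ ≤ |ω| * N).trans h
      nlinarith
    calc w * (10 * δ * N) ≤ w * (10 * δ * (C₂ * 2 / (w * |g|))) := by gcongr
      _ = 20 * C₂ * (δ / |g|) := by field_simp; ring
      _ ≤ (8 * C₁ + 20 * C₂) * ((1 / (b * w * (w * L) ^ 2) + δ) / |g|) := by
        have : 0 ≤ 1 / (b * w * (w * L) ^ 2) := by positivity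
        gcongr <;> linarith

/-- Decay of the windowed kernel in the off-resonant frequency region. -/
lemma exists_norm_fourier_window_kap_le : ∃ C : ℝ, 0 ≤ C ∧ ∀ α Q P b w δ L c x ξ : ℝ,
    0 < b → 0 < w → w ≤ δ → 0 < L → (b + |α|) * w ^ 2 ≤ 1 → |x - c| ≤ δ + w →
    L ≤ |2 * Real.pi * ξ + 2 * α * c + Q| →
    2 * b * |2 * c + P| ≤ |2 * Real.pi * ξ + 2 * α * c + Q| →
    ‖𝓕 (fun y => (chi ((y - c) / w) : ℂ) * kap α Q P b δ y x) ξ‖ ≤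
      C * ((1 / (b * w * (w * L) ^ 2) + δ) / |2 * Real.pi * ξ + 2 * α * c + Q|) := by
  obtain ⟨C, hC, h⟩ := exists_norm_integral_window_le
  refine ⟨C, hC, fun α Q P b w δ L c x ξ hb hw hwδ hL hα hx hg hl => ?_⟩
  have hδ : 0 < δ := hw.trans_le hwδ
  set g := 2 * Real.pi * ξ + 2 * α * c + Q with hgdef
  set l := 2 * c + P with hldef
  set a := x - c with hadef
  set F : ℝ → ℂ := fun y => Complex.exp (Complex.I * (-(2 * Real.pi * ξ) * y : ℝ)) *
    ((chi ((y - c) / w) : ℂ) * kap α Q P b δ y x) with hFdef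
  set W : ℝ := -(2 * Real.pi * ξ) * c - (α * (c ^ 2 - x ^ 2) + Q * (c - x)) with hW
  set k : ℝ := b * ((c - x) * (c + x + P)) with hk
  let J : ℝ → ℝ → ℂ := fun η z => ((chi z * chi ((w * z - a) / δ) * |l + w * z + a| : ℝ) : ℂ) *
      Complex.exp (Complex.I * ((η * b - α) * w ^ 2 * z ^ 2 + (w * (η * b * l - g)) * z : ℝ))
  have hF : ∀ z, F (c + w * z) = (Complex.exp (Complex.I * (W : ℝ)) * (1 / 2)) *
      ∫ η in (-1 : ℝ)..1, Complex.exp (Complex.I * (η * k : ℝ)) * J η z := by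
    intro z
    have e1 : (c + w * z - c) / w = z := by field_simp; ring
    have e2 : c + w * z - x = w * z - a := by rw [hadef]; ring
    have e3 : c + w * z + x + P = l + w * z + a := by rw [hadef, hldef]; ring
    have e4 : ∀ η : ℝ, Complex.exp (Complex.I * (η * k : ℝ)) * J η z =
        (((chi z * chi ((w * z - a) / δ) * |l + w * z + a| : ℝ) : ℂ) *
          (Complex.exp (Complex.I * (-(α * w ^ 2 * z ^ 2) - w * g * z : ℝ)))) *
          Complex.exp (Complex.I * (η * (b * (l + w * z + a) * (w * z - a)) : ℝ)) := by
      intro η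
      simp only [J]
      have : Complex.exp (Complex.I * (η * k : ℝ)) * Complex.exp (Complex.I *
          ((η * b - α) * w ^ 2 * z ^ 2 + (w * (η * b * l - g)) * z : ℝ)) =
          Complex.exp (Complex.I * (-(α * w ^ 2 * z ^ 2) - w * g * z : ℝ)) *
          Complex.exp (Complex.I * (η * (b * (l + w * z + a) * (w * z - a)) : ℝ)) := by
        rw [← Complex.exp_add, ← Complex.exp_add]
        congr 1
        rw [hk, hadef, hldef]
        push_cast; ring
      linear_combination ((chi z * chi ((w * z - a) / δ) * |l + w * z + a| : ℝ) : ℂ) * this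
    simp only [e4]
    rw [intervalIntegral.integral_const_mul]
    simp only [hFdef, kap]
    rw [e1, e2, e3, SS]
    push_cast
    rw [sinc_eq_integral]
    have e5 : Complex.exp (Complex.I * (-(2 * Real.pi * ξ) * (c + w * z))) *
        Complex.exp (Complex.I * -(α * ((c + w * z) ^ 2 - x ^ 2) + Q * (w * z - a))) =
        Complex.exp (Complex.I * (W : ℝ)) *
        Complex.exp (Complex.I * (-(α * w ^ 2 * z ^ 2) - w * g * z : ℝ)) := by
      rw [← Complex.exp_add, ← Complex.exp_add]
      congr 1
      rw [hW, hgdef, hadef]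
      push_cast; ring
    calc _ = (Complex.exp (Complex.I * (-(2 * Real.pi * ξ) * (c + w * z))) *
        Complex.exp (Complex.I * -(α * ((c + w * z) ^ 2 - x ^ 2) + Q * (w * z - a)))) *
        ((chi z : ℂ) * (|l + w * z + a| : ℝ) * chi ((w * z - a) / δ) * (1 / 2 *
          ∫ η in (-1 : ℝ)..1,
            Complex.exp (Complex.I * (η * (b * (l + w * z + a) * (w * z - a)) : ℝ)))) := by
          push_cast; ring
      _ = _ := by rw [e5]; push_cast; ring
  have hint : 𝓕 (fun y => (chi ((y - c) / w) : ℂ) * kap α Q P b δ y x) ξ =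
      (w : ℂ) * ∫ z, F (c + w * z) := by
    rw [fourier_eq_exp]
    have e1 := Measure.integral_comp_mul_left (fun t => F (c + t)) w
    rw [integral_add_left_eq_self F c, abs_inv, abs_of_pos hw] at e1
    rw [e1, Complex.real_smul, ← mul_assoc, Complex.ofReal_inv, mul_inv_cancel₀ (by exact_mod_cast hw.ne'), one_mul]
  have hswap : ∫ z, F (c + w * z) = (Complex.exp (Complex.I * (W : ℝ)) * (1 / 2)) *
      ∫ η in (-1 : ℝ)..1, Complex.exp (Complex.I * (η * k : ℝ)) * ∫ z, J η z := by
    simp only [hF]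
    rw [integral_const_mul]
    congr 1
    simp only [intervalIntegral.integral_of_le (by norm_num : (-1 : ℝ) ≤ 1)]
    rw [integral_integral_swap]
    · congr 1; ext η; rw [integral_const_mul]
    · have hc : Continuous fun q : ℝ × ℝ => Complex.exp (Complex.I * (q.2 * k : ℝ)) * J q.2 q.1 := by
        simp only [J]; fun_prop
      have hn : Nice fun z : ℝ => ((chi z * chi ((w * z - a) / δ) * |l + w * z + a| : ℝ) : ℂ) := by
        have hc' : Continuous fun z : ℝ =>
            ((chi z * chi ((w * z - a) / δ) * |l + w * z + a| : ℝ) : ℂ) := by fun_prop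
        exact ⟨.of_continuous hc', 1, fun z hz => by
          rw [chi_eq_zero (by simpa using hz.le)]; simp⟩
      refine Integrable.mono' (hn.integrable.norm.mul_prod (integrable_const (1 : ℝ)))
        hc.aestronglyMeasurable (Filter.Eventually.of_forall fun q => ?_)
      simp only [J, Function.uncurry_def]
      rw [norm_mul, norm_mul, norm_exp_I_mul, norm_exp_I_mul]
      simp
  set B := (1 / (b * w * (w * L) ^ 2) + δ) / |g|
  have hJ : ∀ η ∈ Set.Icc (-1 : ℝ) 1, w * ‖∫ z, J η z‖ ≤ C * B := by
    intro η hη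
    have hη' : |η| ≤ 1 := abs_le.mpr hη
    refine h l a b w δ g _ _ L hb hw hwδ hL hg hx hl ?_ ?_
    · rw [abs_mul, abs_of_nonneg (sq_nonneg w)]
      refine le_trans ?_ hα
      gcongr
      refine (abs_sub _ _).trans ?_
      rw [abs_mul, abs_of_pos hb]
      nlinarith
    · rw [abs_mul, abs_of_pos hw, mul_div_assoc]
      gcongr
      have h1 : |η * b * l| ≤ b * |l| := by
        rw [abs_mul, abs_mul, abs_of_pos hb]
        have : 0 ≤ b * |l| := by positivity
        nlinarith
      have h2 := abs_sub_abs_le_abs_sub g (η * b * l)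
      rw [abs_sub_comm]
      linarith
  have hN : ∀ η ∈ Set.uIoc (-1 : ℝ) 1,
      ‖Complex.exp (Complex.I * (η * k : ℝ)) * ∫ z, J η z‖ ≤ C * B / w := by
    intro η hη
    rw [Set.uIoc_of_le (by norm_num)] at hη
    rw [norm_mul, norm_exp_I_mul, one_mul, le_div_iff₀ hw, mul_comm]
    exact hJ η (Set.Ioc_subset_Icc_self hη)
  have hfin := intervalIntegral.norm_integral_le_of_norm_le_const hN
  rw [hint, hswap, norm_mul, norm_mul, norm_mul, norm_exp_I_mul, Complex.norm_real,
    Real.norm_of_nonneg hw.le]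
  have e6 : ‖(1 / 2 : ℂ)‖ = 1 / 2 := by norm_num
  have e7 : |(1 : ℝ) - -1| = 2 := by norm_num
  rw [e6, one_mul]
  rw [e7] at hfin
  calc _ ≤ w * (1 / 2 * (C * B / w * 2)) := by gcongr
    _ = C * B := by field_simp

lemma lintegral_inv_sq_le {L : ℝ} (hL : 0 < L) (e : ℝ) :
    ∫⁻ ξ : ℝ, (if L ≤ |2 * Real.pi * ξ + e| then
      ENNReal.ofReal ((1 / |2 * Real.pi * ξ + e|) ^ 2) else 0) ≤ ENNReal.ofReal (1 / L) := by
  have hpi := Real.pi_pos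
  set k := 2 * Real.pi / L with hk
  have hk0 : 0 < k := by positivity
  have hI : ∫ ξ : ℝ, 2 / L ^ 2 * (1 + (e / L + k * ξ) ^ 2)⁻¹ = 1 / L := by
    rw [integral_const_mul]
    have e1 := Measure.integral_comp_mul_left (fun z : ℝ => (1 + (e / L + z) ^ 2)⁻¹) k
    have e2 := integral_add_left_eq_self (μ := volume) (fun z : ℝ => (1 + z ^ 2)⁻¹) (e / L)
    rw [e1, e2, integral_univ_inv_one_add_sq, abs_of_pos (by positivity), smul_eq_mul, hk]
    field_simp
  have hint : Integrable fun ξ : ℝ => 2 / L ^ 2 * (1 + (e / L + k * ξ) ^ 2)⁻¹ := by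
    refine Integrable.const_mul ?_ _
    exact ((integrable_inv_one_add_sq.comp_add_left (e / L))).comp_mul_left' hk0.ne'
  rw [← hI, ofReal_integral_eq_lintegral_ofReal hint
    (Filter.Eventually.of_forall fun ξ => by positivity)]
  refine lintegral_mono fun ξ => ?_
  split_ifs with h
  · refine ENNReal.ofReal_le_ofReal ?_
    have e3 : e / L + k * ξ = (2 * Real.pi * ξ + e) / L := by rw [hk]; ring
    rw [e3, one_div, inv_pow, sq_abs]
    have h2 : L ^ 2 ≤ (2 * Real.pi * ξ + e) ^ 2 := by rw [← sq_abs (_ + e)]; gcongr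
    set G := 2 * Real.pi * ξ + e
    have hG : 0 < G ^ 2 := lt_of_lt_of_le (by positivity) h2
    have : 2 / L ^ 2 * (1 + (G / L) ^ 2)⁻¹ = 2 / (L ^ 2 + G ^ 2) := by field_simp
    rw [this, inv_eq_one_div, div_le_div_iff₀ hG (by positivity)]
    linarith
  · exact zero_le

lemma lintegral_mul_win_sq_le {h : ℝ → ℂ} (hh : Measurable h) {D : ℝ} (c : ℝ) :
    (∫⁻ x, ‖h x‖ₑ * ‖win D (x - c)‖ₑ) ^ 2 ≤
      ENNReal.ofReal (2 * D) * nsq fun x => h x * win D (x - c) := by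
  have hw := measurable_win D
  have hid : ∀ z, ‖win D z‖ₑ * ‖win D z‖ₑ = ‖win D z‖ₑ := by
    intro z; by_cases hz : |z| ≤ D
    · simp [win_of_le hz]
    · simp [win_of_lt (not_le.mp hz)]
  have h1 := lintegral_mul_sq_le (μ := (volume : Measure ℝ)) (f := fun x => ‖win D (x - c)‖ₑ)
    (g := fun x => ‖h x * win D (x - c)‖ₑ) (by fun_prop) (by fun_prop)
  have e1 : ∀ x, ‖win D (x - c)‖ₑ * ‖h x * win D (x - c)‖ₑ = ‖h x‖ₑ * ‖win D (x - c)‖ₑ := by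
    intro x; rw [enorm_mul, mul_left_comm, hid]
  simp only [e1] at h1
  refine h1.trans ?_
  unfold nsq
  gcongr
  have e2 := lintegral_win_le D c
  refine le_trans (lintegral_mono fun x => ?_) e2
  rw [sq, hid]
  apply le_of_eq
  congr 1
  by_cases hx : |x - c| ≤ D
  · rw [win_of_le hx, win_of_le (by rwa [abs_sub_comm])]
  · rw [not_le] at hx
    rw [win_of_lt hx, win_of_lt (by rwa [abs_sub_comm])]

lemma fourier_window_integral_kap {δ w : ℝ} (hw : 0 < w) (α Q P b : ℝ) {h : ℝ → ℂ}
    (hh : Nice h) (c ξ : ℝ) :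
    𝓕 (fun y => (chi ((y - c) / w) : ℂ) * ∫ x, kap α Q P b δ y x * h x) ξ =
      ∫ x, h x * 𝓕 (fun y => (chi ((y - c) / w) : ℂ) * kap α Q P b δ y x) ξ := by
  simp only [fourier_eq_exp]
  set E : ℝ → ℂ := fun y => Complex.exp (Complex.I * (-(2 * Real.pi * ξ) * y : ℝ)) with hE
  have hcont : Continuous fun q : ℝ × ℝ => (chi ((q.1 - c) / w) : ℂ) * kap α Q P b δ q.1 q.2 *
      E q.1 := by
    have := continuous_kap α Q P b δ
    simp only [hE]
    fun_prop
  obtain ⟨R, hR⟩ := hh.supp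
  have hn : Nice fun q : ℝ × ℝ => ((chi ((q.1 - c) / w) : ℂ) * kap α Q P b δ q.1 q.2 *
      E q.1) * h q.2 := by
    refine Nice.of_fst_snd (R := |c| + w) (R' := R)
      ((LocBdd.of_continuous hcont).mul (hh.toLocBdd.comp continuous_snd)) ?_
    intro y x hyx
    constructor
    · have h2 : |y - c| < w := by
        by_contra! hc; exact hyx (by simp [chi_div_eq_zero hw hc])
      have := abs_add_le (y - c) c
      rw [sub_add_cancel] at this
      rw [Real.norm_eq_abs]; linarith
    · by_contra! hc; exact hyx (by simp [hR x hc])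
  calc _ = ∫ y, ∫ x, ((chi ((y - c) / w) : ℂ) * kap α Q P b δ y x * E y) * h x := by
        congr 1; ext y
        rw [← mul_assoc, ← integral_const_mul]
        congr 1; ext x; ring
    _ = ∫ x, ∫ y, ((chi ((y - c) / w) : ℂ) * kap α Q P b δ y x * E y) * h x :=
        integral_integral_swap hn.integrable
    _ = _ := by
        congr 1; ext x
        rw [← integral_const_mul]
        congr 1; ext y; ring

lemma exists_lintegral_off_le : ∃ C : ℝ, 0 ≤ C ∧ ∀ (α Q P b w δ L : ℝ) (h : ℝ → ℂ),
    0 < b → 0 < w → w ≤ δ → 0 < L → (b + |α|) * w ^ 2 ≤ 1 → Nice h →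
    ∫⁻ c, ∫⁻ ξ, (if L ≤ |2 * Real.pi * ξ + 2 * α * c + Q| ∧
        2 * b * |2 * c + P| ≤ |2 * Real.pi * ξ + 2 * α * c + Q| then
        ‖𝓕 (fun y => (chi ((y - c) / w) : ℂ) * ∫ x, kap α Q P b δ y x * h x) ξ‖ₑ ^ 2 else 0) ≤
      ENNReal.ofReal (C * (δ * (1 / (b * w * (w * L) ^ 2) + δ)) ^ 2 / L) * nsq h := by
  obtain ⟨C, hC, hker⟩ := exists_norm_fourier_window_kap_le
  refine ⟨16 * C ^ 2, by positivity, fun α Q P b w δ L h hb hw hwδ hL hα hh => ?_⟩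
  have hδ : 0 < δ := hw.trans_le hwδ
  set Y := 1 / (b * w * (w * L) ^ 2) + δ with hY
  have hY0 : 0 < Y := by positivity
  set D := δ + w with hD
  have hpt : ∀ c ξ, (if L ≤ |2 * Real.pi * ξ + 2 * α * c + Q| ∧
        2 * b * |2 * c + P| ≤ |2 * Real.pi * ξ + 2 * α * c + Q| then
        ‖𝓕 (fun y => (chi ((y - c) / w) : ℂ) * ∫ x, kap α Q P b δ y x * h x) ξ‖ₑ ^ 2 else 0) ≤
      ENNReal.ofReal ((C * Y) ^ 2) * (ENNReal.ofReal (2 * D) * nsq fun x => h x * win D (x - c)) *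
        (if L ≤ |2 * Real.pi * ξ + (2 * α * c + Q)| then
          ENNReal.ofReal ((1 / |2 * Real.pi * ξ + (2 * α * c + Q)|) ^ 2) else 0) := by
    intro c ξ
    rw [← add_assoc]
    set g := 2 * Real.pi * ξ + 2 * α * c + Q
    split_ifs with h1 h2 h2
    · have h3 : ‖𝓕 (fun y => (chi ((y - c) / w) : ℂ) * ∫ x, kap α Q P b δ y x * h x) ξ‖ₑ ≤
          ENNReal.ofReal (C * (Y / |g|)) * ∫⁻ x, ‖h x‖ₑ * ‖win D (x - c)‖ₑ := by
        rw [fourier_window_integral_kap hw α Q P b hh,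
          ← lintegral_const_mul' _ _ ENNReal.ofReal_ne_top]
        refine (enorm_integral_le_lintegral_enorm _).trans (lintegral_mono fun x => ?_)
        rw [enorm_mul, mul_left_comm]
        gcongr
        by_cases hx : |x - c| ≤ D
        · rw [win_of_le hx, enorm_one, mul_one, ← ofReal_norm]
          exact ENNReal.ofReal_le_ofReal (hker α Q P b w δ L c x ξ hb hw hwδ hL hα hx h1.1 h1.2)
        · rw [win_of_lt (not_le.mp hx)]
          have : (fun y => (chi ((y - c) / w) : ℂ) * kap α Q P b δ y x) = fun _ => 0 := by
            ext y
            by_cases hy : w ≤ |y - c|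
            · simp [chi_div_eq_zero hw hy]
            · have h4 : δ ≤ |y - x| := by
                have := abs_sub_abs_le_abs_sub (x - c) (y - c)
                rw [sub_sub_sub_cancel_right, abs_sub_comm x y] at this
                rw [not_le] at hx hy
                linarith
              simp [kap, chi_div_eq_zero hδ h4]
          rw [this, fourier_eq_exp]
          simp
      calc _ ≤ (ENNReal.ofReal (C * (Y / |g|)) * ∫⁻ x, ‖h x‖ₑ * ‖win D (x - c)‖ₑ) ^ 2 :=
            pow_le_pow_left' h3 2
        _ = ENNReal.ofReal ((C * Y) ^ 2) * (∫⁻ x, ‖h x‖ₑ * ‖win D (x - c)‖ₑ) ^ 2 *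
            ENNReal.ofReal ((1 / |g|) ^ 2) := by
            rw [mul_pow, ← ENNReal.ofReal_pow (by positivity), mul_right_comm,
              ← ENNReal.ofReal_mul (by positivity)]
            congr 3; ring
        _ ≤ _ := by
            gcongr
            exact lintegral_mul_win_sq_le hh.meas c
    · exact absurd h1.1 h2
    · exact zero_le
    · exact zero_le
  have hfin : ∀ c, nsq (fun x => h x * win D (x - c)) ≠ ⊤ := fun c =>
    (hh.mul_right (locBdd_win D c)).nsq_lt_top.ne
  calc _ ≤ ∫⁻ c, ENNReal.ofReal ((C * Y) ^ 2) * (ENNReal.ofReal (2 * D) *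
          nsq fun x => h x * win D (x - c)) * ENNReal.ofReal (1 / L) := by
        refine lintegral_mono fun c => ?_
        refine (lintegral_mono (hpt c)).trans ?_
        rw [lintegral_const_mul' _ _ (by
          exact ENNReal.mul_ne_top ENNReal.ofReal_ne_top
            (ENNReal.mul_ne_top ENNReal.ofReal_ne_top (hfin c)))]
        gcongr
        exact lintegral_inv_sq_le hL _
    _ = ENNReal.ofReal ((C * Y) ^ 2) * ENNReal.ofReal (2 * D) * ENNReal.ofReal (1 / L) *
        ∫⁻ c, nsq fun x => h x * win D (x - c) := by
        rw [← lintegral_const_mul' _ _ (by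
          exact ENNReal.mul_ne_top (ENNReal.mul_ne_top ENNReal.ofReal_ne_top ENNReal.ofReal_ne_top)
            ENNReal.ofReal_ne_top)]
        congr 1; ext c; ring
    _ ≤ ENNReal.ofReal ((C * Y) ^ 2) * ENNReal.ofReal (2 * D) * ENNReal.ofReal (1 / L) *
        (ENNReal.ofReal (2 * D) * nsq h) := by
        gcongr
        exact lintegral_nsq_window_le hh.meas (measurable_win D) (norm_win_le D)
          fun z hz => win_of_lt hz
    _ = ENNReal.ofReal ((C * Y) ^ 2 * (2 * D) * (1 / L) * (2 * D)) * nsq h := by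
        have hx : 0 ≤ (C * Y) ^ 2 := by positivity
        have hD0 : 0 ≤ 2 * D := by positivity
        have hL0 : 0 ≤ 1 / L := by positivity
        rw [ENNReal.ofReal_mul' hD0, ENNReal.ofReal_mul' hL0, ENNReal.ofReal_mul hx, ← mul_assoc]
    _ ≤ _ := by
        gcongr
        have : D ≤ 2 * δ := by rw [hD]; linarith
        calc _ = (C * Y) ^ 2 * (2 * D) ^ 2 / L := by ring
          _ ≤ (C * Y) ^ 2 * (2 * (2 * δ)) ^ 2 / L := by gcongr
          _ = _ := by ring

lemma one_add_mul_SS_sq_le {b σ s d : ℝ} (hb : 0 < b) (hσb : b * σ ^ 2 ≤ 1)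
    (hs : |s| ≤ σ + |d|) : (1 + b * d ^ 2) * SS b s d ^ 2 ≤ 8 / b := by
  rw [le_div_iff₀ hb]
  have h1 : SS b s d ^ 2 ≤ (σ + |d|) ^ 2 := by
    rw [← sq_abs (SS b s d)]
    have := (abs_SS_le b s d).trans hs
    gcongr
  have h2 : SS b s d ^ 2 * (b * d) ^ 2 ≤ 1 := by
    have := abs_SS_mul_le b s d
    rw [← abs_mul] at this
    rw [← mul_pow, ← sq_abs]
    exact pow_le_one₀ (abs_nonneg _) (by simpa [abs_mul] using this)
  have h3 : (σ + |d|) ^ 2 ≤ 2 * (σ ^ 2 + d ^ 2) := by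
    rw [← sq_abs d]; nlinarith [sq_nonneg (σ - |d|)]
  rcases le_total (b * d ^ 2) 1 with h | h
  · calc (1 + b * d ^ 2) * SS b s d ^ 2 * b ≤ (1 + 1) * (2 * (σ ^ 2 + d ^ 2)) * b := by
          gcongr; exact h1.trans h3
      _ = 4 * (b * σ ^ 2 + b * d ^ 2) := by ring
      _ ≤ 8 := by linarith
  · have h4 : 0 ≤ b * SS b s d ^ 2 := by positivity
    nlinarith [mul_le_mul_of_nonneg_left h h4]

lemma lintegral_inv_one_add_mul_sq {b : ℝ} (hb : 0 < b) (y : ℝ) :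
    ∫⁻ x : ℝ, ENNReal.ofReal (8 / b * (1 + b * (y - x) ^ 2)⁻¹) =
      ENNReal.ofReal (8 * Real.pi / (b * √b)) := by
  have hk0 : 0 < √b := by positivity
  have hI : ∫ x : ℝ, 8 / b * (1 + (√b * x) ^ 2)⁻¹ = 8 * Real.pi / (b * √b) := by
    rw [integral_const_mul]
    have e1 := Measure.integral_comp_mul_left (fun z : ℝ => (1 + z ^ 2)⁻¹) √b
    rw [e1, integral_univ_inv_one_add_sq, abs_of_pos (by positivity), smul_eq_mul]
    field_simp
  have hint : Integrable fun x : ℝ => 8 / b * (1 + (√b * x) ^ 2)⁻¹ :=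
    (integrable_inv_one_add_sq.comp_mul_left' hk0.ne').const_mul _
  rw [← hI, ofReal_integral_eq_lintegral_ofReal hint
    (Filter.Eventually.of_forall fun ξ => by positivity),
    ← lintegral_sub_left_eq_self (μ := volume) _ y]
  congr 1; ext x
  rw [mul_pow, Real.sq_sqrt hb.le, sub_sub_cancel]

lemma nsq_indicator_integral_kap_le {α Q P b δ σ : ℝ} (hb : 0 < b)
    (hσb : b * σ ^ 2 ≤ 1) {h : ℝ → ℂ} (hh : Nice h) :
    nsq (fun y => (win σ (2 * y + P)) * ∫ x, kap α Q P b δ y x * h x) ≤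
      ENNReal.ofReal (8 * Real.pi / (b * √b) * σ) * nsq h := by
  have hpt : ∀ y, ‖(win σ (2 * y + P)) * ∫ x, kap α Q P b δ y x * h x‖ₑ ^ 2 ≤
      ENNReal.ofReal (8 * Real.pi / (b * √b)) * nsq h * ‖win (σ / 2) (-P / 2 - y)‖ₑ := by
    intro y
    by_cases hy : |2 * y + P| ≤ σ
    · have hy' : |-P / 2 - y| ≤ σ / 2 := by
        have : -P / 2 - y = -((2 * y + P) / 2) := by ring
        rw [this, abs_neg, abs_div, abs_two]; linarith
      rw [win_of_le hy, one_mul, win_of_le hy', enorm_one, mul_one]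
      have hc : Measurable fun x => kap α Q P b δ y x := by
        have := (continuous_kap α Q P b δ).comp (Continuous.prodMk_right y)
        exact this.measurable
      refine (enorm_integral_mul_sq_le hc.aemeasurable hh.meas.aemeasurable).trans ?_
      gcongr
      rw [← lintegral_inv_one_add_mul_sq hb y]
      refine lintegral_mono fun x => ?_
      rw [← ofReal_norm, ← ENNReal.ofReal_pow (norm_nonneg _)]
      refine ENNReal.ofReal_le_ofReal ?_
      have h1 : ‖kap α Q P b δ y x‖ ≤ |SS b (y + x + P) (y - x)| := by
        unfold kap
        rw [norm_mul, norm_mul, norm_exp_I_mul, one_mul, Complex.norm_real, Complex.norm_real]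
        exact mul_le_of_le_one_right (norm_nonneg _) (abs_chi_le_one _)
      have h2 : |y + x + P| ≤ σ + |y - x| := by
        have := abs_sub (2 * y + P) (y - x)
        have e : y + x + P = 2 * y + P - (y - x) := by ring
        rw [e]; linarith
      have h3 := one_add_mul_SS_sq_le hb hσb h2
      calc _ ≤ |SS b (y + x + P) (y - x)| ^ 2 := by gcongr
        _ = SS b (y + x + P) (y - x) ^ 2 := sq_abs _
        _ ≤ _ := by
          rw [← div_eq_mul_inv, le_div_iff₀ (by positivity), mul_comm]
          exact h3
    · rw [win_of_lt (not_le.mp hy)]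
      simp
  refine (lintegral_mono hpt).trans ?_
  rw [lintegral_const_mul' _ _ (ENNReal.mul_ne_top ENNReal.ofReal_ne_top hh.nsq_lt_top.ne),
    ENNReal.ofReal_mul (by positivity), mul_right_comm]
  gcongr
  refine (lintegral_win_le (σ / 2) (-P / 2)).trans (ENNReal.ofReal_le_ofReal ?_)
  linarith

lemma lintegral_vert_le {α Q P b w δ σ : ℝ} {h : ℝ → ℂ} (hb : 0 < b) (hw : 0 < w) (hδ : 0 < δ)
    (hσb : b * (σ + 2 * w) ^ 2 ≤ 1) (hh : Nice h) :
    ∫⁻ c, ∫⁻ ξ, (if |2 * c + P| ≤ σ then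
        ‖𝓕 (fun y => (chi ((y - c) / w) : ℂ) * ∫ x, kap α Q P b δ y x * h x) ξ‖ₑ ^ 2 else 0) ≤
      ENNReal.ofReal (2 * w * (8 * Real.pi / (b * √b) * (σ + 2 * w))) * nsq h := by
  have hS := nice_integral_kap hδ α Q P b hh
  set S : ℝ → ℂ := fun y => ∫ x, kap α Q P b δ y x * h x
  have hwin : Measurable fun y => win (σ + 2 * w) (2 * y + P) :=
    (measurable_win _).comp (by fun_prop)
  calc _ ≤ ∫⁻ c, nsq (fun y => (win (σ + 2 * w) (2 * y + P) * S y) * (chi ((y - c) / w) : ℂ)) := by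
        refine lintegral_mono fun c => ?_
        by_cases hc : |2 * c + P| ≤ σ
        · simp only [hc, if_true]
          change nsq (𝓕 (fun y => (chi ((y - c) / w) : ℂ) * S y)) ≤ _
          rw [nsq_fourier (hS.mul_left (locBdd_chi w c))]
          refine lintegral_mono fun y => ?_
          by_cases hy : w ≤ |y - c|
          · simp [chi_div_eq_zero hw hy]
          · have : |2 * y + P| ≤ σ + 2 * w := by
              have h1 := abs_add_le (2 * c + P) (2 * (y - c))
              have e : 2 * c + P + 2 * (y - c) = 2 * y + P := by ring
              rw [e, abs_mul, abs_two] at h1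
              linarith
            beta_reduce
            rw [win_of_le this, one_mul, mul_comm]
        · simp [hc]
    _ ≤ ENNReal.ofReal (2 * w) * nsq (fun y => win (σ + 2 * w) (2 * y + P) * S y) := by
        refine lintegral_nsq_window_le (q := fun z => (chi (z / w) : ℂ))
          (hwin.mul hS.meas) (by fun_prop) ?_ ?_
        · intro z; rw [Complex.norm_real]; exact abs_chi_le_one _
        · intro z hz; rw [chi_div_eq_zero hw hz.le]; simp
    _ ≤ _ := by
        rw [ENNReal.ofReal_mul (p := 2 * w) (by positivity), mul_assoc]
        exact mul_le_mul' le_rfl (nsq_indicator_integral_kap_le hb hσb hh)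

lemma exists_lintegral_good_le : ∃ C : ℝ, 0 ≤ C ∧ ∀ (α Q P b w δ L κ : ℝ) (h : ℝ → ℂ),
    0 < b → 0 < w → w ≤ δ → 0 < L → 0 < κ → (b + |α|) * w ^ 2 ≤ 1 → 2 * b * κ ≤ 1 →
    b * (κ * L + 2 * w) ^ 2 ≤ 1 → Nice h →
    ∫⁻ c, ∫⁻ ξ, (if |2 * c + P| ≤ κ * |2 * Real.pi * ξ + 2 * α * c + Q| then
        ‖𝓕 (fun y => (chi ((y - c) / w) : ℂ) * ∫ x, kap α Q P b δ y x * h x) ξ‖ₑ ^ 2 else 0) ≤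
      ENNReal.ofReal (C * ((δ * (1 / (b * w * (w * L) ^ 2) + δ)) ^ 2 / L +
        w / (b * √b) * (κ * L + 2 * w))) * nsq h := by
  obtain ⟨C, hC, hoff⟩ := exists_lintegral_off_le
  refine ⟨C + 16 * Real.pi, by positivity, fun α Q P b w δ L κ h hb hw hwδ hL hκ hα hbκ hσ hh => ?_⟩
  have hδ : 0 < δ := hw.trans_le hwδ
  have h1 := hoff α Q P b w δ L h hb hw hwδ hL hα hh
  have h2 := lintegral_vert_le (α := α) (Q := Q) (P := P) (σ := κ * L) hb hw hδ hσ hh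
  have hS := nice_integral_kap hδ α Q P b hh
  set F : ℝ → ℝ → ENNReal := fun c ξ =>
    ‖𝓕 (fun y => (chi ((y - c) / w) : ℂ) * ∫ x, kap α Q P b δ y x * h x) ξ‖ₑ ^ 2 with hF
  have hFm : Measurable fun z : ℝ × ℝ => F z.1 z.2 := by
    have h3 := measurable_fourier_param
      (F := fun (c : ℝ) y => (chi ((y - c) / w) : ℂ) * ∫ x, kap α Q P b δ y x * h x) (by
        have := hS.meas
        have h4 : Measurable fun q : ℝ × ℝ => (chi ((q.2 - q.1) / w) : ℂ) := by fun_prop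
        exact h4.mul (this.comp measurable_snd))
    exact h3.enorm.pow_const 2
  have hGm : Measurable fun z : ℝ × ℝ => if |2 * z.1 + P| ≤ κ * L then F z.1 z.2 else 0 :=
    Measurable.ite (measurableSet_le (by fun_prop) (by fun_prop)) hFm measurable_const
  calc _ ≤ ∫⁻ c, ∫⁻ ξ, ((if L ≤ |2 * Real.pi * ξ + 2 * α * c + Q| ∧
          2 * b * |2 * c + P| ≤ |2 * Real.pi * ξ + 2 * α * c + Q| then F c ξ else 0) +
          if |2 * c + P| ≤ κ * L then F c ξ else 0) := by
        refine lintegral_mono fun c => lintegral_mono fun ξ => ?_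
        beta_reduce
        set g := 2 * Real.pi * ξ + 2 * α * c + Q
        by_cases hg : |2 * c + P| ≤ κ * |g|
        · rw [if_pos hg]
          by_cases hL' : L ≤ |g|
          · rw [if_pos (c := L ≤ |g| ∧ _)]
            · exact le_self_add
            · refine ⟨hL', ?_⟩
              calc 2 * b * |2 * c + P| ≤ 2 * b * (κ * |g|) := by gcongr
                _ = 2 * b * κ * |g| := by ring
                _ ≤ 1 * |g| := by gcongr
                _ = |g| := one_mul _
          · rw [if_pos (c := |2 * c + P| ≤ κ * L)]
            · exact le_add_self
            · refine hg.trans ?_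
              gcongr
              exact (not_le.mp hL').le
        · rw [if_neg hg]; exact zero_le
    _ = (∫⁻ c, ∫⁻ ξ, (if L ≤ |2 * Real.pi * ξ + 2 * α * c + Q| ∧
          2 * b * |2 * c + P| ≤ |2 * Real.pi * ξ + 2 * α * c + Q| then F c ξ else 0)) +
          ∫⁻ c, ∫⁻ ξ, if |2 * c + P| ≤ κ * L then F c ξ else 0 := by
        rw [← lintegral_add_right _ hGm.lintegral_prod_right']
        congr 1; ext c
        rw [lintegral_add_right]
        exact hGm.comp measurable_prodMk_left
    _ ≤ _ := add_le_add h1 h2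
    _ ≤ _ := by
        rw [← add_mul, ← ENNReal.ofReal_add (by positivity) (by positivity)]
        gcongr
        set u := (δ * (1 / (b * w * (w * L) ^ 2) + δ)) ^ 2
        have e1 : 2 * w * (8 * Real.pi / (b * √b) * (κ * L + 2 * w)) =
          16 * Real.pi * (w / (b * √b) * (κ * L + 2 * w)) := by ring
        rw [e1, mul_div_assoc]
        have e2 : 0 ≤ w / (b * √b) * (κ * L + 2 * w) := by positivity
        have e3 : 0 ≤ u / L := by positivity
        nlinarith [Real.pi_pos, mul_nonneg hC e2, mul_nonneg Real.pi_pos.le e3]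

/-- Cauchy–Schwarz after splitting a bilinear integral into a part on which one factor is small
and a part living on a small set of parameters. -/
lemma lintegral_pairing_sq_le_of_split {Q Z : Type*} [MeasurableSpace Q] [MeasurableSpace Z]
    {μ : Measure Q} {ν : Measure Z} [SFinite μ] [SFinite ν] {A : Z → ENNReal}
    {B : Q → Z → ENNReal} {η : Q → ENNReal} (hA : Measurable A)
    (hB : Measurable fun x : Q × Z => B x.1 x.2) (hη : Measurable η) {a k E V V₀ : ENNReal}
    {good : Set (Q × Z)} (hg : MeasurableSet good) (hAa : ∫⁻ z, A z ^ 2 ∂ν ≤ a)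
    (hBk : ∀ᵐ q ∂μ, ∫⁻ z, B q z ^ 2 ∂ν ≤ k * η q)
    (hgood : ∀ᵐ q ∂μ, ∫⁻ z, good.indicator (fun x => B x.1 x.2 ^ 2) (q, z) ∂ν ≤ E * η q)
    (hbad : ∀ z, μ {q | (q, z) ∉ good} ≤ V) (hV : μ Set.univ ≤ V₀) :
    (∫⁻ q, ∫⁻ z, B q z * A z ∂ν ∂μ) ^ 2 ≤ 4 * (V₀ * E + V * k) * a * ∫⁻ q, η q ∂μ := by
  set g : Q × Z → ENNReal := good.indicator fun _ => 1 with hgdef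
  set g' : Q × Z → ENNReal := goodᶜ.indicator fun _ => 1 with hg'def
  have hgm : Measurable g := measurable_const.indicator hg
  have hgm' : Measurable g' := measurable_const.indicator hg.compl
  have hA2 : Measurable fun x : Q × Z => A x.2 := hA.comp measurable_snd
  have hsplit : ∀ x, g x + g' x = 1 := by
    intro x
    by_cases hx : x ∈ good <;> simp [hgdef, hg'def, hx]
  have hsq' : ∀ x, g' x ^ 2 = g' x := by
    intro x; by_cases hx : x ∈ good <;> simp [hg'def, hx]
  have e1 : ∫⁻ q, ∫⁻ z, B q z * A z ∂ν ∂μ =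
      (∫⁻ q, ∫⁻ z, (g (q, z) * B q z) * A z ∂ν ∂μ) +
        ∫⁻ q, ∫⁻ z, B q z * (g' (q, z) * A z) ∂ν ∂μ := by
    rw [← lintegral_add_right]
    · congr 1; ext q
      rw [← lintegral_add_right]
      · congr 1; ext z
        calc _ = (g (q, z) + g' (q, z)) * (B q z * A z) := by rw [hsplit, one_mul]
          _ = _ := by ring
      · exact (hB.mul (hgm'.mul hA2)).comp measurable_prodMk_left
    · exact (hB.mul (hgm'.mul hA2)).lintegral_prod_right'
  have h1 : (∫⁻ q, ∫⁻ z, (g (q, z) * B q z) * A z ∂ν ∂μ) ^ 2 ≤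
      (E * ∫⁻ q, η q ∂μ) * (a * V₀) := by
    refine (lintegral_lintegral_mul_sq_le (hgm.mul hB) hA2).trans ?_
    gcongr
    · rw [← lintegral_const_mul _ hη]
      refine lintegral_mono_ae (hgood.mono fun q hq => le_trans (lintegral_mono fun z => ?_) hq)
      by_cases hx : (q, z) ∈ good <;> simp [hgdef, hx]
    · rw [lintegral_const]
      gcongr
  have h2 : (∫⁻ q, ∫⁻ z, B q z * (g' (q, z) * A z) ∂ν ∂μ) ^ 2 ≤
      (k * ∫⁻ q, η q ∂μ) * (a * V) := by
    refine (lintegral_lintegral_mul_sq_le hB (hgm'.mul hA2)).trans ?_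
    gcongr
    · rw [← lintegral_const_mul _ hη]
      exact lintegral_mono_ae hBk
    · rw [lintegral_lintegral_swap ((hgm'.mul hA2).pow_const 2).aemeasurable]
      calc _ ≤ ∫⁻ z, A z ^ 2 * V ∂ν := by
            refine lintegral_mono fun z => ?_
            simp only [mul_pow, hsq']
            rw [lintegral_mul_const (f := fun x => g' (x, z)) _
              (hgm'.comp measurable_prodMk_right), mul_comm]
            gcongr
            refine le_trans (le_of_eq ?_) (hbad z)
            rw [← lintegral_indicator_one]
            · rfl
            · exact measurable_prodMk_right hg.compl
        _ = (∫⁻ z, A z ^ 2 ∂ν) * V := lintegral_mul_const _ (hA.pow_const 2)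
        _ ≤ _ := by gcongr
  rw [e1]
  refine (ENNReal.add_sq_le_four_mul _ _).trans ?_
  calc _ ≤ 4 * ((E * ∫⁻ q, η q ∂μ) * (a * V₀) + (k * ∫⁻ q, η q ∂μ) * (a * V)) := by gcongr
    _ = _ := by ring

lemma lintegral_sq_le_measure_mul {Q : Type*} [MeasurableSpace Q] {μ : Measure Q}
    {W : Q → ENNReal} (hW : Measurable W) {V₀ : ENNReal} (hV : μ Set.univ ≤ V₀) :
    (∫⁻ q, W q ∂μ) ^ 2 ≤ V₀ * ∫⁻ q, W q ^ 2 ∂μ := by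
  have := lintegral_mul_sq_le (μ := μ) (f := fun _ => 1) (g := W) aemeasurable_const hW.aemeasurable
  simp only [one_mul, one_pow, lintegral_const] at this
  exact this.trans (by gcongr)

lemma abs_eval_derivative_mul_le {g : ℝ[X]} (hg : g ≠ 0) {r u : ℝ} (hr : 0 < r)
    (h : ∀ z ∈ (g.map (algebraMap ℝ ℂ)).roots, r ≤ |u - z.re|) :
    r * |g.derivative.eval u| ≤ g.natDegree * |g.eval u| := by
  set G := g.map (algebraMap ℝ ℂ) with hG
  have hev : ∀ q : ℝ[X], (q.map (algebraMap ℝ ℂ)).eval (u : ℂ) = (q.eval u : ℝ) := fun q => by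
    exact (eval_map_apply (algebraMap ℝ ℂ) u)
  have hG0 : G ≠ 0 := by rwa [hG, Polynomial.map_ne_zero_iff (algebraMap ℝ ℂ).injective]
  have hne : G.eval (u : ℂ) ≠ 0 := by
    intro h0
    have := h u ((mem_roots hG0).mpr h0)
    simp at this
    linarith
  have hsplit : G.Splits := IsAlgClosed.splits G
  have h1 := hsplit.eval_derivative_div_eval_of_ne_zero hne
  have h2 : ‖G.derivative.eval (u : ℂ) / G.eval (u : ℂ)‖ ≤ g.natDegree * (1 / r) := by
    rw [h1]
    refine (norm_multiset_sum_le _).trans ?_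
    have : ∀ x ∈ (G.roots.map fun z => 1 / ((u : ℂ) - z)).map norm, x ≤ 1 / r := by
      intro x hx
      simp only [Multiset.map_map, Multiset.mem_map, Function.comp] at hx
      obtain ⟨z, hz, rfl⟩ := hx
      rw [norm_div, norm_one]
      refine one_div_le_one_div_of_le hr ((h z hz).trans ?_)
      have := Complex.abs_re_le_norm ((u : ℂ) - z)
      simpa using this
    refine (Multiset.sum_le_card_nsmul _ _ this).trans ?_
    rw [nsmul_eq_mul, Multiset.card_map, Multiset.card_map]
    gcongr
    exact (card_roots' G).trans natDegree_map_le
  rw [hG, derivative_map, hev, hev, ← Complex.ofReal_div, Complex.norm_real, Real.norm_eq_abs,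
    abs_div, div_le_iff₀ (abs_pos.mpr (by intro h0; apply hne; rw [hG, hev, h0]; simp))] at h2
  calc _ ≤ r * (g.natDegree * (1 / r) * |g.eval u|) := by gcongr
    _ = _ := by field_simp

lemma volume_abs_derivative_gt_le {g : ℝ[X]} {m : ℕ} (hm : g.natDegree ≤ m) {r : ℝ} (hr : 0 < r) :
    volume {u | ¬ r * |g.derivative.eval u| ≤ m * |g.eval u|} ≤ ENNReal.ofReal (2 * m * r) := by
  by_cases hg : g = 0
  · simp [hg]
  classical
  set s := (g.map (algebraMap ℝ ℂ)).roots.toFinset with hs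
  have hsub : {u | ¬ r * |g.derivative.eval u| ≤ m * |g.eval u|} ⊆
      ⋃ z ∈ s, Metric.ball z.re r := by
    intro u hu
    by_contra hc
    apply hu
    refine (abs_eval_derivative_mul_le hg hr fun z hz => ?_).trans ?_
    · by_contra! h
      apply hc
      simp only [Set.mem_iUnion]
      exact ⟨z, Multiset.mem_toFinset.mpr hz, by rwa [Metric.mem_ball, Real.dist_eq]⟩
    · gcongr
  refine (measure_mono hsub).trans ((measure_biUnion_finset_le _ _).trans ?_)
  simp only [Real.volume_ball, Finset.sum_const]
  rw [nsmul_eq_mul, ← ENNReal.ofReal_natCast, ← ENNReal.ofReal_mul (by positivity)]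
  refine ENNReal.ofReal_le_ofReal ?_
  have : (s.card : ℝ) ≤ m := by
    exact_mod_cast (Multiset.toFinset_card_le _).trans
      ((card_roots' _).trans (natDegree_map_le.trans hm))
  nlinarith

lemma volume_strip_le {K : ℝ} {U : Set ℝ} (hU : MeasurableSet U) :
    volume {q : ℝ × ℝ | |q.1 - q.2| ≤ K ∧ q.1 + q.2 ∈ U} ≤ ENNReal.ofReal K * volume U := by
  have hm : MeasurableSet {q : ℝ × ℝ | |q.1 - q.2| ≤ K ∧ q.1 + q.2 ∈ U} := by
    have h1 : Measurable fun q : ℝ × ℝ => q.1 + q.2 := by fun_prop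
    have h2 : MeasurableSet {q : ℝ × ℝ | |q.1 - q.2| ≤ K} :=
      measurableSet_le (by fun_prop) (by fun_prop)
    have h3 : {q : ℝ × ℝ | |q.1 - q.2| ≤ K ∧ q.1 + q.2 ∈ U} =
        {q : ℝ × ℝ | |q.1 - q.2| ≤ K} ∩ (fun q : ℝ × ℝ => q.1 + q.2) ⁻¹' U := by ext; simp
    rw [h3]
    exact h2.inter (h1 hU)
  have hm2 : MeasurableSet {q : ℝ × ℝ | |2 * q.1 - q.2| ≤ K ∧ q.2 ∈ U} := by
    have h2 : MeasurableSet {q : ℝ × ℝ | |2 * q.1 - q.2| ≤ K} :=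
      measurableSet_le (by fun_prop) (by fun_prop)
    have h3 : {q : ℝ × ℝ | |2 * q.1 - q.2| ≤ K ∧ q.2 ∈ U} =
        {q : ℝ × ℝ | |2 * q.1 - q.2| ≤ K} ∩ Prod.snd ⁻¹' U := by ext; simp
    rw [h3]
    exact h2.inter (measurable_snd hU)
  have hmeas2 : Measurable fun q : ℝ × ℝ => ({q : ℝ × ℝ | |2 * q.1 - q.2| ≤ K ∧ q.2 ∈ U}.indicator
      1 q : ENNReal) := measurable_one.indicator hm2
  rw [← lintegral_indicator_one hm, Measure.volume_eq_prod, lintegral_prod _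
    (measurable_one.indicator hm).aemeasurable]
  calc _ = ∫⁻ x, ∫⁻ y, ({q : ℝ × ℝ | |2 * q.1 - q.2| ≤ K ∧ q.2 ∈ U}.indicator 1 (x, y) : ENNReal) := by
        congr 1; ext x
        rw [← lintegral_sub_left_eq_self (μ := volume) _ (-x)]
        rw [← lintegral_neg_eq_self]
        congr 1; ext y
        have e1 : x - (-x - -y) = 2 * x - y := by ring
        have e2 : x + (-x - -y) = y := by ring
        by_cases h : |2 * x - y| ≤ K ∧ y ∈ U
        · rw [Set.indicator_of_mem (a := (x, y)) h, Set.indicator_of_mem]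
          · rfl
          · change |x - (-x - -y)| ≤ K ∧ x + (-x - -y) ∈ U
            rwa [e1, e2]
        · rw [Set.indicator_of_notMem (a := (x, y)) h, Set.indicator_of_notMem]
          change ¬ (|x - (-x - -y)| ≤ K ∧ x + (-x - -y) ∈ U)
          rwa [e1, e2]
    _ = ∫⁻ y, ∫⁻ x, ({q : ℝ × ℝ | |2 * q.1 - q.2| ≤ K ∧ q.2 ∈ U}.indicator 1 (x, y) : ENNReal) :=
        lintegral_lintegral_swap hmeas2.aemeasurable
    _ ≤ ∫⁻ y, ENNReal.ofReal K * U.indicator 1 y := by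
        refine lintegral_mono fun y => ?_
        by_cases hy : y ∈ U
        · simp only [Set.indicator_of_mem hy, Pi.one_apply, mul_one]
          calc _ ≤ ∫⁻ x, (Set.Icc ((y - K) / 2) ((y + K) / 2)).indicator 1 x := by
                refine lintegral_mono fun x => ?_
                refine Set.indicator_le_indicator_apply_of_subset (s := {x | |2 * x - y| ≤ K ∧ y ∈ U})
                  (f := fun _ => 1) ?_ zero_le
                rintro x ⟨h, -⟩
                rw [abs_le] at h
                constructor <;> linarith
            _ = _ := by
                rw [lintegral_indicator_one measurableSet_Icc, Real.volume_Icc]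
                congr 1; ring
        · simp [Set.indicator, hy]
    _ = _ := by
        rw [lintegral_const_mul _ (measurable_one.indicator hU), lintegral_indicator_one hU]

lemma lintegral_near_le {K : ℝ} {η : ℝ → ENNReal} (hη : Measurable η) {H : Set ℝ}
    (hH : MeasurableSet H) {Ω : Set (ℝ × ℝ)} (hΩm : MeasurableSet Ω)
    (hΩ : ∀ q ∈ Ω, |q.1 - q.2| ≤ K ∧ q.2 ∈ H) :
    ∫⁻ q in Ω, η q.2 ≤ ENNReal.ofReal (2 * K) * ∫⁻ x in H, η x := by
  have hpt : ∀ q : ℝ × ℝ, Ω.indicator (fun q => η q.2) q ≤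
      (Set.Icc (q.2 - K) (q.2 + K)).indicator 1 q.1 * H.indicator η q.2 := by
    intro q
    by_cases hq : q ∈ Ω
    · obtain ⟨h1, h2⟩ := hΩ q hq
      rw [abs_le] at h1
      rw [Set.indicator_of_mem hq, Set.indicator_of_mem h2, Set.indicator_of_mem]
      · simp
      · constructor <;> linarith
    · simp [Set.indicator, hq]
  have hm : Measurable fun q : ℝ × ℝ =>
      (Set.Icc (q.2 - K) (q.2 + K)).indicator (1 : ℝ → ENNReal) q.1 * H.indicator η q.2 := by
    have h1 : MeasurableSet {q : ℝ × ℝ | q.1 ∈ Set.Icc (q.2 - K) (q.2 + K)} := by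
      have h2 : MeasurableSet {q : ℝ × ℝ | q.2 - K ≤ q.1} :=
        measurableSet_le (by fun_prop) (by fun_prop)
      have h3 : MeasurableSet {q : ℝ × ℝ | q.1 ≤ q.2 + K} :=
        measurableSet_le (by fun_prop) (by fun_prop)
      have h4 : {q : ℝ × ℝ | q.1 ∈ Set.Icc (q.2 - K) (q.2 + K)} =
          {q : ℝ × ℝ | q.2 - K ≤ q.1} ∩ {q : ℝ × ℝ | q.1 ≤ q.2 + K} := by ext; simp
      rw [h4]
      exact h2.inter h3
    have h2 : Measurable ({q : ℝ × ℝ | q.1 ∈ Set.Icc (q.2 - K) (q.2 + K)}.indicator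
      (1 : ℝ × ℝ → ENNReal)) := measurable_one.indicator h1
    exact h2.mul ((hη.indicator hH).comp measurable_snd)
  rw [← lintegral_indicator hΩm]
  refine (lintegral_mono hpt).trans ?_
  rw [Measure.volume_eq_prod, lintegral_prod_symm _ hm.aemeasurable,
    ← lintegral_indicator hH, ← lintegral_const_mul _ (hη.indicator hH)]
  refine lintegral_mono fun y => ?_
  change ∫⁻ x, (Set.Icc (y - K) (y + K)).indicator 1 x * H.indicator η y ≤ _
  rw [lintegral_mul_const (f := fun x => (Set.Icc (y - K) (y + K)).indicator 1 x) _
    (measurable_one.indicator measurableSet_Icc),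
    lintegral_indicator_one measurableSet_Icc, Real.volume_Icc]
  gcongr
  apply le_of_eq; ring

/-- The kernel with the scale `δ` cut off in the second variable, restricted to a set `E` of
differences in the first variable. -/
def pker (p : ℝ[X]) (γ δ : ℝ) (E : Set ℝ) (x y : ℝ × ℝ) : ℂ :=
  Complex.exp (Complex.I * (γ * Psi p x y : ℝ)) *
    (SS (bet (x.1 - y.1)) (x.2 + y.2 + p.derivative.eval (x.1 + y.1)) (x.2 - y.2) : ℂ) *
    (chi ((x.2 - y.2) / δ) : ℂ) * E.indicator (fun _ => 1) (x.1 - y.1)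

/-- The one-dimensional slice of `pker` after removing the pure quadratic phases. -/
def skap (p : ℝ[X]) (γ δ x₀ y₁ x₁ : ℝ) : ℝ → ℝ → ℂ :=
  kap (γ * (y₁ + x₁ - 2 * x₀)) (γ * p.eval (y₁ + x₁)) (p.derivative.eval (y₁ + x₁))
    (bet (y₁ - x₁)) δ

lemma pker_eq (p : ℝ[X]) (γ δ : ℝ) (E : Set ℝ) (x₀ y₁ y x₁ x : ℝ) :
    pker p γ δ E (y₁, y) (x₁, x) = Complex.exp (Complex.I * (2 * γ * (y₁ - x₀) * y ^ 2 : ℝ)) *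
      (skap p γ δ x₀ y₁ x₁ y x *
        Complex.exp (Complex.I * (-(2 * γ * (x₁ - x₀) * x ^ 2) : ℝ))) *
      E.indicator (fun _ => 1) (y₁ - x₁) := by
  unfold pker skap kap Psi
  have : Complex.exp (Complex.I * (γ * ((y₁ - x₁) * (y ^ 2 + x ^ 2) - (y - x) * p.eval (y₁ + x₁)) : ℝ)) =
      Complex.exp (Complex.I * (2 * γ * (y₁ - x₀) * y ^ 2 : ℝ)) *
      Complex.exp (Complex.I * (-(γ * (y₁ + x₁ - 2 * x₀) * (y ^ 2 - x ^ 2) +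
        γ * p.eval (y₁ + x₁) * (y - x)) : ℝ)) *
      Complex.exp (Complex.I * (-(2 * γ * (x₁ - x₀) * x ^ 2) : ℝ)) := by
    rw [← Complex.exp_add, ← Complex.exp_add]
    congr 1; push_cast; ring
  simp only [this]
  ring

lemma measurable_kap_param {Z : Type*} [MeasurableSpace Z] {α Q P b y x : Z → ℝ}
    (hα : Measurable α) (hQ : Measurable Q) (hP : Measurable P) (hb : Measurable b)
    (hy : Measurable y) (hx : Measurable x) (δ : ℝ) :
    Measurable fun z => kap (α z) (Q z) (P z) (b z) δ (y z) (x z) := by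
  have hc : Continuous fun v : ℝ × ℝ × ℝ × ℝ × ℝ × ℝ =>
      kap v.1 v.2.1 v.2.2.1 v.2.2.2.1 δ v.2.2.2.2.1 v.2.2.2.2.2 := by
    unfold kap; fun_prop
  have h2 : Measurable fun z => (α z, Q z, P z, b z, y z, x z) := by fun_prop
  have h3 := hc.measurable.comp h2
  simp only [Function.comp_def] at h3
  exact h3

lemma measurable_integral_kap {α Q P b : ℝ × ℝ → ℝ}
    (hα : Measurable α) (hQ : Measurable Q) (hP : Measurable P) (hb : Measurable b)
    {h : ℝ × ℝ → ℝ → ℂ} (hh : Measurable fun z : (ℝ × ℝ) × ℝ => h z.1 z.2) (δ : ℝ) :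
    Measurable fun z : (ℝ × ℝ) × ℝ =>
      ∫ x, kap (α z.1) (Q z.1) (P z.1) (b z.1) δ z.2 x * h z.1 x := by
  have h1 : Measurable fun v : ((ℝ × ℝ) × ℝ) × ℝ =>
      kap (α v.1.1) (Q v.1.1) (P v.1.1) (b v.1.1) δ v.1.2 v.2 * h v.1.1 v.2 :=
    (measurable_kap_param (by fun_prop) (by fun_prop) (by fun_prop) (by fun_prop) (by fun_prop)
      (by fun_prop) δ).mul
      (hh.comp (by fun_prop : Measurable fun v : ((ℝ × ℝ) × ℝ) × ℝ => (v.1.1, v.2)))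
  exact h1.stronglyMeasurable.integral_prod_right'.measurable

lemma measurable_nsq_param {Z : Type*} [MeasurableSpace Z] {h : Z → ℝ → ℂ}
    (hh : Measurable fun z : Z × ℝ => h z.1 z.2) : Measurable fun q => nsq (h q) :=
  (hh.enorm.pow_const 2).lintegral_prod_right'

lemma enorm_fourier_star_window (S : ℝ → ℂ) (w c ξ : ℝ) :
    ‖𝓕 (fun y => (starRingEnd ℂ) ((starRingEnd ℂ) (S y) * (chi ((y - c) / w) : ℂ))) ξ‖ₑ =
      ‖𝓕 (fun y => (chi ((y - c) / w) : ℂ) * S y) ξ‖ₑ := by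
  have : (fun y => (starRingEnd ℂ) ((starRingEnd ℂ) (S y) * (chi ((y - c) / w) : ℂ))) =
      fun y => (chi ((y - c) / w) : ℂ) * S y := by
    funext y; simp [mul_comm]
  rw [this]

lemma measurable_chi_window_fourier {S : ℝ × ℝ → ℝ → ℂ}
    (hS : Measurable fun z : (ℝ × ℝ) × ℝ => S z.1 z.2) (w : ℝ) :
    Measurable fun x : (ℝ × ℝ) × (ℝ × ℝ) =>
      𝓕 (fun y => (chi ((y - x.2.1) / w) : ℂ) * S x.1 y) x.2.2 := by
  have h4 : Measurable fun v : ((ℝ × ℝ) × ℝ) × ℝ => S v.1.1 v.2 :=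
    hS.comp (by fun_prop : Measurable fun v : ((ℝ × ℝ) × ℝ) × ℝ => (v.1.1, v.2))
  have h1 := measurable_fourier_param
    (F := fun (v : (ℝ × ℝ) × ℝ) y => (chi ((y - v.2) / w) : ℂ) * S v.1 y) (by fun_prop)
  have h2 : Measurable fun x : (ℝ × ℝ) × (ℝ × ℝ) =>
      (((x.1, x.2.1), x.2.2) : ((ℝ × ℝ) × ℝ) × ℝ) := by fun_prop
  have h3 := h1.comp h2
  simp only [Function.comp_def] at h3
  exact h3

lemma lintegral_window_fourier_sq_le {S : ℝ → ℂ} (hS : Nice S) {w : ℝ} (hw : 0 < w) :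
    ∫⁻ z : ℝ × ℝ, ‖𝓕 (fun y => (chi ((y - z.1) / w) : ℂ) * S y) z.2‖ₑ ^ 2 ≤
      ENNReal.ofReal (2 * w) * nsq S := by
  have hm := measurable_fourier_param (F := fun (c : ℝ) y => (chi ((y - c) / w) : ℂ) * S y) (by
    have h1 := hS.meas
    fun_prop)
  rw [Measure.volume_eq_prod, lintegral_prod _ (hm.enorm.pow_const 2).aemeasurable]
  have : ∀ c, ∫⁻ ξ, ‖𝓕 (fun y => (chi ((y - c) / w) : ℂ) * S y) ξ‖ₑ ^ 2 =
      nsq (fun y => S y * (chi ((y - c) / w) : ℂ)) := by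
    intro c
    have h := nsq_fourier (hS.mul_right (locBdd_chi w c))
    simp only [mul_comm (S _)] at h ⊢
    exact h
  simp only [this]
  refine lintegral_nsq_window_le (q := fun z => (chi (z / w) : ℂ)) hS.meas (by fun_prop) ?_ ?_
  · intro z; rw [Complex.norm_real]; exact abs_chi_le_one _
  · intro z hz; rw [chi_div_eq_zero hw hz.le]; simp

lemma lintegral_sharp_window_sq_le {a : ℝ → ℂ} (ha : Nice a) (L : ℝ) :
    ∫⁻ z : ℝ × ℝ, ‖𝓕 (fun x => a x * win L (x - z.1)) z.2‖ₑ ^ 2 ≤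
      ENNReal.ofReal (2 * L) * nsq a := by
  rw [Measure.volume_eq_prod, lintegral_prod _
    ((measurable_window_fourier ha.meas (measurable_win L)).enorm.pow_const 2).aemeasurable]
  have : ∀ c, ∫⁻ ξ, ‖𝓕 (fun x => a x * win L (x - c)) ξ‖ₑ ^ 2 =
      nsq (fun x => a x * win L (x - c)) := fun c =>
    nsq_fourier (ha.mul_right (locBdd_win L c))
  simp only [this]
  exact lintegral_nsq_window_le ha.meas (measurable_win L) (norm_win_le L)
    fun z hz => win_of_lt hz

/-- Averaged bound for a family of pairings of localized Fourier transforms. -/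
lemma exists_window_family_le : ∃ C : ℝ, 0 < C ∧ ∀ {μ : Measure (ℝ × ℝ)} [SFinite μ]
    {α Q P b : ℝ × ℝ → ℝ} {δ w L κ mk Eg V V₀ L' : ℝ}, Measurable α → Measurable Q → Measurable P →
    Measurable b → (∀ q, 0 < b q) → 0 < w → w ≤ δ → 0 < L → 0 < κ → 0 ≤ mk → 0 ≤ Eg → 0 ≤ V →
    0 ≤ V₀ → 0 ≤ L' →
    (∀ᵐ q ∂μ, (b q + |α q|) * w ^ 2 ≤ 1 ∧ 2 * b q * κ ≤ 1 ∧ b q * (κ * L + 2 * w) ^ 2 ≤ 1 ∧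
      (δ * (1 / (b q * w * (w * L) ^ 2) + δ)) ^ 2 / L + w / (b q * √(b q)) * (κ * L + 2 * w) ≤ Eg ∧
      1 / b q * (1 + b q * δ ^ 2) ≤ mk) →
    (∀ z : ℝ × ℝ, μ {q | ¬ |2 * z.1 + P q| ≤ κ * |2 * Real.pi * z.2 + 2 * α q * z.1 + Q q|} ≤
      ENNReal.ofReal V) → μ Set.univ ≤ ENNReal.ofReal V₀ →
    ∀ {a : ℝ → ℂ} {h : ℝ × ℝ → ℝ → ℂ}, Nice a → (Measurable fun z : (ℝ × ℝ) × ℝ => h z.1 z.2) →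
    (∀ q, Nice (h q)) →
    (∫⁻ q, (∫⁻ z : ℝ × ℝ, ‖𝓕 (fun y => (chi ((y - z.1) / w) : ℂ) *
        ∫ x, kap (α q) (Q q) (P q) (b q) δ y x * h q x) z.2‖ₑ *
      ‖𝓕 (fun x => a x * win L' (x - z.1)) z.2‖ₑ) ∂μ) ^ 2 ≤
      ENNReal.ofReal (C * ((V₀ * Eg + V * (w * mk ^ 2)) * L')) * nsq a * ∫⁻ q, nsq (h q) ∂μ := by
  obtain ⟨C₂, hC₂, h2⟩ := exists_nsq_kap_le
  obtain ⟨C₃, hC₃, h3⟩ := exists_lintegral_good_le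
  refine ⟨8 * (C₃ + 2 * C₂ ^ 2), by positivity, ?_⟩
  intro μ _ α Q P b δ w L κ mk Eg V V₀ L' hα hQ hP hb hbpos hw hwδ hL hκ hmk hEg hV hV₀ hL' hae
    hVz hV₀' a h ha hh hhN
  have hδ : 0 < δ := hw.trans_le hwδ
  have hS := measurable_integral_kap hα hQ hP hb hh δ
  set S : ℝ × ℝ → ℝ → ℂ := fun q y => ∫ x, kap (α q) (Q q) (P q) (b q) δ y x * h q x with hSdef
  have hSN : ∀ q, Nice (S q) := fun q => nice_integral_kap hδ _ _ _ _ (hhN q)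
  have hBm : Measurable fun x : (ℝ × ℝ) × (ℝ × ℝ) =>
      ‖𝓕 (fun y => (chi ((y - x.2.1) / w) : ℂ) * S x.1 y) x.2.2‖ₑ :=
    (measurable_chi_window_fourier hS w).enorm
  have hAm : Measurable fun z : ℝ × ℝ => ‖𝓕 (fun x => a x * win L' (x - z.1)) z.2‖ₑ :=
    (measurable_window_fourier ha.meas (measurable_win L')).enorm
  have hgm : MeasurableSet {x : (ℝ × ℝ) × (ℝ × ℝ) |
      |2 * x.2.1 + P x.1| ≤ κ * |2 * Real.pi * x.2.2 + 2 * α x.1 * x.2.1 + Q x.1|} :=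
    measurableSet_le (by fun_prop) (by fun_prop)
  have key := lintegral_pairing_sq_le_of_split (μ := μ) (ν := (volume : Measure (ℝ × ℝ)))
    (A := fun z => ‖𝓕 (fun x => a x * win L' (x - z.1)) z.2‖ₑ)
    (B := fun q z => ‖𝓕 (fun y => (chi ((y - z.1) / w) : ℂ) * S q y) z.2‖ₑ)
    (η := fun q => nsq (h q)) hAm hBm (measurable_nsq_param hh)
    (k := ENNReal.ofReal (2 * w) * ENNReal.ofReal ((C₂ * mk) ^ 2))
    (E := ENNReal.ofReal (C₃ * Eg)) hgm (lintegral_sharp_window_sq_le ha L') ?_ ?_ hVz hV₀'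
  · refine key.trans ?_
    refine (le_of_eq_of_le (b := ENNReal.ofReal (4 * (V₀ * (C₃ * Eg) +
        V * (2 * w * (C₂ * mk) ^ 2)) * (2 * L')) * nsq a * ∫⁻ q, nsq (h q) ∂μ) ?_
      (mul_le_mul_left (mul_le_mul_left (ENNReal.ofReal_le_ofReal ?_) (nsq a)) _))
    · have e : ∀ x y z u v t : ℝ, 0 ≤ x → 0 ≤ y → 0 ≤ z → 0 ≤ u → 0 ≤ v → 0 ≤ t →
          ENNReal.ofReal (4 * (x * y + z * (u * v)) * t) =
          4 * (ENNReal.ofReal x * ENNReal.ofReal y + ENNReal.ofReal z * (ENNReal.ofReal u *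
            ENNReal.ofReal v)) * ENNReal.ofReal t := by
        intro x y z u v t hx hy hz hu hv ht
        rw [ENNReal.ofReal_mul (by positivity), ENNReal.ofReal_mul (by positivity),
          ENNReal.ofReal_add (by positivity) (by positivity), ENNReal.ofReal_mul hx,
          ENNReal.ofReal_mul hz, ENNReal.ofReal_mul hu, ENNReal.ofReal_ofNat]
      rw [e _ _ _ _ _ _ hV₀ (by positivity) hV (by positivity) (by positivity) (by positivity)]
      ring
    · have e1 : 0 ≤ V₀ * Eg * L' := by positivity
      have e2 : 0 ≤ V * (w * mk ^ 2) * L' := by positivity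
      nlinarith [mul_nonneg hC₃ e2, mul_nonneg (sq_nonneg C₂) e1]
  · filter_upwards [hae] with q hq
    refine (lintegral_window_fourier_sq_le (hSN q) hw).trans ?_
    rw [mul_assoc]
    refine mul_le_mul' le_rfl ((h2 (α q) (Q q) (P q) (b q) δ (h q) (hbpos q) hδ (hhN q)).trans ?_)
    have := hbpos q
    gcongr
    exact hq.2.2.2.2
  · filter_upwards [hae] with q hq
    have hp := hbpos q
    refine le_of_eq_of_le ?_ ((h3 (α q) (Q q) (P q) (b q) w δ L κ (h q) hp hw hwδ hL hκ
      hq.1 hq.2.1 hq.2.2.1 (hhN q)).trans ?_)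
    · have hm2 : Measurable fun z : ℝ × ℝ => {x : (ℝ × ℝ) × (ℝ × ℝ) |
        |2 * x.2.1 + P x.1| ≤ κ * |2 * Real.pi * x.2.2 + 2 * α x.1 * x.2.1 + Q x.1|}.indicator
        (fun x => ‖𝓕 (fun y => (chi ((y - x.2.1) / w) : ℂ) * S x.1 y) x.2.2‖ₑ ^ 2) (q, z) :=
        ((hBm.pow_const 2).indicator hgm).comp measurable_prodMk_left
      rw [Measure.volume_eq_prod, lintegral_prod _ hm2.aemeasurable]
      congr 1
    · gcongr
      exact hq.2.2.2.1

/-- Averaged bound for the pairings of two families of model operators. -/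
lemma exists_pairing_family_le : ∃ C : ℝ, 0 < C ∧ ∀ {μ : Measure (ℝ × ℝ)} [SFinite μ]
    {α Q P b α' Q' P' b' : ℝ × ℝ → ℝ} {δ w L κ mk Eg V V₀ δ' m e : ℝ},
    Measurable α → Measurable Q → Measurable P → Measurable b →
    (∀ q, 0 < b q) → (∀ q, 0 < b' q) → 0 < w → w ≤ δ → 0 < L → 0 < κ → 0 ≤ mk → 0 ≤ Eg → 0 ≤ V →
    0 ≤ V₀ → 0 < δ' → 0 ≤ m → 0 ≤ e →
    (∀ᵐ q ∂μ, (b q + |α q|) * w ^ 2 ≤ 1 ∧ 2 * b q * κ ≤ 1 ∧ b q * (κ * L + 2 * w) ^ 2 ≤ 1 ∧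
      (δ * (1 / (b q * w * (w * L) ^ 2) + δ)) ^ 2 / L + w / (b q * √(b q)) * (κ * L + 2 * w) ≤ Eg ∧
      1 / b q * (1 + b q * δ ^ 2) ≤ mk) →
    (∀ᵐ q ∂μ, 1 / b' q * (1 + b' q * δ' ^ 2 + |α' q| * δ' ^ 2) ≤ m ∧ |α' q| / b' q ≤ e) →
    (∀ z : ℝ × ℝ, μ {q | ¬ |2 * z.1 + P q| ≤ κ * |2 * Real.pi * z.2 + 2 * α q * z.1 + Q q|} ≤
      ENNReal.ofReal V) → μ Set.univ ≤ ENNReal.ofReal V₀ →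
    ∀ {a : ℝ → ℂ} {h : ℝ × ℝ → ℝ → ℂ}, Nice a → (Measurable fun z : (ℝ × ℝ) × ℝ => h z.1 z.2) →
    (∀ q, Nice (h q)) →
    (∫⁻ q, ‖∫ y, (starRingEnd ℂ) (∫ x, kap (α q) (Q q) (P q) (b q) δ y x * h q x) *
        ∫ x, kap (α' q) (Q' q) (P' q) (b' q) δ' y x * a x‖ₑ ∂μ) ^ 2 ≤
      ENNReal.ofReal (C * ((m / w) ^ 2 * ((V₀ * Eg + V * (w * mk ^ 2)) * (δ' + w)) +
        (w * (1 + e)) ^ 2 * (V₀ * (δ' ^ 2 * mk ^ 2)))) * nsq a * ∫⁻ q, nsq (h q) ∂μ := by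
  obtain ⟨C₁, hC₁, h1⟩ := exists_enorm_fourier_kapFrozen_le
  obtain ⟨C₂, hC₂, h2⟩ := exists_nsq_kap_le
  obtain ⟨C₃, hC₃, h3⟩ := exists_window_family_le
  set I := ∫ z, chi z with hI
  have hIpos : 0 < I := integral_chi_pos
  refine ⟨4 * (C₁ / I) ^ 2 * C₃ + 64 * C₂ ^ 2, by positivity, ?_⟩
  intro μ _ α Q P b α' Q' P' b' δ w L κ mk Eg V V₀ δ' m e hα hQ hP hb hbpos hb'pos hw hwδ hL hκ
    hmk hEg hV hV₀ hδ' hm he hae hae' hVz hV₀' a h ha hh hhN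
  have hδ : 0 < δ := hw.trans_le hwδ
  have hS := measurable_integral_kap hα hQ hP hb hh δ
  have hT := h3 hα hQ hP hb hbpos hw hwδ hL hκ hmk hEg hV hV₀ (by positivity : 0 ≤ δ' + w) hae hVz
    hV₀' ha hh hhN
  have hSN : ∀ q, Nice (fun y => ∫ x, kap (α q) (Q q) (P q) (b q) δ y x * h q x) :=
    fun q => nice_integral_kap hδ _ _ _ _ (hhN q)
  have hSb : ∀ᵐ q ∂μ, nsq (fun y => ∫ x, kap (α q) (Q q) (P q) (b q) δ y x * h q x) ≤
      ENNReal.ofReal ((C₂ * mk) ^ 2) * nsq (h q) := by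
    filter_upwards [hae] with q hq
    refine (h2 (α q) (Q q) (P q) (b q) δ (h q) (hbpos q) hδ (hhN q)).trans ?_
    have := hbpos q
    gcongr
    exact hq.2.2.2.2
  generalize hSS : (fun q y => ∫ x, kap (α q) (Q q) (P q) (b q) δ y x * h q x) = S at *
  have hSS' : ∀ q y, ∫ x, kap (α q) (Q q) (P q) (b q) δ y x * h q x = S q y :=
    fun q y => congrFun (congrFun hSS q) y
  simp only [hSS'] at hS hT hSN hSb ⊢
  have hBA : Measurable fun x : (ℝ × ℝ) × (ℝ × ℝ) =>
      ‖𝓕 (fun y => (chi ((y - x.2.1) / w) : ℂ) * S x.1 y) x.2.2‖ₑ *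
        ‖𝓕 (fun y => a y * win (δ' + w) (y - x.2.1)) x.2.2‖ₑ :=
    (measurable_chi_window_fourier hS w).enorm.mul
      (((measurable_window_fourier ha.meas (measurable_win (δ' + w))).enorm).comp measurable_snd)
  have hW : Measurable fun q => ∫⁻ y, ∫⁻ x, ‖S q y‖ₑ * ‖win δ' (y - x)‖ₑ * ‖a x‖ₑ := by
    have h4 : Measurable fun v : ((ℝ × ℝ) × ℝ) × ℝ =>
        ‖S v.1.1 v.1.2‖ₑ * ‖win δ' (v.1.2 - v.2)‖ₑ * ‖a v.2‖ₑ := by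
      have h5 : Measurable fun v : ((ℝ × ℝ) × ℝ) × ℝ => S v.1.1 v.1.2 := hS.comp measurable_fst
      have h6 := ha.meas
      fun_prop
    exact h4.lintegral_prod_right'.lintegral_prod_right'
  set T := ∫⁻ q, (∫⁻ z : ℝ × ℝ, ‖𝓕 (fun y => (chi ((y - z.1) / w) : ℂ) * S q y) z.2‖ₑ *
      ‖𝓕 (fun x => a x * win (δ' + w) (x - z.1)) z.2‖ₑ) ∂μ
  have hWsq : (∫⁻ q, (∫⁻ y, ∫⁻ x, ‖S q y‖ₑ * ‖win δ' (y - x)‖ₑ * ‖a x‖ₑ) ∂μ) ^ 2 ≤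
      ENNReal.ofReal (V₀ * (2 * δ') ^ 2 * (C₂ * mk) ^ 2) * nsq a * ∫⁻ q, nsq (h q) ∂μ := by
    calc _ ≤ ENNReal.ofReal V₀ * ∫⁻ q, (∫⁻ y, ∫⁻ x, ‖S q y‖ₑ * ‖win δ' (y - x)‖ₑ * ‖a x‖ₑ) ^ 2 ∂μ :=
          lintegral_sq_le_measure_mul hW hV₀'
      _ ≤ ENNReal.ofReal V₀ * ∫⁻ q, ENNReal.ofReal ((2 * δ') ^ 2 * (C₂ * mk) ^ 2) * nsq a *
            nsq (h q) ∂μ := by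
          refine mul_le_mul' le_rfl (lintegral_mono_ae ?_)
          filter_upwards [hSb] with q hq
          refine (lintegral_win_pairing_sq_le hδ'.le (hSN q).meas ha.meas).trans ?_
          refine (mul_le_mul' (mul_le_mul' le_rfl hq) le_rfl).trans (le_of_eq ?_)
          rw [ENNReal.ofReal_mul (by positivity)]
          ring
      _ = _ := by
          rw [lintegral_const_mul _ (measurable_nsq_param hh), mul_assoc V₀,
            ENNReal.ofReal_mul hV₀]
          ring
  set W := ∫⁻ q, (∫⁻ y, ∫⁻ x, ‖S q y‖ₑ * ‖win δ' (y - x)‖ₑ * ‖a x‖ₑ) ∂μ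
  set η := ∫⁻ q, nsq (h q) ∂μ
  have hlin : ENNReal.ofReal (w * I) * ∫⁻ q, ‖∫ y, (starRingEnd ℂ) (S q y) *
        ∫ x, kap (α' q) (Q' q) (P' q) (b' q) δ' y x * a x‖ₑ ∂μ ≤
      ENNReal.ofReal (C₁ * m) * T +
        ENNReal.ofReal (w * I) * (ENNReal.ofReal (2 * w * (1 + e)) * W) := by
    have hrhs : ENNReal.ofReal (C₁ * m) * T +
        ENNReal.ofReal (w * I) * (ENNReal.ofReal (2 * w * (1 + e)) * W) =
        ∫⁻ q, (ENNReal.ofReal (C₁ * m) *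
          (∫⁻ z : ℝ × ℝ, ‖𝓕 (fun y => (chi ((y - z.1) / w) : ℂ) * S q y) z.2‖ₑ *
            ‖𝓕 (fun x => a x * win (δ' + w) (x - z.1)) z.2‖ₑ) +
          ENNReal.ofReal (w * I) * (ENNReal.ofReal (2 * w * (1 + e)) *
            ∫⁻ y, ∫⁻ x, ‖S q y‖ₑ * ‖win δ' (y - x)‖ₑ * ‖a x‖ₑ)) ∂μ := by
      rw [lintegral_add_left (hBA.lintegral_prod_right'.const_mul _),
        lintegral_const_mul _ hBA.lintegral_prod_right',
        lintegral_const_mul _ (hW.const_mul _), lintegral_const_mul _ hW]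
    rw [hrhs, ← lintegral_const_mul' _ _ ENNReal.ofReal_ne_top]
    refine lintegral_mono_ae ?_
    filter_upwards [hae'] with q hq
    have hbq := hb'pos q
    have hJ := enorm_integral_kap_le h1 (α := α' q) (Q := Q' q) (P := P' q) hbq hδ' hw (hSN q).star ha
    rw [← hI] at hJ
    refine hJ.trans (add_le_add (mul_le_mul' (ENNReal.ofReal_le_ofReal ?_) ?_)
      (mul_le_mul' le_rfl (mul_le_mul' (ENNReal.ofReal_le_ofReal ?_) ?_)))
    · gcongr; exact hq.1
    · have hm2 : Measurable fun z : ℝ × ℝ => ‖𝓕 (fun y => (chi ((y - z.1) / w) : ℂ) * S q y) z.2‖ₑ *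
          ‖𝓕 (fun y => a y * win (δ' + w) (y - z.1)) z.2‖ₑ := by
        have h6 := hBA.comp (measurable_prodMk_left (x := q))
        simp only [Function.comp_def] at h6
        exact h6
      rw [Measure.volume_eq_prod, lintegral_prod _ hm2.aemeasurable]
      simp only [enorm_fourier_star_window]
      exact le_rfl
    · gcongr; exact hq.2
    · simp only [RCLike.enorm_conj]; exact le_rfl
  set D := ∫⁻ q, ‖∫ y, (starRingEnd ℂ) (S q y) *
        ∫ x, kap (α' q) (Q' q) (P' q) (b' q) δ' y x * a x‖ₑ ∂μ
  have hsq : ENNReal.ofReal ((w * I) ^ 2) * D ^ 2 ≤ ENNReal.ofReal ((w * I) ^ 2) *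
      (ENNReal.ofReal ((4 * (C₁ / I) ^ 2 * C₃ + 64 * C₂ ^ 2) *
        ((m / w) ^ 2 * ((V₀ * Eg + V * (w * mk ^ 2)) * (δ' + w)) +
        (w * (1 + e)) ^ 2 * (V₀ * (δ' ^ 2 * mk ^ 2)))) * nsq a * η) := by
    set X1 := (V₀ * Eg + V * (w * mk ^ 2)) * (δ' + w) with hX1
    have hX1' : 0 ≤ X1 := by positivity
    calc ENNReal.ofReal ((w * I) ^ 2) * D ^ 2 = (ENNReal.ofReal (w * I) * D) ^ 2 := by
          rw [mul_pow (ENNReal.ofReal _), ENNReal.ofReal_pow (by positivity)]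
      _ ≤ _ := pow_le_pow_left' hlin 2
      _ ≤ _ := ENNReal.add_sq_le_four_mul _ _
      _ = 4 * (ENNReal.ofReal (C₁ * m) ^ 2 * T ^ 2 +
          ENNReal.ofReal (w * I) ^ 2 * (ENNReal.ofReal (2 * w * (1 + e)) ^ 2 * W ^ 2)) := by
          simp only [mul_pow]
      _ ≤ 4 * (ENNReal.ofReal (C₁ * m) ^ 2 * (ENNReal.ofReal (C₃ * X1) * nsq a * η) +
          ENNReal.ofReal (w * I) ^ 2 * (ENNReal.ofReal (2 * w * (1 + e)) ^ 2 *
            (ENNReal.ofReal (V₀ * (2 * δ') ^ 2 * (C₂ * mk) ^ 2) * nsq a * η))) := by gcongr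
      _ = ENNReal.ofReal (4 * ((C₁ * m) ^ 2 * (C₃ * X1) + (w * I) ^ 2 * (2 * w * (1 + e)) ^ 2 *
            (V₀ * (2 * δ') ^ 2 * (C₂ * mk) ^ 2))) * (nsq a * η) := by
          have e : ∀ x y z u v : ℝ, 0 ≤ x → 0 ≤ y → 0 ≤ z → 0 ≤ u → 0 ≤ v →
              ENNReal.ofReal (4 * (x ^ 2 * y + u ^ 2 * v ^ 2 * z)) =
              4 * (ENNReal.ofReal x ^ 2 * ENNReal.ofReal y +
                ENNReal.ofReal u ^ 2 * ENNReal.ofReal v ^ 2 * ENNReal.ofReal z) := by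
            intro x y z u v hx hy hz hu hv
            rw [ENNReal.ofReal_mul (by norm_num), ENNReal.ofReal_add (by positivity) (by positivity),
              ENNReal.ofReal_mul (by positivity), ENNReal.ofReal_mul (by positivity),
              ENNReal.ofReal_mul (by positivity),
              ENNReal.ofReal_pow hx, ENNReal.ofReal_pow hu, ENNReal.ofReal_pow hv,
              ENNReal.ofReal_ofNat]
          rw [e _ _ _ _ _ (by positivity) (by positivity) (by positivity) (by positivity)
            (by positivity)]
          ring
      _ ≤ ENNReal.ofReal ((w * I) ^ 2 * ((4 * (C₁ / I) ^ 2 * C₃ + 64 * C₂ ^ 2) *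
          ((m / w) ^ 2 * X1 + (w * (1 + e)) ^ 2 * (V₀ * (δ' ^ 2 * mk ^ 2))))) * (nsq a * η) := by
          refine mul_le_mul_left (ENNReal.ofReal_le_ofReal ?_) _
          have e1 : (w * I) ^ 2 * (4 * (C₁ / I) ^ 2 * C₃ * ((m / w) ^ 2 * X1)) =
              4 * ((C₁ * m) ^ 2 * (C₃ * X1)) := by field_simp
          have e2 : 0 ≤ (w * I) ^ 2 * (64 * C₂ ^ 2 * ((m / w) ^ 2 * X1)) := by positivity
          have e3 : 0 ≤ (w * I) ^ 2 * (4 * (C₁ / I) ^ 2 * C₃ *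
            ((w * (1 + e)) ^ 2 * (V₀ * (δ' ^ 2 * mk ^ 2)))) := by positivity
          have e4 : (w * I) ^ 2 * ((4 * (C₁ / I) ^ 2 * C₃ + 64 * C₂ ^ 2) *
              ((m / w) ^ 2 * X1 + (w * (1 + e)) ^ 2 * (V₀ * (δ' ^ 2 * mk ^ 2)))) =
              (w * I) ^ 2 * (4 * (C₁ / I) ^ 2 * C₃ * ((m / w) ^ 2 * X1)) +
              (w * I) ^ 2 * (64 * C₂ ^ 2 * ((m / w) ^ 2 * X1)) +
              (w * I) ^ 2 * (4 * (C₁ / I) ^ 2 * C₃ *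
                ((w * (1 + e)) ^ 2 * (V₀ * (δ' ^ 2 * mk ^ 2)))) +
              4 * ((w * I) ^ 2 * (2 * w * (1 + e)) ^ 2 *
                (V₀ * (2 * δ') ^ 2 * (C₂ * mk) ^ 2)) := by ring
          rw [e4, e1]
          linarith
      _ = _ := by
          rw [ENNReal.ofReal_mul (by positivity)]; ring
  have hne : ENNReal.ofReal ((w * I) ^ 2) ≠ 0 := by
    rw [ne_eq, ENNReal.ofReal_eq_zero, not_le]; positivity
  exact (ENNReal.mul_le_mul_iff_right hne ENNReal.ofReal_ne_top).mp hsq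

lemma volume_bad_le {p : ℝ[X]} {n : ℕ} (hn : 1 ≤ n) (hp : p.natDegree ≤ n) {γ : ℝ}
    (hγ : 1 / 2 ≤ |γ|) {r K : ℝ} (hr : 0 < r)
    (hK : 0 < K) (x₀ : ℝ) {Ω : Set (ℝ × ℝ)}
    (hΩ : ∀ q ∈ Ω, |q.1 - q.2| ≤ K) (z : ℝ × ℝ) :
    volume.restrict Ω {q : ℝ × ℝ | ¬ |2 * z.1 + p.derivative.eval (q.1 + q.2)| ≤
      2 * n / r * |2 * Real.pi * z.2 + 2 * (γ * (q.1 + q.2 - 2 * x₀)) * z.1 +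
        γ * p.eval (q.1 + q.2)|} ≤ ENNReal.ofReal (K * (2 * n * r)) := by
  set g : ℝ[X] := C (2 * Real.pi * z.2 - 4 * γ * z.1 * x₀) + C (2 * γ * z.1) * X + C γ * p with hg
  have hgn : g.natDegree ≤ n := by
    refine (natDegree_add_le_of_degree_le (n := n) ?_ ((natDegree_C_mul_le _ _).trans hp))
    refine natDegree_add_le_of_degree_le
      ((natDegree_C _).trans_le (Nat.zero_le _)) ((natDegree_C_mul_le _ _).trans ?_)
    simpa using hn
  have hge : ∀ u, g.eval u = 2 * Real.pi * z.2 + 2 * (γ * (u - 2 * x₀)) * z.1 + γ * p.eval u := by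
    intro u; simp [hg]; ring
  have hgd : ∀ u, g.derivative.eval u = γ * (2 * z.1 + p.derivative.eval u) := by
    intro u; simp [hg]; ring
  have hUm : MeasurableSet {u | ¬ r * |g.derivative.eval u| ≤ n * |g.eval u|} := by
    have h1 := g.continuous.measurable
    have h2 := g.derivative.continuous.measurable
    have h3 : MeasurableSet {u | r * |g.derivative.eval u| ≤ n * |g.eval u|} :=
      measurableSet_le (by fun_prop) (by fun_prop)
    exact h3.compl
  have hs := (volume_strip_le (K := K) hUm).trans
    (mul_le_mul' le_rfl (volume_abs_derivative_gt_le hgn hr))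
  rw [← ENNReal.ofReal_mul hK.le] at hs
  refine le_trans ?_ hs
  have hbm : MeasurableSet {q : ℝ × ℝ | ¬ |2 * z.1 + p.derivative.eval (q.1 + q.2)| ≤
      2 * n / r * |2 * Real.pi * z.2 + 2 * (γ * (q.1 + q.2 - 2 * x₀)) * z.1 +
        γ * p.eval (q.1 + q.2)|} := by
    have h1 : Continuous fun q : ℝ × ℝ => p.eval (q.1 + q.2) := p.continuous.comp (by fun_prop)
    have h2 : Continuous fun q : ℝ × ℝ => p.derivative.eval (q.1 + q.2) :=
      p.derivative.continuous.comp (by fun_prop)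
    have h3 : IsClosed {q : ℝ × ℝ | |2 * z.1 + p.derivative.eval (q.1 + q.2)| ≤
        2 * n / r * |2 * Real.pi * z.2 + 2 * (γ * (q.1 + q.2 - 2 * x₀)) * z.1 +
        γ * p.eval (q.1 + q.2)|} := isClosed_le (by fun_prop) (by fun_prop)
    exact h3.measurableSet.compl
  rw [Measure.restrict_apply hbm]
  refine measure_mono ?_
  rintro q ⟨hq, hqΩ⟩
  refine ⟨hΩ q hqΩ, fun hgood => hq ?_⟩
  change r * |g.derivative.eval (q.1 + q.2)| ≤ n * |g.eval (q.1 + q.2)| at hgood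
  rw [hgd, hge, abs_mul] at hgood
  set A := |2 * z.1 + p.derivative.eval (q.1 + q.2)|
  have hA : 0 ≤ A := abs_nonneg _
  rw [div_mul_eq_mul_div, le_div_iff₀ hr]
  have : r * (1 / 2 * A) ≤ r * (|γ| * A) := by gcongr
  linarith

lemma measure_strip_le {J K : ℝ} {Ω : Set (ℝ × ℝ)} (x₀ : ℝ)
    (hΩ : ∀ q ∈ Ω, |q.1 - x₀| ≤ J ∧ |q.1 - q.2| ≤ K) (hΩm : MeasurableSet Ω) (hJ : 0 ≤ J) :
    volume.restrict Ω Set.univ ≤ ENNReal.ofReal (4 * J * K) := by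
  rw [Measure.restrict_apply_univ, Measure.volume_eq_prod, Measure.prod_apply hΩm]
  calc ∫⁻ x, volume (Prod.mk x ⁻¹' Ω) ≤
        ∫⁻ x, (Set.Icc (x₀ - J) (x₀ + J)).indicator (fun _ => ENNReal.ofReal (2 * K)) x := by
        refine lintegral_mono fun x => ?_
        by_cases hx : x ∈ Set.Icc (x₀ - J) (x₀ + J)
        · rw [Set.indicator_of_mem hx]
          calc _ ≤ volume (Set.Icc (x - K) (x + K)) := by
                refine measure_mono fun y hy => ?_
                have := abs_le.mp (hΩ _ hy).2
                constructor <;> linarith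
            _ = _ := by rw [Real.volume_Icc]; congr 1; ring
        · have : Prod.mk x ⁻¹' Ω = ∅ := by
            ext y
            simp only [Set.mem_preimage, Set.mem_empty_iff_false, iff_false]
            intro hy
            have := abs_le.mp (hΩ _ hy).1
            exact hx ⟨by linarith, by linarith⟩
          rw [this]; simp
    _ = _ := by
        rw [lintegral_indicator_const measurableSet_Icc, Real.volume_Icc,
          ← ENNReal.ofReal_mul' (by linarith)]
        congr 1; ring

/-- The bounds on the scales entering the fixed-point estimate. -/
lemma fixed_scales_le {n : ℕ} (hn : 1 ≤ n) {Γ s X M b α b' α' : ℝ} (hΓ : 0 ≤ Γ) (hs : 1 ≤ s)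
    (hX : 8 * n ≤ X) (hXΓ : 2 + 3 * Γ ≤ X ^ 2) (hM : 1 ≤ M) (hMX : M ≤ X)
    (hb : s ^ 2 / 4 ≤ b) (hb2 : b ≤ 2 * s ^ 2) (hα : |α| ≤ 3 * Γ * (X ^ 24 * s ^ 2))
    (hb' : X ^ 24 * s ^ 2 / 4 ≤ b') (hα' : |α'| ≤ Γ * (X ^ 24 * s ^ 2))
    {w L κ δ δ' : ℝ} (hw : w = 1 / (X ^ 13 * s)) (hL : L = s * X ^ 19)
    (hκ : κ = 2 * n / (X ^ 22 * s ^ 2)) (hδ : δ = M / s) (hδ' : δ' = M / (X ^ 12 * s)) :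
    ((b + |α|) * w ^ 2 ≤ 1 ∧ 2 * b * κ ≤ 1 ∧ b * (κ * L + 2 * w) ^ 2 ≤ 1 ∧
      (δ * (1 / (b * w * (w * L) ^ 2) + δ)) ^ 2 / L + w / (b * √b) * (κ * L + 2 * w) ≤
        57 * n * M ^ 2 / (X ^ 16 * s ^ 5) ∧
      1 / b * (1 + b * δ ^ 2) ≤ 5 * M ^ 2 / s ^ 2) ∧
    1 / b' * (1 + b' * δ' ^ 2 + |α'| * δ' ^ 2) ≤ (5 + 4 * Γ) * M ^ 2 / (X ^ 24 * s ^ 2) ∧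
      |α'| / b' ≤ 4 * Γ := by
  have hn' : (1 : ℝ) ≤ n := by exact_mod_cast hn
  have hX1 : 1 ≤ X := by linarith
  have hb0 : 0 < b := lt_of_lt_of_le (by positivity) hb
  have hb'0 : 0 < b' := lt_of_lt_of_le (by positivity) hb'
  have h1X : ∀ k : ℕ, 1 ≤ X ^ k := fun k => one_le_pow₀ hX1
  have hs2 : 1 ≤ s ^ 2 := one_le_pow₀ hs
  have hM2 : 1 ≤ M ^ 2 := one_le_pow₀ hM
  have hκL : κ * L + 2 * w ≤ 4 * n / (X ^ 3 * s) := by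
    have e1 : κ * L = 2 * n / (X ^ 3 * s) := by rw [hκ, hL]; field_simp
    have e2 : 2 * w ≤ 2 * n / (X ^ 3 * s) := by
      rw [hw, mul_one_div]
      gcongr <;> linarith
    rw [e1]
    calc _ ≤ 2 * n / (X ^ 3 * s) + 2 * n / (X ^ 3 * s) := by gcongr
      _ = _ := by ring
  have hw0 : 0 < w := by rw [hw]; positivity
  have hL0 : 0 < L := by rw [hL]; positivity
  have hκ0 : 0 < κ := by rw [hκ]; positivity
  refine ⟨⟨?_, ?_, ?_, ?_, ?_⟩, ?_, ?_⟩
  · have : b + |α| ≤ X ^ 2 * (X ^ 24 * s ^ 2) := by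
      have : s ^ 2 ≤ X ^ 24 * s ^ 2 := le_mul_of_one_le_left (by positivity) (h1X 24)
      calc b + |α| ≤ (2 + 3 * Γ) * (X ^ 24 * s ^ 2) := by linarith
        _ ≤ _ := by gcongr
    calc _ ≤ X ^ 2 * (X ^ 24 * s ^ 2) * w ^ 2 := by gcongr
      _ = 1 := by rw [hw]; field_simp
  · calc 2 * b * κ ≤ 2 * (2 * s ^ 2) * κ := by gcongr
      _ = 8 * n / X ^ 22 := by rw [hκ]; field_simp; ring
      _ ≤ X ^ 1 / X ^ 22 := by gcongr; simpa using hX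
      _ ≤ 1 := by
        rw [div_le_one (by positivity)]; gcongr <;> first | exact hX1 | norm_num
  · calc b * (κ * L + 2 * w) ^ 2 ≤ 2 * s ^ 2 * (4 * n / (X ^ 3 * s)) ^ 2 := by gcongr
      _ = (8 * n) ^ 2 / (2 * X ^ 6) := by field_simp; ring
      _ ≤ X ^ 2 / (2 * X ^ 6) := by gcongr
      _ ≤ 1 := by
        rw [div_le_one (by positivity)]
        have : X ^ 2 ≤ X ^ 6 := by gcongr <;> first | exact hX1 | norm_num
        linarith [h1X 6]
  · have e1 : 1 / (b * w * (w * L) ^ 2) ≤ 4 * X / s := by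
      calc 1 / (b * w * (w * L) ^ 2) ≤ 1 / (s ^ 2 / 4 * w * (w * L) ^ 2) := by gcongr
        _ = 4 * X / s := by rw [hw, hL]; field_simp
    have e2 : δ * (1 / (b * w * (w * L) ^ 2) + δ) ≤ 5 * X * M / s ^ 2 := by
      have : δ ≤ X / s := by rw [hδ]; gcongr
      have hδ0 : 0 ≤ δ := by rw [hδ]; positivity
      calc _ ≤ δ * (4 * X / s + X / s) := by gcongr
        _ = _ := by rw [hδ]; field_simp; ring
    have hδ0 : 0 ≤ δ := by rw [hδ]; positivity
    have e3 : (δ * (1 / (b * w * (w * L) ^ 2) + δ)) ^ 2 / L ≤ 25 * M ^ 2 / (X ^ 16 * s ^ 5) := by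
      calc _ ≤ (5 * X * M / s ^ 2) ^ 2 / L := by gcongr
        _ = 25 * M ^ 2 / (X ^ 17 * s ^ 5) := by rw [hL]; field_simp; ring
        _ ≤ _ := by gcongr <;> first | exact hX1 | norm_num
    have e4 : w / (b * √b) * (κ * L + 2 * w) ≤ 32 * n * M ^ 2 / (X ^ 16 * s ^ 5) := by
      have e5 : s / 2 ≤ √b := by
        apply Real.le_sqrt_of_sq_le; calc _ = s ^ 2 / 4 := by ring
          _ ≤ b := hb
      calc _ ≤ w / (s ^ 2 / 4 * (s / 2)) * (4 * n / (X ^ 3 * s)) := by gcongr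
        _ = 32 * n * 1 / (X ^ 16 * s ^ 5) := by rw [hw]; field_simp; ring
        _ ≤ _ := by gcongr
    calc _ ≤ 25 * M ^ 2 / (X ^ 16 * s ^ 5) + 32 * n * M ^ 2 / (X ^ 16 * s ^ 5) := add_le_add e3 e4
      _ ≤ 25 * n * M ^ 2 / (X ^ 16 * s ^ 5) + 32 * n * M ^ 2 / (X ^ 16 * s ^ 5) := by
          gcongr; linarith
      _ = _ := by ring
  · calc 1 / b * (1 + b * δ ^ 2) = 1 / b + δ ^ 2 := by field_simp
      _ ≤ 1 / (s ^ 2 / 4) + δ ^ 2 := by gcongr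
      _ = (4 + M ^ 2) / s ^ 2 := by rw [hδ]; field_simp
      _ ≤ _ := by gcongr; linarith
  · have hJ : 0 < X ^ 24 * s ^ 2 := by positivity
    have hd : δ' ^ 2 = M ^ 2 / (X ^ 24 * s ^ 2) := by rw [hδ']; field_simp
    have hr : |α'| / b' ≤ 4 * Γ := by
      rw [div_le_iff₀ hb'0]; nlinarith
    calc _ = 1 / b' + δ' ^ 2 + |α'| / b' * δ' ^ 2 := by field_simp
      _ ≤ 1 / (X ^ 24 * s ^ 2 / 4) + δ' ^ 2 + 4 * Γ * δ' ^ 2 := by gcongr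
      _ = (4 + M ^ 2 + 4 * Γ * M ^ 2) / (X ^ 24 * s ^ 2) := by rw [hd]; field_simp
      _ ≤ _ := by gcongr; linarith
  · rw [div_le_iff₀ hb'0]; nlinarith

lemma fixed_constants_le {n Γ s X M : ℝ} (hn : 1 ≤ n) (hΓ : 0 ≤ Γ) (hs : 1 ≤ s) (hX : 1 ≤ X)
    (hM : 1 ≤ M) :
    (((5 + 4 * Γ) * M ^ 2 / (X ^ 24 * s ^ 2) / (1 / (X ^ 13 * s))) ^ 2 *
      ((4 * (X ^ 24 * s ^ 2) * s ^ 2 * (57 * n * M ^ 2 / (X ^ 16 * s ^ 5)) +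
        s ^ 2 * (2 * n * (X ^ 22 * s ^ 2)) * (1 / (X ^ 13 * s) * (5 * M ^ 2 / s ^ 2) ^ 2)) *
        (M / (X ^ 12 * s) + 1 / (X ^ 13 * s))) +
      (1 / (X ^ 13 * s) * (1 + 4 * Γ)) ^ 2 * (4 * (X ^ 24 * s ^ 2) * s ^ 2 *
        ((M / (X ^ 12 * s)) ^ 2 * (5 * M ^ 2 / s ^ 2) ^ 2))) * (2 * s ^ 2) ≤
    ((5 + 4 * Γ) ^ 2 * (1112 * n) + 200 * (1 + 4 * Γ) ^ 2) * (M ^ 9 / (X ^ 25 * s ^ 2)) := by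
  have hs0 : 0 < s := by linarith
  have hX0 : 0 < X := by linarith
  have hM2 : 1 ≤ M ^ 2 := one_le_pow₀ hM
  have h1 : (228 + 50 * (M ^ 2 * X)) * (M * X + 1) ≤ 278 * (M ^ 2 * X) * (2 * (M * X)) := by
    have ha : 1 ≤ M ^ 2 * X := one_le_mul_of_one_le_of_one_le hM2 hX
    have hb : 1 ≤ M * X := one_le_mul_of_one_le_of_one_le hM hX
    exact mul_le_mul (by linarith) (by linarith) (by positivity) (by positivity)
  have h2 : M ^ 6 ≤ M ^ 9 * X := by
    calc M ^ 6 ≤ M ^ 9 := pow_le_pow_right₀ hM (by norm_num)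
      _ ≤ M ^ 9 * X := le_mul_of_one_le_right (by positivity) hX
  calc _ = (2 * (5 + 4 * Γ) ^ 2 * n * M ^ 6 / (X ^ 27 * s ^ 2)) *
        ((228 + 50 * (M ^ 2 * X)) * (M * X + 1)) +
        200 * (1 + 4 * Γ) ^ 2 / (X ^ 26 * s ^ 2) * M ^ 6 := by field_simp; ring
    _ ≤ (2 * (5 + 4 * Γ) ^ 2 * n * M ^ 6 / (X ^ 27 * s ^ 2)) *
        (278 * (M ^ 2 * X) * (2 * (M * X))) +
        200 * (1 + 4 * Γ) ^ 2 / (X ^ 26 * s ^ 2) * (M ^ 9 * X) :=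
        add_le_add (mul_le_mul_of_nonneg_left h1 (by positivity))
          (mul_le_mul_of_nonneg_left h2 (by positivity))
    _ = _ := by field_simp; ring

/-- The estimate obtained by fixing the inner first variable. -/
lemma exists_fixed_pairing_le (n : ℕ) (hn : 1 ≤ n) (Γ : ℝ) (hΓ : 0 ≤ Γ) : ∃ C : ℝ, 0 < C ∧
    ∀ (p : ℝ[X]) (γ s X M x₀ : ℝ) (Ej Ek : Set ℝ) (a : ℝ → ℂ) (h : ℝ × ℝ → ℝ → ℂ) (η : ℝ → ENNReal),
    p.natDegree ≤ n → 1 / 2 ≤ |γ| → |γ| ≤ Γ → 1 ≤ s → 8 * n ≤ X → 2 + 3 * Γ ≤ X ^ 2 → 1 ≤ M → M ≤ X →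
    MeasurableSet Ej → MeasurableSet Ek →
    (∀ t ∈ Ej, |t| ≤ X ^ 24 * s ^ 2 ∧ X ^ 24 * s ^ 2 / 4 ≤ bet t) →
    (∀ t ∈ Ek, |t| ≤ s ^ 2 ∧ s ^ 2 / 4 ≤ bet t) →
    Nice a → (Measurable fun z : (ℝ × ℝ) × ℝ => h z.1 z.2) → (∀ q, Nice (h q)) →
    Measurable η → (∀ q, nsq (h q) = η q.2) →
    (∫⁻ q in {q : ℝ × ℝ | q.1 - x₀ ∈ Ej ∧ q.1 - q.2 ∈ Ek},
      ‖∫ y, (starRingEnd ℂ) (∫ x, skap p γ (M / s) x₀ q.1 q.2 y x * h q x) *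
        ∫ x, skap p γ (M / (X ^ 12 * s)) x₀ q.1 x₀ y x * a x‖ₑ) ^ 2 ≤
      ENNReal.ofReal (C * (M ^ 9 / (X ^ 25 * s ^ 2))) * nsq a *
        ∫⁻ x in {x | |x - x₀| ≤ 2 * (X ^ 24 * s ^ 2)}, η x := by
  obtain ⟨C, hC, key⟩ := exists_pairing_family_le
  refine ⟨C * ((5 + 4 * Γ) ^ 2 * (1112 * n) + 200 * (1 + 4 * Γ) ^ 2), by positivity, ?_⟩
  intro p γ s X M x₀ Ej Ek a h η hp hγ hγΓ hs hX hXΓ hM hMX hEj hEk hEj' hEk' ha hh hhN hη hhη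
  have hn' : (1 : ℝ) ≤ n := by exact_mod_cast hn
  have hX1 : 1 ≤ X := by linarith
  have hX24 : 1 ≤ X ^ 24 := one_le_pow₀ hX1
  have hs2 : 1 ≤ s ^ 2 := one_le_pow₀ hs
  have hKJ : s ^ 2 ≤ X ^ 24 * s ^ 2 := le_mul_of_one_le_left (by positivity) hX24
  set Ω : Set (ℝ × ℝ) := {q : ℝ × ℝ | q.1 - x₀ ∈ Ej ∧ q.1 - q.2 ∈ Ek} with hΩ
  have hΩm : MeasurableSet Ω := by
    have h1 : Ω = (fun q : ℝ × ℝ => q.1 - x₀) ⁻¹' Ej ∩ (fun q : ℝ × ℝ => q.1 - q.2) ⁻¹' Ek := by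
      ext; simp [hΩ]
    rw [h1]
    exact (hEj.preimage (by fun_prop)).inter (hEk.preimage (by fun_prop))
  have hΩj : ∀ q ∈ Ω, |q.1 - x₀| ≤ X ^ 24 * s ^ 2 := fun q hq => (hEj' _ hq.1).1
  have hΩk : ∀ q ∈ Ω, |q.1 - q.2| ≤ s ^ 2 := fun q hq => (hEk' _ hq.2).1
  have hbad := volume_bad_le hn hp hγ (r := X ^ 22 * s ^ 2) (by positivity)
    (by positivity : 0 < s ^ 2) x₀ hΩk
  have hV₀ := measure_strip_le x₀ (fun q hq => ⟨hΩj q hq, hΩk q hq⟩) hΩm (by positivity)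
  have hnear := lintegral_near_le hη (K := s ^ 2) (H := {x | |x - x₀| ≤ 2 * (X ^ 24 * s ^ 2)})
    (measurableSet_le (by fun_prop) (by fun_prop)) hΩm (fun q hq => by
      refine ⟨hΩk q hq, ?_⟩
      have h1 := abs_le.mp (hΩj q hq)
      have h2 := abs_le.mp (hΩk q hq)
      change |q.2 - x₀| ≤ _
      rw [abs_le]; constructor <;> linarith)
  have hsc : ∀ q ∈ Ω, _ := fun q hq => fixed_scales_le hn hΓ hs hX hXΓ hM hMX
    (hEk' _ hq.2).2 (b := bet (q.1 - q.2))
    ((bet_le _).trans (by linarith [(hEk' _ hq.2).1]))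
    (α := γ * (q.1 + q.2 - 2 * x₀)) (by
      rw [abs_mul, mul_comm 3 Γ, mul_assoc]
      have h1 := abs_le.mp (hΩj q hq)
      have h2 := abs_le.mp (hΩk q hq)
      refine mul_le_mul hγΓ ?_ (abs_nonneg _) hΓ
      rw [abs_le]; constructor <;> linarith)
    (b' := bet (q.1 - x₀)) (hEj' _ hq.1).2 (α' := γ * (q.1 + x₀ - 2 * x₀)) (by
      rw [abs_mul]
      refine mul_le_mul hγΓ ?_ (abs_nonneg _) hΓ
      have := hΩj q hq
      rwa [show q.1 + x₀ - 2 * x₀ = q.1 - x₀ by ring]) (w := 1 / (X ^ 13 * s)) (L := s * X ^ 19) rfl rfl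
      (κ := 2 * n / (X ^ 22 * s ^ 2)) rfl (δ := M / s) rfl (δ' := M / (X ^ 12 * s)) rfl
  have h1 : Continuous fun q : ℝ × ℝ => γ * p.eval (q.1 + q.2) :=
    continuous_const.mul (p.continuous.comp (by fun_prop))
  have h2 : Continuous fun q : ℝ × ℝ => p.derivative.eval (q.1 + q.2) :=
    p.derivative.continuous.comp (by fun_prop)
  have hwδ : 1 / (X ^ 13 * s) ≤ M / s := by
    rw [div_le_div_iff₀ (by positivity) (by positivity), one_mul]
    have h3 : 1 ≤ M * X ^ 13 := one_le_mul_of_one_le_of_one_le hM (one_le_pow₀ hX1)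
    nlinarith
  have hres := key (μ := volume.restrict Ω) (α := fun q => γ * (q.1 + q.2 - 2 * x₀))
    (Q := fun q => γ * p.eval (q.1 + q.2)) (P := fun q => p.derivative.eval (q.1 + q.2))
    (b := fun q => bet (q.1 - q.2)) (α' := fun q => γ * (q.1 + x₀ - 2 * x₀))
    (Q' := fun q => γ * p.eval (q.1 + x₀)) (P' := fun q => p.derivative.eval (q.1 + x₀))
    (b' := fun q => bet (q.1 - x₀)) (δ := M / s) (w := 1 / (X ^ 13 * s)) (L := s * X ^ 19)
    (κ := 2 * n / (X ^ 22 * s ^ 2)) (mk := 5 * M ^ 2 / s ^ 2)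
    (Eg := 57 * n * M ^ 2 / (X ^ 16 * s ^ 5)) (V := s ^ 2 * (2 * n * (X ^ 22 * s ^ 2)))
    (V₀ := 4 * (X ^ 24 * s ^ 2) * s ^ 2) (δ' := M / (X ^ 12 * s))
    (m := (5 + 4 * Γ) * M ^ 2 / (X ^ 24 * s ^ 2)) (e := 4 * Γ) (by fun_prop) h1.measurable
    h2.measurable (by have := continuous_bet; fun_prop) (fun q => bet_pos _) (fun q => bet_pos _)
    (by positivity) hwδ (by positivity) (by positivity) (by positivity) (by positivity)
    (by positivity) (by positivity) (by positivity) (by positivity) (by positivity)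
    (by filter_upwards [ae_restrict_mem hΩm] with q hq using (hsc q hq).1)
    (by filter_upwards [ae_restrict_mem hΩm] with q hq using (hsc q hq).2)
    hbad hV₀ ha hh hhN
  refine hres.trans ?_
  simp only [hhη]
  refine (mul_le_mul' le_rfl hnear).trans ?_
  have hfin := fixed_constants_le hn' hΓ hs hX1 hM
  rw [mul_mul_mul_comm, ← ENNReal.ofReal_mul (by positivity), mul_assoc (ENNReal.ofReal _) (nsq a)]
  refine mul_le_mul' (ENNReal.ofReal_le_ofReal ?_) le_rfl
  rw [mul_assoc, mul_assoc C]
  exact mul_le_mul_of_nonneg_left hfin hC.le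

/-- Locally bounded kernels supported near the diagonal. -/
structure Band (K : ℝ × ℝ → ℝ × ℝ → ℂ) : Prop where
  loc : LocBdd fun z : (ℝ × ℝ) × (ℝ × ℝ) => K z.1 z.2
  supp : ∃ R : ℝ, ∀ x y, K x y ≠ 0 → ‖x - y‖ ≤ R

/-- The integral operator with kernel `K`. -/
def Iop (K : ℝ × ℝ → ℝ × ℝ → ℂ) (f : ℝ × ℝ → ℂ) (x : ℝ × ℝ) : ℂ := ∫ y, K x y * f y

section
variable {K K' : ℝ × ℝ → ℝ × ℝ → ℂ} {f g : ℝ × ℝ → ℂ}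

lemma Band.nice_mul (hK : Band K) (hf : Nice f) :
    Nice fun z : (ℝ × ℝ) × (ℝ × ℝ) => K z.1 z.2 * f z.2 := by
  obtain ⟨R, hR⟩ := hf.supp
  obtain ⟨R', hR'⟩ := hK.supp
  refine Nice.of_fst_snd (hK.loc.mul (hf.toLocBdd.comp (g := Prod.snd) continuous_snd))
    (R := R + R') (R' := R) fun x y h => ?_
  have h1 : ‖y‖ ≤ R := by
    by_contra! h1
    exact h (by simp [hR y h1])
  have h2 := hR' x y (left_ne_zero_of_mul h)
  refine ⟨?_, h1⟩
  calc ‖x‖ = ‖y + (x - y)‖ := by congr 1; abel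
    _ ≤ ‖y‖ + ‖x - y‖ := norm_add_le _ _
    _ ≤ _ := add_le_add h1 h2

lemma Band.nice (hK : Band K) (hf : Nice f) : Nice (Iop K f) := (hK.nice_mul hf).integral_right

lemma Band.integrable (hK : Band K) (hf : Nice f) (x : ℝ × ℝ) : Integrable fun y => K x y * f y :=
  ((hK.nice_mul hf).apply_prodMk x).integrable

lemma Band.add (hK : Band K) (hK' : Band K') : Band fun x y => K x y + K' x y := by
  obtain ⟨R, hR⟩ := hK.supp
  obtain ⟨R', hR'⟩ := hK'.supp
  refine ⟨hK.loc.add hK'.loc, max R R', fun x y h => ?_⟩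
  by_cases h1 : K x y = 0
  · exact (hR' x y (by simpa [h1] using h)).trans (le_max_right _ _)
  · exact (hR x y h1).trans (le_max_left _ _)

lemma Band.const_mul (hK : Band K) (c : ℂ) : Band fun x y => c * K x y :=
  ⟨(LocBdd.const c).mul hK.loc, hK.supp.imp fun _ h x y h' => h x y (right_ne_zero_of_mul h')⟩

lemma Band.adjoint (hK : Band K) : Band fun x y => (starRingEnd ℂ) (K y x) := by
  obtain ⟨R, hR⟩ := hK.supp
  refine ⟨(hK.loc.comp (g := Prod.swap) continuous_swap).star, R, fun x y h => ?_⟩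
  rw [norm_sub_rev]
  exact hR y x (by simpa using h)

lemma Iop_add_kernel (hK : Band K) (hK' : Band K') (hf : Nice f) :
    Iop (fun x y => K x y + K' x y) f = fun x => Iop K f x + Iop K' f x := by
  ext x
  unfold Iop
  rw [← integral_add (hK.integrable hf x) (hK'.integrable hf x)]
  simp only [add_mul]

lemma Iop_const_mul_kernel (c : ℂ) : Iop (fun x y => c * K x y) f = fun x => c * Iop K f x := by
  ext x
  unfold Iop
  simp only [mul_assoc, integral_const_mul]

lemma integral_Iop_mul_conj (hK : Band K) (hf : Nice f) (hg : Nice g) :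
    ∫ x, Iop K f x * (starRingEnd ℂ) (g x) =
      ∫ y, f y * (starRingEnd ℂ) (Iop (fun x y => (starRingEnd ℂ) (K y x)) g y) := by
  have h := ((hK.nice_mul hf).mul_right (hg.star.toLocBdd.comp (g := Prod.fst) continuous_fst)).integrable
  have h2 := integral_integral_swap (f := fun x y => K x y * f y * (starRingEnd ℂ) (g x)) h
  simp only [integral_mul_const] at h2
  refine h2.trans ?_
  congr 1; ext y
  unfold Iop
  rw [← integral_conj, ← integral_const_mul]
  congr 1; ext x
  simp only [map_mul, Complex.conj_conj]
  ring

lemma nsq_Iop_adjoint_le (hK : Band K) {B : ENNReal} (h : ∀ f, Nice f → nsq (Iop K f) ≤ B * nsq f)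
    (hf : Nice f) : nsq (Iop (fun x y => (starRingEnd ℂ) (K y x)) f) ≤ B * nsq f := by
  refine nsq_le_of_dual (hK.adjoint.nice hf) fun g hg => ?_
  have h1 := integral_Iop_mul_conj hK hg.star hf
  have h2 : ‖∫ x, Iop (fun x y => (starRingEnd ℂ) (K y x)) f x * g x‖ₑ =
      ‖∫ x, Iop K (fun x => (starRingEnd ℂ) (g x)) x * (starRingEnd ℂ) (f x)‖ₑ := by
    rw [h1, ← RCLike.enorm_conj (K := ℂ), ← integral_conj]
    congr 2; ext x; simp [mul_comm]
  rw [h2]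
  refine (enorm_integral_mul_sq_le (hK.nice hg.star).meas.aemeasurable
    hf.star.meas.aemeasurable).trans ?_
  rw [nsq_star f, mul_right_comm]
  refine mul_le_mul' ((h _ hg.star).trans_eq ?_) le_rfl
  rw [nsq_star]

end

lemma locBdd_pker (p : ℝ[X]) (γ δ : ℝ) {E : Set ℝ} (hE : MeasurableSet E) :
    LocBdd fun z : (ℝ × ℝ) × (ℝ × ℝ) => pker p γ δ E z.1 z.2 := by
  have h1 : Continuous fun z : (ℝ × ℝ) × (ℝ × ℝ) =>
      Complex.exp (Complex.I * (γ * Psi p z.1 z.2 : ℝ)) *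
      (SS (bet (z.1.1 - z.2.1)) (z.1.2 + z.2.2 + p.derivative.eval (z.1.1 + z.2.1))
        (z.1.2 - z.2.2) : ℂ) * (chi ((z.1.2 - z.2.2) / δ) : ℂ) := by
    unfold Psi
    have h1 : Continuous fun z : (ℝ × ℝ) × (ℝ × ℝ) => p.eval (z.1.1 + z.2.1) :=
      p.continuous.comp (by fun_prop)
    have h2 : Continuous fun z : (ℝ × ℝ) × (ℝ × ℝ) => p.derivative.eval (z.1.1 + z.2.1) :=
      p.derivative.continuous.comp (by fun_prop)
    have h3 := continuous_bet
    have h4 := continuous_chi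
    have h5 := continuous_SS (h3.comp (g := bet) (f := fun z : (ℝ × ℝ) × (ℝ × ℝ) => z.1.1 - z.2.1)
      (by fun_prop)) (by fun_prop : Continuous fun z : (ℝ × ℝ) × (ℝ × ℝ) =>
        z.1.2 + z.2.2 + p.derivative.eval (z.1.1 + z.2.1))
      (by fun_prop : Continuous fun z : (ℝ × ℝ) × (ℝ × ℝ) => z.1.2 - z.2.2)
    simp only [Function.comp_def] at h5
    fun_prop
  refine (LocBdd.of_continuous h1).mul ⟨?_, fun _ => ⟨1, fun z _ => ?_⟩⟩
  · exact (measurable_const.indicator hE).comp (by fun_prop)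
  · by_cases h : z.1.1 - z.2.1 ∈ E <;> simp [h]

lemma pker_ne_zero {p : ℝ[X]} {γ δ : ℝ} {E : Set ℝ} (hδ : 0 < δ) {x y : ℝ × ℝ}
    (h : pker p γ δ E x y ≠ 0) : x.1 - y.1 ∈ E ∧ |x.2 - y.2| ≤ δ := by
  unfold pker at h
  refine ⟨?_, ?_⟩
  · by_contra h1
    exact h (by simp [h1])
  · by_contra! h1
    exact h (by simp [chi_div_eq_zero hδ h1.le])

lemma band_pker (p : ℝ[X]) (γ : ℝ) {δ J : ℝ} (hδ : 0 < δ) {E : Set ℝ} (hE : MeasurableSet E)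
    (hJ : ∀ t ∈ E, |t| ≤ J) : Band (pker p γ δ E) := by
  refine ⟨locBdd_pker p γ δ hE, max J δ, fun x y h => ?_⟩
  obtain ⟨h1, h2⟩ := pker_ne_zero hδ h
  exact max_le_max (hJ _ h1) h2

lemma pker_conj (p : ℝ[X]) (γ δ : ℝ) {E : Set ℝ} (hE : ∀ t ∈ E, -t ∈ E) (x y : ℝ × ℝ) :
    (starRingEnd ℂ) (pker p γ δ E y x) = pker p γ δ E x y := by
  have hE' : (starRingEnd ℂ) (E.indicator (fun _ => (1 : ℂ)) (y.1 - x.1)) =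
      E.indicator (fun _ => 1) (x.1 - y.1) := by
    by_cases h : x.1 - y.1 ∈ E
    · have h2 := hE _ h
      rw [neg_sub] at h2
      simp [h, h2]
    · have h2 : y.1 - x.1 ∉ E := fun h2 => h (by simpa using hE _ h2)
      simp [h, h2]
  have hΨ : Psi p y x = - Psi p x y := by unfold Psi; rw [add_comm y.1]; ring
  have hS : SS (bet (y.1 - x.1)) (y.2 + x.2 + p.derivative.eval (y.1 + x.1)) (y.2 - x.2) =
      SS (bet (x.1 - y.1)) (x.2 + y.2 + p.derivative.eval (x.1 + y.1)) (x.2 - y.2) := by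
    unfold SS
    rw [← neg_sub x.1, bet_neg, ← neg_sub x.2, add_comm y.2, add_comm y.1, mul_neg, Real.sinc_neg]
  have hc : chi ((y.2 - x.2) / δ) = chi ((x.2 - y.2) / δ) := by
    rw [← neg_sub x.2, neg_div, chi_neg]
  unfold pker
  rw [map_mul, map_mul, map_mul, hE', hΨ, hS, hc, Complex.conj_ofReal, Complex.conj_ofReal,
    ← Complex.exp_conj]
  congr 4
  simp

lemma Nice.comp_of_norm_eq {E F : Type*} [Norm E] [MeasurableSpace E] [Norm F] [MeasurableSpace F]
    {f : F → ℂ} (hf : Nice f) {g : E → F} (hg : Measurable g) (h : ∀ x, ‖g x‖ = ‖x‖) :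
    Nice fun x => f (g x) := by
  obtain ⟨R, hR⟩ := hf.supp
  refine ⟨⟨hf.meas.comp hg, fun R => ?_⟩, R, fun x hx => hR _ (by rwa [h])⟩
  obtain ⟨B, hB⟩ := hf.bdd R
  exact ⟨B, fun x hx => hB _ (by rwa [h])⟩

lemma lintegral_sq_le_of_sq_le {α : Type*} [MeasurableSpace α] {μ : Measure α} {F φ ψ : α → ENNReal}
    (hφ : Measurable φ) (hψ : Measurable ψ) (h : ∀ x, F x ^ 2 ≤ φ x * ψ x) :
    (∫⁻ x, F x ∂μ) ^ 2 ≤ (∫⁻ x, φ x ∂μ) * ∫⁻ x, ψ x ∂μ := by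
  have hsq : ∀ x : ENNReal, (x ^ (1 / 2 : ℝ)) ^ 2 = x := fun x => by
    rw [← ENNReal.rpow_natCast, ← ENNReal.rpow_mul]; norm_num
  have h1 : ∀ x, F x ≤ φ x ^ (1 / 2 : ℝ) * ψ x ^ (1 / 2 : ℝ) := fun x => by
    rw [← ENNReal.mul_rpow_of_nonneg _ _ (by norm_num), one_div, ENNReal.le_rpow_inv_iff (by norm_num)]
    simpa using h x
  have h2 := lintegral_mul_sq_le (μ := μ) (hφ.pow_const (1 / 2 : ℝ)).aemeasurable
    (hψ.pow_const (1 / 2 : ℝ)).aemeasurable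
  simp only [hsq] at h2
  exact (pow_le_pow_left' (lintegral_mono h1) 2).trans h2

lemma nsq_prod {f : ℝ × ℝ → ℂ} (hf : Measurable f) : nsq f = ∫⁻ x, nsq fun y => f (x, y) := by
  unfold nsq
  rw [Measure.volume_eq_prod, lintegral_prod _ (by fun_prop)]

lemma enorm_integral_slices_le {A B : ℝ × ℝ → ℝ → ℂ}
    (hA : Nice fun z : (ℝ × ℝ) × ℝ => A z.1 z.2) (hB : Nice fun z : (ℝ × ℝ) × ℝ => B z.1 z.2) :
    ‖∫ y : ℝ × ℝ, (starRingEnd ℂ) (∫ x, A (y.1, x) y.2) * ∫ x, B (y.1, x) y.2‖ₑ ≤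
      ∫⁻ x₀, ∫⁻ q : ℝ × ℝ, ‖∫ y, (starRingEnd ℂ) (A q y) * B (q.1, x₀) y‖ₑ := by
  have hsl : ∀ {A : ℝ × ℝ → ℝ → ℂ}, (Nice fun z : (ℝ × ℝ) × ℝ => A z.1 z.2) →
      Nice fun y : ℝ × ℝ => ∫ x, A (y.1, x) y.2 := fun {A} hA =>
    Nice.integral_right (f := fun z : (ℝ × ℝ) × ℝ => A (z.1.1, z.2) z.1.2)
      (hA.comp_of_norm_eq (g := fun z : (ℝ × ℝ) × ℝ => ((z.1.1, z.2), z.1.2)) (by fun_prop)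
        fun z => by simp only [Prod.norm_def]; rw [max_right_comm])
  have hint : Integrable fun y : ℝ × ℝ => (starRingEnd ℂ) (∫ x, A (y.1, x) y.2) *
      ∫ x, B (y.1, x) y.2 := ((hsl hB).mul_left (hsl hA).star.toLocBdd).integrable
  have hF : Nice fun z : (ℝ × (ℝ × ℝ)) × ℝ =>
      (starRingEnd ℂ) (A (z.1.1, z.1.2.1) z.2) * B (z.1.1, z.1.2.2) z.2 := by
    obtain ⟨R, hR⟩ := hA.supp
    obtain ⟨R', hR'⟩ := hB.supp
    refine ⟨LocBdd.mul (LocBdd.star ?_) ?_, max R R', fun z hz => ?_⟩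
    · exact hA.toLocBdd.comp (g := fun z : (ℝ × (ℝ × ℝ)) × ℝ => ((z.1.1, z.1.2.1), z.2)) (by fun_prop)
    · exact hB.toLocBdd.comp (g := fun z : (ℝ × (ℝ × ℝ)) × ℝ => ((z.1.1, z.1.2.2), z.2)) (by fun_prop)
    · by_contra h0
      have h1 : ‖((z.1.1, z.1.2.1), z.2)‖ ≤ R := by
        by_contra! h1
        exact h0 (by have := hR _ h1; simp at this; simp [this])
      have h2 : ‖((z.1.1, z.1.2.2), z.2)‖ ≤ R' := by
        by_contra! h1
        exact h0 (by have := hR' _ h1; simp at this; simp [this])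
      simp only [Prod.norm_def, max_le_iff, lt_max_iff] at h1 h2 hz
      grind
  have hG := hF.integral_right.meas
  rw [Measure.volume_eq_prod, integral_prod _ hint]
  calc _ ≤ ∫⁻ y₁, ‖∫ y₂, (starRingEnd ℂ) (∫ x, A (y₁, x) y₂) * ∫ x, B (y₁, x) y₂‖ₑ :=
        enorm_integral_le_lintegral_enorm _
    _ ≤ ∫⁻ y₁, ∫⁻ z : ℝ × ℝ, ‖∫ y₂, (starRingEnd ℂ) (A (y₁, z.1) y₂) * B (y₁, z.2) y₂‖ₑ := by
        refine lintegral_mono fun y₁ => ?_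
        refine le_trans (le_of_eq ?_) (enorm_integral_le_lintegral_enorm _)
        have h1 := (hF.comp_of_norm_eq (g := fun z : ℝ × ((ℝ × ℝ) × ℝ) => ((z.1, z.2.1), z.2.2))
          (by fun_prop) fun z => by simp only [Prod.norm_def]; rw [max_assoc]).apply_prodMk y₁
        have h2 := integral_integral_swap (f := fun (z : ℝ × ℝ) (y₂ : ℝ) =>
          (starRingEnd ℂ) (A (y₁, z.1) y₂) * B (y₁, z.2) y₂) h1.integrable
        refine Eq.trans ?_ (congrArg enorm h2).symm
        congr 2; ext y₂
        rw [← integral_conj, Measure.volume_eq_prod, integral_prod_mul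
          (fun x => (starRingEnd ℂ) (A (y₁, x) y₂)) (fun x => B (y₁, x) y₂)]
    _ = ∫⁻ y₁, ∫⁻ x₁, ∫⁻ x₀, ‖∫ y₂, (starRingEnd ℂ) (A (y₁, x₁) y₂) * B (y₁, x₀) y₂‖ₑ := by
        congr 1; ext y₁
        rw [Measure.volume_eq_prod, lintegral_prod]
        exact (hG.comp measurable_prodMk_left).enorm.aemeasurable
    _ = ∫⁻ q : ℝ × ℝ, ∫⁻ x₀, ‖∫ y₂, (starRingEnd ℂ) (A q y₂) * B (q.1, x₀) y₂‖ₑ := by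
        rw [Measure.volume_eq_prod, lintegral_prod]
        refine (Measurable.lintegral_prod_right' (f := fun z : (ℝ × ℝ) × ℝ =>
          ‖∫ y₂, (starRingEnd ℂ) (A z.1 y₂) * B (z.1.1, z.2) y₂‖ₑ) ?_).aemeasurable
        exact (hG.comp (g := fun z : ℝ × ℝ × ℝ => _) (f := fun z : (ℝ × ℝ) × ℝ => (z.1.1, (z.1.2, z.2))) (by fun_prop)).enorm
    _ = _ := by
        refine lintegral_lintegral_swap ?_
        exact (hG.comp (g := fun z : ℝ × ℝ × ℝ => _) (f := fun z : (ℝ × ℝ) × ℝ => (z.1.1, (z.1.2, z.2))) (by fun_prop)).enorm.aemeasurable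

lemma lintegral_lintegral_near_le {η : ℝ → ENNReal} (hη : Measurable η) (W : ℝ) :
    (Measurable fun x₀ => ∫⁻ x in {x | |x - x₀| ≤ W}, η x) ∧
    ∫⁻ x₀, ∫⁻ x in {x | |x - x₀| ≤ W}, η x = ENNReal.ofReal (2 * W) * ∫⁻ x, η x := by
  have hm : MeasurableSet {z : ℝ × ℝ | |z.2 - z.1| ≤ W} := measurableSet_le (by fun_prop) (by fun_prop)
  have hf : Measurable fun z : ℝ × ℝ => {z : ℝ × ℝ | |z.2 - z.1| ≤ W}.indicator (fun z => η z.2) z :=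
    (hη.comp measurable_snd).indicator hm
  have h1 : ∀ x₀, ∫⁻ x in {x | |x - x₀| ≤ W}, η x =
      ∫⁻ x, {z : ℝ × ℝ | |z.2 - z.1| ≤ W}.indicator (fun z => η z.2) (x₀, x) := fun x₀ => by
    rw [← lintegral_indicator (measurableSet_le (by fun_prop) (by fun_prop))]
    rfl
  simp only [h1]
  refine ⟨hf.lintegral_prod_right', ?_⟩
  rw [lintegral_lintegral_swap hf.aemeasurable, ← lintegral_const_mul _ hη]
  congr 1; ext x
  calc _ = ∫⁻ x₀, (Set.Icc (x - W) (x + W)).indicator (fun _ => η x) x₀ := by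
        congr 1; ext x₀
        have : |x - x₀| ≤ W ↔ x₀ ∈ Set.Icc (x - W) (x + W) := by
          rw [abs_le, Set.mem_Icc]; constructor <;> rintro ⟨h1, h2⟩ <;> constructor <;> linarith
        by_cases h : |x - x₀| ≤ W
        · rw [Set.indicator_of_mem (this.mp h), Set.indicator_of_mem (a := (x₀, x)) h]
        · rw [Set.indicator_of_notMem (mt this.mpr h), Set.indicator_of_notMem (a := (x₀, x)) h]
    _ = _ := by
        rw [lintegral_indicator measurableSet_Icc, lintegral_const, Measure.restrict_apply_univ,
          Real.volume_Icc, mul_comm]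
        congr 2; ring

lemma nice_pker_slice {p : ℝ[X]} {γ δ J : ℝ} (hδ : 0 < δ) {E : Set ℝ} (hE : MeasurableSet E)
    (hJ : ∀ t ∈ E, |t| ≤ J) {f : ℝ × ℝ → ℂ} (hf : Nice f) :
    (Nice fun z : (ℝ × ℝ) × ℝ => ∫ x, pker p γ δ E (z.1.1, z.2) (z.1.2, x) * f (z.1.2, x)) ∧
    ∀ y, Iop (pker p γ δ E) f y = ∫ x₁, ∫ x, pker p γ δ E (y.1, y.2) (x₁, x) * f (x₁, x) := by
  have h1 := (band_pker p γ hδ hE hJ).nice_mul hf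
  constructor
  · exact Nice.integral_right (f := fun z : ((ℝ × ℝ) × ℝ) × ℝ =>
      pker p γ δ E (z.1.1.1, z.1.2) (z.1.1.2, z.2) * f (z.1.1.2, z.2))
      (h1.comp_of_norm_eq (g := fun z : ((ℝ × ℝ) × ℝ) × ℝ => ((z.1.1.1, z.1.2), (z.1.1.2, z.2)))
        (by fun_prop) fun z => by
          simp only [Prod.norm_def]
          rw [max_max_max_comm, max_assoc, max_assoc, max_assoc])
  · intro y
    unfold Iop
    rw [Measure.volume_eq_prod, integral_prod]
    exact (h1.apply_prodMk y).integrable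

/-- Almost orthogonality of two operators at different scales. -/
lemma exists_pairing_scales_le (n : ℕ) (hn : 1 ≤ n) (Γ : ℝ) (hΓ : 0 ≤ Γ) : ∃ C : ℝ, 0 < C ∧
    ∀ (p : ℝ[X]) (γ s X M : ℝ) (Ej Ek : Set ℝ) (f h : ℝ × ℝ → ℂ),
    p.natDegree ≤ n → 1 / 2 ≤ |γ| → |γ| ≤ Γ → 1 ≤ s → 8 * n ≤ X → 2 + 3 * Γ ≤ X ^ 2 → 1 ≤ M → M ≤ X →
    MeasurableSet Ej → MeasurableSet Ek →
    (∀ t ∈ Ej, |t| ≤ X ^ 24 * s ^ 2 ∧ X ^ 24 * s ^ 2 / 4 ≤ bet t) →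
    (∀ t ∈ Ek, |t| ≤ s ^ 2 ∧ s ^ 2 / 4 ≤ bet t) →
    Nice f → Nice h →
    ‖∫ y, (starRingEnd ℂ) (Iop (pker p γ (M / s) Ek) h y) *
      Iop (pker p γ (M / (X ^ 12 * s)) Ej) f y‖ₑ ^ 2 ≤
    ENNReal.ofReal (C * (M ^ 9 / X)) * nsq f * nsq h := by
  obtain ⟨C, hC, key⟩ := exists_fixed_pairing_le n hn Γ hΓ
  refine ⟨4 * C, by positivity, ?_⟩
  intro p γ s X M Ej Ek f h hp hγ hγΓ hs hX hXΓ hM hMX hEj hEk hEj' hEk' hf hh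
  have hn' : (1 : ℝ) ≤ n := by exact_mod_cast hn
  have hX1 : 1 ≤ X := by linarith
  have hsk : 0 < M / s := by positivity
  have hsj : 0 < M / (X ^ 12 * s) := by positivity
  obtain ⟨hA, hA'⟩ := nice_pker_slice (p := p) (γ := γ) hsk hEk (fun t ht => (hEk' t ht).1) hh
  obtain ⟨hB, hB'⟩ := nice_pker_slice (p := p) (γ := γ) hsj hEj (fun t ht => (hEj' t ht).1) hf
  have hη : Measurable fun x => nsq fun y => h (x, y) := by
    unfold nsq
    have h1 : Measurable fun z : ℝ × ℝ => ‖h z‖ₑ ^ 2 := hh.meas.enorm.pow_const 2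
    exact h1.lintegral_prod_right'
  have hφ : Measurable fun x => nsq fun y => f (x, y) := by
    unfold nsq
    have h1 : Measurable fun z : ℝ × ℝ => ‖f z‖ₑ ^ 2 := hf.meas.enorm.pow_const 2
    exact h1.lintegral_prod_right'
  have hW := lintegral_lintegral_near_le hη (2 * (X ^ 24 * s ^ 2))
  have hph : ∀ x₀, Measurable fun z : (ℝ × ℝ) × ℝ =>
      Complex.exp (Complex.I * (-(2 * γ * (z.1.2 - x₀) * z.2 ^ 2) : ℝ)) * h (z.1.2, z.2) := fun x₀ =>
    (by fun_prop : Measurable fun z : (ℝ × ℝ) × ℝ =>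
      Complex.exp (Complex.I * (-(2 * γ * (z.1.2 - x₀) * z.2 ^ 2) : ℝ))).mul
      (hh.meas.comp (by fun_prop : Measurable fun z : (ℝ × ℝ) × ℝ => (z.1.2, z.2)))
  have hphN : ∀ x₀ (q : ℝ × ℝ), Nice fun x =>
      Complex.exp (Complex.I * (-(2 * γ * (q.2 - x₀) * x ^ 2) : ℝ)) * h (q.2, x) := fun x₀ q =>
    (hh.apply_prodMk q.2).mul_left (.of_continuous (by fun_prop))
  have hfix : ∀ x₀, (∫⁻ q : ℝ × ℝ,
      ‖∫ y, (starRingEnd ℂ) (∫ x, pker p γ (M / s) Ek (q.1, y) (q.2, x) * h (q.2, x)) *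
        ∫ x, pker p γ (M / (X ^ 12 * s)) Ej (q.1, y) (x₀, x) * f (x₀, x)‖ₑ) ^ 2 ≤
      ENNReal.ofReal (C * (M ^ 9 / (X ^ 25 * s ^ 2))) * (nsq fun y => f (x₀, y)) *
        ∫⁻ x in {x | |x - x₀| ≤ 2 * (X ^ 24 * s ^ 2)}, nsq fun y => h (x, y) := by
    intro x₀
    have h1 := key p γ s X M x₀ Ej Ek (fun x => f (x₀, x))
      (fun q x => Complex.exp (Complex.I * (-(2 * γ * (q.2 - x₀) * x ^ 2) : ℝ)) * h (q.2, x))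
      (fun x => nsq fun y => h (x, y)) hp hγ hγΓ hs hX hXΓ hM hMX hEj hEk hEj' hEk'
      (hf.apply_prodMk x₀) (hph x₀) (hphN x₀) hη
      (fun q => nsq_congr_enorm fun x => by rw [enorm_mul, enorm_exp_I_mul, one_mul])
    refine le_of_eq_of_le ?_ h1
    have hΩ : MeasurableSet {q : ℝ × ℝ | q.1 - x₀ ∈ Ej ∧ q.1 - q.2 ∈ Ek} := by
      have h1 : {q : ℝ × ℝ | q.1 - x₀ ∈ Ej ∧ q.1 - q.2 ∈ Ek} =
          (fun q : ℝ × ℝ => q.1 - x₀) ⁻¹' Ej ∩ (fun q : ℝ × ℝ => q.1 - q.2) ⁻¹' Ek := by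
        ext; simp
      rw [h1]
      exact (hEj.preimage (by fun_prop)).inter (hEk.preimage (by fun_prop))
    rw [← lintegral_indicator hΩ]
    congr 2; ext q
    by_cases hq : q.1 - x₀ ∈ Ej ∧ q.1 - q.2 ∈ Ek
    · rw [Set.indicator_of_mem (a := q) hq]
      congr 2; ext y
      have e1 : ∀ x, pker p γ (M / s) Ek (q.1, y) (q.2, x) * h (q.2, x) =
          Complex.exp (Complex.I * (2 * γ * (q.1 - x₀) * y ^ 2 : ℝ)) *
          (skap p γ (M / s) x₀ q.1 q.2 y x *
          (Complex.exp (Complex.I * (-(2 * γ * (q.2 - x₀) * x ^ 2) : ℝ)) * h (q.2, x))) := fun x => by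
        rw [pker_eq p γ _ Ek x₀, Set.indicator_of_mem hq.2]
        ring
      have e2 : ∀ x, pker p γ (M / (X ^ 12 * s)) Ej (q.1, y) (x₀, x) * f (x₀, x) =
          Complex.exp (Complex.I * (2 * γ * (q.1 - x₀) * y ^ 2 : ℝ)) *
          (skap p γ (M / (X ^ 12 * s)) x₀ q.1 x₀ y x * f (x₀, x)) := fun x => by
        rw [pker_eq p γ _ Ej x₀, Set.indicator_of_mem hq.1, sub_self, mul_zero, zero_mul, neg_zero,
          Complex.ofReal_zero, mul_zero, Complex.exp_zero]
        ring
      simp only [e1, e2, integral_const_mul, map_mul]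
      rw [mul_mul_mul_comm, ← Complex.normSq_eq_conj_mul_self, Complex.normSq_eq_norm_sq,
        norm_exp_I_mul, one_pow, Complex.ofReal_one, one_mul]
    · rw [Set.indicator_of_notMem (a := q) hq]
      have e : ∀ y, (starRingEnd ℂ) (∫ x, pker p γ (M / s) Ek (q.1, y) (q.2, x) * h (q.2, x)) *
        ∫ x, pker p γ (M / (X ^ 12 * s)) Ej (q.1, y) (x₀, x) * f (x₀, x) = 0 := fun y => by
        rcases not_and_or.mp hq with h2 | h2
        · simp [pker, h2]
        · simp [pker, h2]
      simp [e]
  have hsl := enorm_integral_slices_le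
    (A := fun q y => ∫ x, pker p γ (M / s) Ek (q.1, y) (q.2, x) * h (q.2, x))
    (B := fun q y => ∫ x, pker p γ (M / (X ^ 12 * s)) Ej (q.1, y) (q.2, x) * f (q.2, x)) hA hB
  simp only [hA', hB']
  refine (pow_le_pow_left' hsl 2).trans ?_
  refine (lintegral_sq_le_of_sq_le (hφ.const_mul _) hW.1 hfix).trans_eq ?_
  rw [hW.2, lintegral_const_mul _ hφ, ← nsq_prod hf.meas, ← nsq_prod hh.meas, ← mul_assoc,
    mul_right_comm _ (nsq f), ← ENNReal.ofReal_mul (by positivity)]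
  congr 3
  field_simp
  ring

/-- A Schur test in the first variable for operators bounded in the second variable. -/
lemma enorm_integral_Iop_sq_le {K : ℝ × ℝ → ℝ × ℝ → ℂ} (hK : Band K) {m W : ℝ}
    (hm : 0 ≤ m) (hW0 : 0 ≤ W) {f g : ℝ × ℝ → ℂ} (hf : Nice f) (hg : Nice g)
    (hW : ∀ y₁ x₁ y x, W < |y₁ - x₁| → K (y₁, y) (x₁, x) = 0)
    (h : ∀ y₁ x₁, nsq (fun y => ∫ x, K (y₁, y) (x₁, x) * f (x₁, x)) ≤
      ENNReal.ofReal (m ^ 2) * nsq fun x => f (x₁, x)) :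
    ‖∫ y, Iop K f y * g y‖ₑ ^ 2 ≤ ENNReal.ofReal ((m * (2 * W)) ^ 2) * nsq f * nsq g := by
  have h1 := hK.nice_mul hf
  have hB : Nice fun z : (ℝ × ℝ) × ℝ => ∫ x, K (z.1.1, z.2) (z.1.2, x) * f (z.1.2, x) :=
    Nice.integral_right (f := fun z : ((ℝ × ℝ) × ℝ) × ℝ =>
      K (z.1.1.1, z.1.2) (z.1.1.2, z.2) * f (z.1.1.2, z.2))
      (h1.comp_of_norm_eq (g := fun z : ((ℝ × ℝ) × ℝ) × ℝ => ((z.1.1.1, z.1.2), (z.1.1.2, z.2)))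
        (by fun_prop) fun z => by
          simp only [Prod.norm_def]
          rw [max_max_max_comm, max_assoc, max_assoc, max_assoc])
  have hB' : ∀ y, Iop K f y = ∫ x₁, ∫ x, K (y.1, y.2) (x₁, x) * f (x₁, x) := by
    intro y
    unfold Iop
    rw [Measure.volume_eq_prod, integral_prod]
    exact (h1.apply_prodMk y).integrable
  have hF : Nice fun z : (ℝ × ℝ) × ℝ =>
      (∫ x, K (z.1.1, z.2) (z.1.2, x) * f (z.1.2, x)) * g (z.1.1, z.2) :=
    hB.mul_right (hg.toLocBdd.comp (g := fun z : (ℝ × ℝ) × ℝ => (z.1.1, z.2)) (by fun_prop))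
  have hη : ∀ {g : ℝ × ℝ → ℂ}, Nice g → Measurable fun x => nsq fun y => g (x, y) := fun {g} hg => by
    unfold nsq
    have h1 : Measurable fun z : ℝ × ℝ => ‖g z‖ₑ ^ 2 := hg.meas.enorm.pow_const 2
    exact h1.lintegral_prod_right'
  have hsq : ∀ x : ENNReal, (x ^ (1 / 2 : ℝ)) ^ 2 = x := fun x => by
    rw [← ENNReal.rpow_natCast, ← ENNReal.rpow_mul]; norm_num
  have hk : MeasurableSet {z : ℝ × ℝ | |z.1 - z.2| ≤ W} :=
    measurableSet_le (by fun_prop) (by fun_prop)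
  have hpt : ∀ y₁ x₁, ‖∫ y, (∫ x, K (y₁, y) (x₁, x) * f (x₁, x)) * g (y₁, y)‖ₑ ≤
      ENNReal.ofReal m * ((nsq fun y => g (y₁, y)) ^ (1 / 2 : ℝ) *
        {z : ℝ × ℝ | |z.1 - z.2| ≤ W}.indicator 1 (y₁, x₁) *
        (nsq fun x => f (x₁, x)) ^ (1 / 2 : ℝ)) := by
    intro y₁ x₁
    rcases le_or_gt |y₁ - x₁| W with hw | hw
    · rw [Set.indicator_of_mem (a := (y₁, x₁)) hw, Pi.one_apply, mul_one]
      rw [← ENNReal.pow_le_pow_left_iff two_ne_zero, mul_pow, mul_pow, hsq, hsq]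
      refine (enorm_integral_mul_sq_le (hB.apply_prodMk (y₁, x₁)).meas.aemeasurable
        (hg.apply_prodMk y₁).meas.aemeasurable).trans ?_
      rw [← ENNReal.ofReal_pow hm, mul_comm (nsq fun y => g (y₁, y)), ← mul_assoc]
      exact mul_le_mul' (h y₁ x₁) le_rfl
    · simp [hW y₁ x₁ _ _ hw]
  have hcol : ∀ y : ℝ, ∫⁻ x : ℝ, (Set.Icc (y - W) (y + W)).indicator (1 : ℝ → ENNReal) x ≤
      ENNReal.ofReal (2 * W) := fun y => by
    rw [lintegral_indicator_one measurableSet_Icc, Real.volume_Icc]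
    apply le_of_eq; congr 1; ring
  have hsch := schur_sq (μ := volume) (ν := volume) ((hη hg).pow_const (1 / 2 : ℝ))
    ((hη hf).pow_const (1 / 2 : ℝ)) (k := {z : ℝ × ℝ | |z.1 - z.2| ≤ W}.indicator 1)
    (measurable_one.indicator hk) (A := ENNReal.ofReal (2 * W)) (B := ENNReal.ofReal (2 * W))
    (fun x => (lintegral_mono fun y => Set.indicator_le_indicator_apply_of_subset
      (s := {y | |x - y| ≤ W}) (f := fun _ => 1) (fun y hy => by
        have : |x - y| ≤ W := hy
        have := abs_le.mp this
        constructor <;> linarith) zero_le).trans (hcol x))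
    (fun x => (lintegral_mono fun y => Set.indicator_le_indicator_apply_of_subset
      (s := {y | |y - x| ≤ W}) (f := fun _ => 1) (fun y hy => by
        have : |y - x| ≤ W := hy
        have := abs_le.mp this
        constructor <;> linarith) zero_le).trans (hcol x))
  simp only [hsq] at hsch
  rw [← nsq_prod hf.meas, ← nsq_prod hg.meas] at hsch
  have hint : Integrable fun y => Iop K f y * g y := (hg.mul_left (hK.nice hf).toLocBdd).integrable
  have hmain : ‖∫ y, Iop K f y * g y‖ₑ ≤ ENNReal.ofReal m * ∫⁻ y₁, ∫⁻ x₁,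
      (nsq fun y => g (y₁, y)) ^ (1 / 2 : ℝ) *
        {z : ℝ × ℝ | |z.1 - z.2| ≤ W}.indicator 1 (y₁, x₁) *
        (nsq fun x => f (x₁, x)) ^ (1 / 2 : ℝ) := by
    rw [Measure.volume_eq_prod, integral_prod _ hint, ← lintegral_const_mul' _ _ (by finiteness)]
    refine (enorm_integral_le_lintegral_enorm _).trans (lintegral_mono fun y₁ => ?_)
    rw [← lintegral_const_mul' _ _ (by finiteness)]
    refine le_trans ?_ (lintegral_mono fun x₁ => hpt y₁ x₁)
    refine le_trans (le_of_eq ?_) (enorm_integral_le_lintegral_enorm _)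
    have h1 := (hF.comp_of_norm_eq (g := fun z : ℝ × (ℝ × ℝ) => ((z.1, z.2.1), z.2.2))
      (by fun_prop) fun z => by simp only [Prod.norm_def]; rw [max_assoc]).apply_prodMk y₁
    have h2 := integral_integral_swap (f := fun (x₁ : ℝ) (y : ℝ) =>
      (∫ x, K (y₁, y) (x₁, x) * f (x₁, x)) * g (y₁, y)) h1.integrable
    refine Eq.trans ?_ (congrArg enorm h2).symm
    congr 2; ext y
    rw [integral_mul_const, hB']
  refine (pow_le_pow_left' hmain 2).trans ?_
  rw [mul_pow]
  refine (mul_le_mul' le_rfl hsch).trans_eq ?_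
  rw [ENNReal.ofReal_pow (by positivity), ENNReal.ofReal_mul (q := 2 * W) hm]
  ring

lemma exists_nsq_base_le : ∃ C : ℝ, 0 < C ∧ ∀ (p : ℝ[X]) (γ s : ℝ) (E : Set ℝ) (f : ℝ × ℝ → ℂ),
    1 ≤ s → MeasurableSet E → (∀ t ∈ E, |t| ≤ s ^ 2 ∧ s ^ 2 / 4 ≤ bet t) → Nice f →
    nsq (Iop (pker p γ (1 / s) E) f) ≤ ENNReal.ofReal (C ^ 2) * nsq f := by
  obtain ⟨C, hC, key⟩ := exists_nsq_kap_le
  refine ⟨24 * C, by positivity, fun p γ s E f hs hE hE' hf => ?_⟩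
  have hδ : 0 < 1 / s := by positivity
  have hs2 : 1 ≤ s ^ 2 := one_le_pow₀ hs
  have hK := band_pker p γ hδ hE fun t ht => (hE' t ht).1
  refine nsq_le_of_dual (hK.nice hf) fun g hg => ?_
  have := enorm_integral_Iop_sq_le hK (m := C * (12 / s ^ 2)) (W := s ^ 2) (by positivity)
    (by positivity) hf hg (fun y₁ x₁ y x hw => by
      by_contra h
      exact absurd (hE' _ (pker_ne_zero hδ h).1).1 (not_le.mpr hw)) fun y₁ x₁ => ?_
  · refine this.trans_eq ?_
    congr 4
    field_simp
    norm_num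
  by_cases ht : y₁ - x₁ ∈ E
  · obtain ⟨h1, h2⟩ := hE' _ ht
    have h3 := bet_le (y₁ - x₁)
    have hb := bet_pos (y₁ - x₁)
    have hk := key (γ * (y₁ + x₁ - 2 * x₁)) (γ * p.eval (y₁ + x₁)) (p.derivative.eval (y₁ + x₁))
      (bet (y₁ - x₁)) (1 / s) (fun x => f (x₁, x)) hb hδ (hf.apply_prodMk x₁)
    refine le_trans (le_of_eq_of_le (nsq_congr_enorm fun y => ?_) hk)
      (mul_le_mul' (ENNReal.ofReal_le_ofReal ?_) le_rfl)
    · have e : ∀ x, pker p γ (1 / s) E (y₁, y) (x₁, x) * f (x₁, x) =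
          Complex.exp (Complex.I * (2 * γ * (y₁ - x₁) * y ^ 2 : ℝ)) *
          (skap p γ (1 / s) x₁ y₁ x₁ y x * f (x₁, x)) := fun x => by
        rw [pker_eq p γ _ E x₁, Set.indicator_of_mem ht, sub_self, mul_zero, zero_mul, neg_zero,
          Complex.ofReal_zero, mul_zero, Complex.exp_zero]
        ring
      simp only [e, integral_const_mul]
      rw [enorm_mul, enorm_exp_I_mul, one_mul]
      rfl
    · refine pow_le_pow_left₀ (by positivity) (mul_le_mul_of_nonneg_left ?_ hC.le) 2
      rw [div_mul_eq_mul_div, div_le_div_iff₀ hb (by positivity)]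
      have h4 : bet (y₁ - x₁) * (1 / s) ^ 2 ≤ 2 := by
        rw [one_div, inv_pow, ← div_eq_mul_inv, div_le_iff₀ (by positivity)]
        linarith
      nlinarith
  · simp [pker, ht, nsq]

lemma norm_integral_fresnel_tail_le {z : ℝ} (hz : 1 ≤ z) :
    ‖∫ x in (1 : ℝ)..z, Complex.exp (Complex.I * (x ^ 2 : ℝ))‖ ≤ 1 := by
  have hd : ∀ x ∈ Set.uIcc 1 z, HasDerivAt (fun x : ℝ => Complex.exp (Complex.I * (x ^ 2 : ℝ)) *
      (-Complex.I / 2 * ((x⁻¹ : ℝ) : ℂ)))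
      (Complex.exp (Complex.I * (x ^ 2 : ℝ)) + Complex.exp (Complex.I * (x ^ 2 : ℝ)) *
        (Complex.I / 2 * (((x ^ 2)⁻¹ : ℝ) : ℂ))) x := by
    intro x hx
    rw [Set.uIcc_of_le hz] at hx
    have hx0 : x ≠ 0 := by linarith [hx.1]
    have h1 : HasDerivAt (fun x : ℝ => x ^ 2) (2 * x) x := by simpa using hasDerivAt_pow 2 x
    have h2 := (h1.ofReal_comp.const_mul Complex.I).cexp
    have h3 := ((hasDerivAt_inv hx0).ofReal_comp.const_mul (-Complex.I / 2))
    refine (h2.mul h3).congr_deriv ?_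
    have hxc : (x : ℂ) ≠ 0 := by exact_mod_cast hx0
    have hI : Complex.I ^ 2 = -1 := Complex.I_sq
    push_cast
    field_simp
    linear_combination (-2 * (x : ℂ) ^ 2 ) * hI
  have hc2 : ContinuousOn (fun x : ℝ => Complex.exp (Complex.I * (x ^ 2 : ℝ)) *
        (Complex.I / 2 * (((x ^ 2)⁻¹ : ℝ) : ℂ))) (Set.uIcc 1 z) := by
    rw [Set.uIcc_of_le hz]
    refine ContinuousOn.mul (by fun_prop) (continuousOn_const.mul
      (Complex.continuous_ofReal.comp_continuousOn (ContinuousOn.inv₀ (by fun_prop) ?_)))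
    intro x hx
    have : x ≠ 0 := by linarith [hx.1]
    positivity
  have hc1 : IntervalIntegrable (fun x : ℝ => Complex.exp (Complex.I * (x ^ 2 : ℝ))) volume 1 z :=
    (by fun_prop : Continuous fun x : ℝ => Complex.exp (Complex.I * (x ^ 2 : ℝ))).intervalIntegrable _ _
  have hi := intervalIntegral.integral_eq_sub_of_hasDerivAt hd (hc1.add hc2.intervalIntegrable)
  rw [intervalIntegral.integral_add hc1 hc2.intervalIntegrable] at hi
  rw [eq_sub_of_add_eq hi]
  have hb : ‖∫ x in (1 : ℝ)..z, Complex.exp (Complex.I * (x ^ 2 : ℝ)) *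
      (Complex.I / 2 * (((x ^ 2)⁻¹ : ℝ) : ℂ))‖ ≤ 1 / 2 * (1 - z⁻¹) := by
    have h2 : ∫ x in (1 : ℝ)..z, 1 / 2 * (x ^ 2)⁻¹ = 1 / 2 * (1 - z⁻¹) := by
      have hd2 : ∀ x ∈ Set.uIcc 1 z, HasDerivAt (fun x : ℝ => -(1 / 2 * x⁻¹)) (1 / 2 * (x ^ 2)⁻¹) x := by
        intro x hx
        rw [Set.uIcc_of_le hz] at hx
        have hx0 : x ≠ 0 := by linarith [hx.1]
        refine ((hasDerivAt_inv hx0).const_mul (1 / 2)).neg.congr_deriv (by ring)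
      rw [intervalIntegral.integral_eq_sub_of_hasDerivAt hd2]
      · norm_num; ring
      · refine ContinuousOn.intervalIntegrable ?_
        rw [Set.uIcc_of_le hz]
        refine continuousOn_const.mul (ContinuousOn.inv₀ (by fun_prop) ?_)
        intro x hx
        have : x ≠ 0 := by linarith [hx.1]
        positivity
    rw [← h2]
    refine intervalIntegral.norm_integral_le_of_norm_le hz (Filter.Eventually.of_forall fun x _ => ?_) ?_
    · rw [norm_mul, norm_exp_I_mul, one_mul, norm_mul, Complex.norm_real, Real.norm_of_nonneg (by positivity)]
      simp
    · refine ContinuousOn.intervalIntegrable ?_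
      rw [Set.uIcc_of_le hz]
      refine continuousOn_const.mul (ContinuousOn.inv₀ (by fun_prop) ?_)
      intro x hx
      have : x ≠ 0 := by linarith [hx.1]
      positivity
  have hz0 : 0 < z := by linarith
  have hn : ∀ x : ℝ, 0 < x → ‖Complex.exp (Complex.I * (x ^ 2 : ℝ)) *
      (-Complex.I / 2 * ((x⁻¹ : ℝ) : ℂ))‖ = 1 / 2 * x⁻¹ := fun x hx => by
    rw [norm_mul, norm_exp_I_mul, one_mul, norm_mul, Complex.norm_real, Real.norm_of_nonneg (by positivity)]
    simp
  refine (norm_sub_le _ _).trans ?_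
  refine (add_le_add (norm_sub_le _ _) le_rfl).trans ?_
  rw [hn z hz0, hn 1 one_pos]
  linarith

lemma norm_integral_fresnel_le (z : ℝ) :
    ‖∫ x in (0 : ℝ)..z, Complex.exp (Complex.I * (x ^ 2 : ℝ))‖ ≤ 2 := by
  have hc : Continuous fun x : ℝ => Complex.exp (Complex.I * (x ^ 2 : ℝ)) := by fun_prop
  have hs : ∀ z : ℝ, |z| ≤ 1 → ‖∫ x in (0 : ℝ)..z, Complex.exp (Complex.I * (x ^ 2 : ℝ))‖ ≤ 1 := by
    intro z hz
    refine (intervalIntegral.norm_integral_le_of_norm_le_const (C := 1) fun x _ =>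
      (norm_exp_I_mul _).le).trans ?_
    simpa using hz
  have key : ∀ z : ℝ, 0 ≤ z → ‖∫ x in (0 : ℝ)..z, Complex.exp (Complex.I * (x ^ 2 : ℝ))‖ ≤ 2 := by
    intro z hz
    rcases le_total z 1 with h | h
    · exact (hs z (by rwa [abs_of_nonneg hz])).trans one_le_two
    · rw [← intervalIntegral.integral_add_adjacent_intervals (hc.intervalIntegrable 0 1)
        (hc.intervalIntegrable 1 z)]
      refine (norm_add_le _ _).trans ?_
      linarith [hs 1 (by simp), norm_integral_fresnel_tail_le h]
  rcases le_total 0 z with h | h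
  · exact key z h
  · have h1 := key (-z) (by linarith)
    have h2 : ∫ x in (0 : ℝ)..-z, Complex.exp (Complex.I * (x ^ 2 : ℝ)) =
        -∫ x in (0 : ℝ)..z, Complex.exp (Complex.I * (x ^ 2 : ℝ)) := by
      have h3 := intervalIntegral.integral_comp_neg (a := 0) (b := z)
        (fun x : ℝ => Complex.exp (Complex.I * (x ^ 2 : ℝ)))
      simp only [neg_sq, neg_zero] at h3
      rw [h3, intervalIntegral.integral_symm]
    rwa [h2, norm_neg] at h1

lemma norm_integral_quadratic_le {c : ℝ} (hc : c ≠ 0) (ℓ l u : ℝ) :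
    ‖∫ x in l..u, Complex.exp (Complex.I * (c * x ^ 2 + ℓ * x : ℝ))‖ ≤ 4 / √|c| := by
  have hpos : ∀ c : ℝ, 0 < c → ∀ ℓ, ‖∫ x in l..u, Complex.exp (Complex.I * (c * x ^ 2 + ℓ * x : ℝ))‖ ≤ 4 / √c := by
    intro c hc ℓ
    have hr : 0 < √c := Real.sqrt_pos.mpr hc
    have hrr : √c ^ 2 = c := Real.sq_sqrt hc.le
    have h1 : ∀ x : ℝ, Complex.exp (Complex.I * (c * x ^ 2 + ℓ * x : ℝ)) =
        Complex.exp (Complex.I * (-(ℓ / (2 * √c)) ^ 2 : ℝ)) *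
        Complex.exp (Complex.I * ((√c * x + ℓ / (2 * √c)) ^ 2 : ℝ)) := by
      intro x
      rw [← Complex.exp_add, ← mul_add, ← Complex.ofReal_add]
      congr 3
      have : (√c * x + ℓ / (2 * √c)) ^ 2 = √c ^ 2 * x ^ 2 + ℓ * x + (ℓ / (2 * √c)) ^ 2 := by
        field_simp
        ring
      rw [this, hrr]; ring
    simp only [h1]
    rw [intervalIntegral.integral_const_mul, norm_mul, norm_exp_I_mul, one_mul]
    rw [intervalIntegral.integral_comp_mul_add
      (fun x : ℝ => Complex.exp (Complex.I * (x ^ 2 : ℝ))) hr.ne', norm_smul, norm_inv,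
      Real.norm_of_nonneg hr.le, div_eq_inv_mul (4 : ℝ)]
    refine mul_le_mul_of_nonneg_left ?_ (inv_nonneg.mpr hr.le)
    have hcc : Continuous fun x : ℝ => Complex.exp (Complex.I * (x ^ 2 : ℝ)) := by fun_prop
    rw [← intervalIntegral.integral_interval_sub_left (hcc.intervalIntegrable 0 _)
      (hcc.intervalIntegrable 0 _)]
    refine (norm_sub_le _ _).trans ?_
    linarith [norm_integral_fresnel_le (√c * l + ℓ / (2 * √c)),
      norm_integral_fresnel_le (√c * u + ℓ / (2 * √c))]
  rcases lt_or_gt_of_ne hc with h | h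
  · rw [abs_of_neg h]
    refine le_of_eq_of_le ?_ (hpos (-c) (by linarith) (-ℓ))
    rw [← RCLike.norm_conj (K := ℂ), ← intervalIntegral.intervalIntegral_conj]
    congr 2; ext x
    rw [← Complex.exp_conj]
    congr 1
    simp
    ring
  · rw [abs_of_pos h]; exact hpos c h ℓ

lemma norm_integral_mul_quadratic_le {a : ℝ → ℝ} (ha : ContDiff ℝ 1 a) {D : ℝ}
    (hD : ∀ x, |deriv a x| ≤ D) {c : ℝ} (hc : c ≠ 0) (ℓ : ℝ) {l u : ℝ} (hlu : l ≤ u)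
    (h : a l = 0 ∨ a u = 0) :
    ‖∫ x in l..u, (a x : ℂ) * Complex.exp (Complex.I * (c * x ^ 2 + ℓ * x : ℝ))‖ ≤
      4 / √|c| * (D * (u - l)) := by
  have he : Continuous fun x : ℝ => Complex.exp (Complex.I * (c * x ^ 2 + ℓ * x : ℝ)) := by fun_prop
  obtain ⟨m, hm⟩ : ∃ m, a u = 0 ∧ m = l ∨ a l = 0 ∧ m = u := by
    rcases h with h | h
    · exact ⟨u, .inr ⟨h, rfl⟩⟩
    · exact ⟨l, .inl ⟨h, rfl⟩⟩
  have hda : Continuous fun x => ((deriv a x : ℝ) : ℂ) :=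
    Complex.continuous_ofReal.comp (ha.continuous_deriv le_rfl)
  have hibp := intervalIntegral.integral_mul_deriv_eq_deriv_mul (a := l) (b := u)
    (u := fun x => (a x : ℂ)) (u' := fun x => ((deriv a x : ℝ) : ℂ))
    (v := fun z => ∫ x in m..z, Complex.exp (Complex.I * (c * x ^ 2 + ℓ * x : ℝ)))
    (v' := fun x => Complex.exp (Complex.I * (c * x ^ 2 + ℓ * x : ℝ)))
    (fun x _ => ((ha.differentiable one_ne_zero x).hasDerivAt).ofReal_comp)
    (fun x _ => he.integral_hasStrictDerivAt m x |>.hasDerivAt)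
    (hda.intervalIntegrable _ _) (he.intervalIntegrable _ _)
  have h0 : (a u : ℂ) * (∫ x in m..u, Complex.exp (Complex.I * (c * x ^ 2 + ℓ * x : ℝ))) -
      (a l : ℂ) * (∫ x in m..l, Complex.exp (Complex.I * (c * x ^ 2 + ℓ * x : ℝ))) = 0 := by
    rcases hm with ⟨h', rfl⟩ | ⟨h', rfl⟩ <;> simp [h']
  rw [hibp, h0, zero_sub, norm_neg]
  refine (intervalIntegral.norm_integral_le_of_norm_le_const (C := D * (4 / √|c|))
    fun x _ => ?_).trans_eq ?_
  · rw [norm_mul, Complex.norm_real]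
    exact mul_le_mul (hD x) (norm_integral_quadratic_le hc ℓ m x) (norm_nonneg _)
      ((abs_nonneg _).trans (hD x))
  · rw [abs_of_nonneg (sub_nonneg.mpr hlu)]; ring

/-- A van der Corput estimate for a quadratic phase and an amplitude cut off to a half-line. -/
lemma norm_setIntegral_mul_quadratic_le {a : ℝ → ℝ} (ha : ContDiff ℝ 1 a) {D : ℝ}
    (hD : ∀ x, |deriv a x| ≤ D) {c : ℝ} (hc : c ≠ 0) (ℓ : ℝ) {l u : ℝ} (hlu : l ≤ u)
    (h0 : ∀ x, x ∉ Set.Ioo l u → a x = 0) {S : Set ℝ}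
    (hS : ∃ m, S = Set.Ioi m ∨ S = Set.Iic m) :
    ‖∫ x in S, (a x : ℂ) * Complex.exp (Complex.I * (c * x ^ 2 + ℓ * x : ℝ))‖ ≤
      4 / √|c| * (D * (u - l)) := by
  have hD0 : 0 ≤ D := (abs_nonneg _).trans (hD 0)
  have hlm : ∀ v w, l ≤ v → v ≤ w → w ≤ u → (a v = 0 ∨ a w = 0) →
      ‖∫ x in v..w, (a x : ℂ) * Complex.exp (Complex.I * (c * x ^ 2 + ℓ * x : ℝ))‖ ≤
      4 / √|c| * (D * (u - l)) := by
    intro v w h1 h2 h3 h4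
    refine (norm_integral_mul_quadratic_le ha hD hc ℓ h2 h4).trans ?_
    refine mul_le_mul_of_nonneg_left (mul_le_mul_of_nonneg_left (by linarith) hD0) (by positivity)
  have hsub : ∀ T : Set ℝ, MeasurableSet S → T ⊆ S → (∀ x ∈ S, x ∉ T → x ∉ Set.Ioo l u) →
      ∫ x in S, (a x : ℂ) * Complex.exp (Complex.I * (c * x ^ 2 + ℓ * x : ℝ)) =
      ∫ x in T, (a x : ℂ) * Complex.exp (Complex.I * (c * x ^ 2 + ℓ * x : ℝ)) := by
    intro T hSm hT h
    refine setIntegral_eq_of_subset_of_forall_sdiff_eq_zero hSm hT fun x hx => ?_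
    simp [h0 x (h x hx.1 hx.2)]
  have hl := h0 l (by simp)
  have hu := h0 u (by simp)
  obtain ⟨m, rfl | rfl⟩ := hS
  · have hv : min (max l m) u ≤ u := min_le_right _ _
    rw [hsub (Set.Ioc (max l m) (max (max l m) u)) measurableSet_Ioi
      (fun x hx => (le_max_right l m).trans_lt hx.1) fun x hx hx' hx'' =>
        hx' ⟨max_lt hx''.1 hx, hx''.2.le.trans (le_max_right _ _)⟩]
    rcases le_total (max l m) u with h | h
    · rw [max_eq_right h, ← intervalIntegral.integral_of_le h]
      exact hlm _ _ (le_max_left _ _) h le_rfl (.inr hu)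
    · rw [max_eq_left h]; simp
      have : 0 ≤ u - l := by linarith
      positivity
  · rw [hsub (Set.Ioc l (min m u)) measurableSet_Iic
      (fun x hx => hx.2.trans (min_le_left _ _)) fun x hx hx' hx'' =>
        hx' ⟨hx''.1, le_min hx hx''.2.le⟩]
    rcases le_total l (min m u) with h | h
    · rw [← intervalIntegral.integral_of_le h]
      exact hlm _ _ le_rfl h (min_le_right _ _) (.inl hl)
    · rw [Set.Ioc_eq_empty (not_lt.mpr h)]; simp
      have : 0 ≤ u - l := by linarith
      positivity

/-- The difference of two consecutive cutoffs, divided by its argument. -/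
def dya (z : ℝ) : ℝ := (chi (z / 2) - chi z) / z

lemma dya_neg (z : ℝ) : dya (-z) = -dya z := by
  unfold dya; rw [neg_div, chi_neg, chi_neg, div_neg]

lemma dya_mul (z : ℝ) : dya z * z = chi (z / 2) - chi z := by
  unfold dya
  rcases eq_or_ne z 0 with rfl | h
  · simp
  · field_simp

lemma dya_eq_zero {z : ℝ} (h : 2 ≤ |z|) : dya z = 0 := by
  unfold dya
  rw [chi_eq_zero (z := z) (by linarith), chi_eq_zero (z := z / 2)
    (by rw [abs_div, abs_two]; linarith)]
  simp

lemma contDiff_dya : ContDiff ℝ 1 dya := by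
  have hchi : ContDiff ℝ 1 chi := contDiff_chi.of_le (by exact_mod_cast le_top)
  rw [contDiff_iff_contDiffAt]
  intro z
  rcases eq_or_ne z 0 with rfl | h
  · refine (contDiffAt_const (c := (0 : ℝ))).congr_of_eventuallyEq ?_
    filter_upwards [Metric.ball_mem_nhds (0 : ℝ) (ε := 1 / 2) (by norm_num)] with z hz
    have hz' : |z| < 1 / 2 := by simpa using hz
    unfold dya
    rw [chi_eq_one (z := z) hz'.le, chi_eq_one (z := z / 2) (by rw [abs_div, abs_two]; linarith)]
    simp
  · unfold dya
    exact ((hchi.contDiffAt.comp z (contDiffAt_id.div_const 2)).sub hchi.contDiffAt).div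
      contDiffAt_id h

lemma exists_dya_bound : ∃ B : ℝ, 0 < B ∧ ∀ z, |dya z| ≤ B ∧ |deriv dya z| ≤ B := by
  have hs : HasCompactSupport dya := by
    refine HasCompactSupport.intro (isCompact_closedBall (0 : ℝ) 2) fun z hz => dya_eq_zero ?_
    have : 2 < |z| := by simpa using hz
    exact this.le
  obtain ⟨A, hA⟩ := hs.exists_bound_of_continuous contDiff_dya.continuous
  obtain ⟨B, hB⟩ := hs.deriv.exists_bound_of_continuous (contDiff_dya.continuous_deriv le_rfl)
  have hA0 := (norm_nonneg _).trans (hA 0)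
  have hB0 := (norm_nonneg _).trans (hB 0)
  exact ⟨A + B + 1, by positivity, fun z => ⟨(hA z).trans (by linarith), (hB z).trans (by linarith)⟩⟩

/-- Schur's test applied to the composition of an operator with its adjoint. -/
lemma nsq_Iop_le_of_adjoint_comp {K : ℝ × ℝ → ℝ × ℝ → ℂ} (hK : Band K)
    {k : (ℝ × ℝ) × (ℝ × ℝ) → ENNReal} (hk : Measurable k)
    (h : ∀ y y', ‖∫ x, (starRingEnd ℂ) (K x y) * K x y'‖ₑ ≤ k (y, y')) {A : ENNReal}
    (hA : ∀ y, ∫⁻ y', k (y, y') ≤ A) (hA' : ∀ y', ∫⁻ y, k (y, y') ≤ A)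
    {f : ℝ × ℝ → ℂ} (hf : Nice f) : nsq (Iop K f) ≤ A * nsq f := by
  have hg := hK.nice hf
  have hrow : ∀ y, Iop (fun x y => (starRingEnd ℂ) (K y x)) (Iop K f) y =
      ∫ y', (∫ x, (starRingEnd ℂ) (K x y) * K x y') * f y' := by
    intro y
    have hn : Nice fun z : (ℝ × ℝ) × (ℝ × ℝ) =>
        (starRingEnd ℂ) (K z.1 y) * (K z.1 z.2 * f z.2) :=
      (hK.nice_mul hf).mul_left (hK.loc.comp (g := fun z : (ℝ × ℝ) × (ℝ × ℝ) => (z.1, y))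
        (by fun_prop)).star
    have h1 := integral_integral_swap (f := fun (x y' : ℝ × ℝ) =>
      (starRingEnd ℂ) (K x y) * (K x y' * f y')) hn.integrable
    calc _ = ∫ x, ∫ y', (starRingEnd ℂ) (K x y) * (K x y' * f y') := by
          unfold Iop
          simp only [integral_const_mul]
      _ = _ := h1
      _ = _ := by
          congr 1; ext y'
          rw [← integral_mul_const]
          congr 1; ext x; ring
  have hN := nsq_eq_enorm_integral hg
  rw [integral_Iop_mul_conj hK hf hg] at hN
  have hle : nsq (Iop K f) ≤ ∫⁻ y, ∫⁻ y', ‖f y‖ₑ * k (y, y') * ‖f y'‖ₑ := by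
    rw [hN]
    refine (enorm_integral_le_lintegral_enorm _).trans (lintegral_mono fun y => ?_)
    rw [enorm_mul, RCLike.enorm_conj (K := ℂ), hrow]
    refine (mul_le_mul' le_rfl (enorm_integral_le_lintegral_enorm _)).trans ?_
    rw [← lintegral_const_mul' _ _ (by finiteness)]
    refine lintegral_mono fun y' => ?_
    rw [enorm_mul, mul_assoc]
    exact mul_le_mul' le_rfl (mul_le_mul' (h y y') le_rfl)
  rw [← ENNReal.pow_le_pow_left_iff two_ne_zero]
  refine (pow_le_pow_left' hle 2).trans
    ((schur_sq hf.meas.enorm hf.meas.enorm hk hA hA').trans_eq ?_)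
  unfold nsq
  ring

/-- The weight `v ↦ v ^ (-1/2)` on `[0, W]`. -/
def isq (W : ℝ) : ℝ → ENNReal := (Set.Icc 0 W).indicator fun v => (ENNReal.ofReal √v)⁻¹

lemma measurable_isq (W : ℝ) : Measurable (isq W) := by
  unfold isq
  exact Measurable.indicator (by fun_prop) measurableSet_Icc

lemma lintegral_isq {W : ℝ} (hW : 0 ≤ W) : ∫⁻ v, isq W v = ENNReal.ofReal (2 * √W) := by
  unfold isq
  rw [lintegral_indicator measurableSet_Icc, setLIntegral_congr Ioc_ae_eq_Icc.symm]
  have h1 : ∫⁻ v in Set.Ioc 0 W, (ENNReal.ofReal √v)⁻¹ =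
      ∫⁻ v in Set.Ioc 0 W, ENNReal.ofReal (v ^ (-(1 / 2) : ℝ)) := by
    refine setLIntegral_congr_fun measurableSet_Ioc fun v hv => ?_
    have : 0 < √v := Real.sqrt_pos.mpr hv.1
    rw [← ENNReal.ofReal_inv_of_pos this, Real.rpow_neg hv.1.le, Real.sqrt_eq_rpow]
  have hi := (intervalIntegral.intervalIntegrable_rpow' (a := 0) (b := W)
    (r := -(1 / 2)) (by norm_num))
  rw [h1, ← ofReal_integral_eq_lintegral_ofReal
    ((intervalIntegrable_iff_integrableOn_Ioc_of_le hW).mp hi), ← intervalIntegral.integral_of_le hW,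
    integral_rpow (.inl (by norm_num))]
  · congr 1
    rw [show (-(1 / 2) : ℝ) + 1 = 1 / 2 by norm_num, ← Real.sqrt_eq_rpow, ← Real.sqrt_eq_rpow]
    simp; ring
  · filter_upwards [ae_restrict_mem measurableSet_Ioc] with v hv
    exact Real.rpow_nonneg hv.1.le _

/-- A translation-invariant majorant of a composition kernel. -/
def ttk (D W : ℝ) (z : (ℝ × ℝ) × (ℝ × ℝ)) : ENNReal :=
  (isq W (z.1.1 - z.2.1) + isq W (z.2.1 - z.1.1)) *
    (Set.Icc (-D) D).indicator 1 (z.1.2 - z.2.2)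

lemma measurable_ttk (D W : ℝ) : Measurable (ttk D W) := by
  unfold ttk
  refine Measurable.mul (((measurable_isq W).comp (by fun_prop)).add
    ((measurable_isq W).comp (by fun_prop))) ?_
  exact (measurable_one.indicator measurableSet_Icc).comp (by fun_prop)

lemma lintegral_ttk {D W : ℝ} (hW : 0 ≤ W) (y : ℝ × ℝ) :
    ∫⁻ y', ttk D W (y, y') = ENNReal.ofReal (4 * √W) * ENNReal.ofReal (2 * D) := by
  have hm := measurable_isq W
  have hj : Measurable ((Set.Icc (-D) D).indicator (1 : ℝ → ENNReal)) :=
    measurable_one.indicator measurableSet_Icc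
  unfold ttk
  rw [Measure.volume_eq_prod, lintegral_prod_mul
    (f := fun v => isq W (y.1 - v) + isq W (v - y.1))
    (g := fun v => (Set.Icc (-D) D).indicator 1 (y.2 - v))
    ((hm.comp (by fun_prop)).add (hm.comp (by fun_prop))).aemeasurable
    (hj.comp (by fun_prop)).aemeasurable, lintegral_add_left
      (f := fun v => isq W (y.1 - v)) (hm.comp (by fun_prop)),
    lintegral_sub_left_eq_self, lintegral_sub_right_eq_self, lintegral_sub_left_eq_self
      ((Set.Icc (-D) D).indicator (1 : ℝ → ENNReal)), lintegral_isq hW,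
    lintegral_indicator_one measurableSet_Icc, Real.volume_Icc,
    ← ENNReal.ofReal_add (by positivity) (by positivity)]
  congr 2 <;> ring

lemma ttk_swap (D W : ℝ) (y y' : ℝ × ℝ) : ttk D W (y, y') = ttk D W (y', y) := by
  unfold ttk
  simp only
  rw [add_comm]
  congr 1
  have : y.2 - y'.2 ∈ Set.Icc (-D) D ↔ y'.2 - y.2 ∈ Set.Icc (-D) D := by
    constructor <;> rintro ⟨h1, h2⟩ <;> constructor <;> linarith
  by_cases h : y.2 - y'.2 ∈ Set.Icc (-D) D
  · rw [Set.indicator_of_mem h, Set.indicator_of_mem (this.mp h)]; rfl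
  · rw [Set.indicator_of_notMem h, Set.indicator_of_notMem (mt this.mpr h)]

lemma le_ttk {D W : ℝ} {y y' : ℝ × ℝ} (h1 : |y.1 - y'.1| ≤ W) (h2 : |y.2 - y'.2| ≤ D) :
    (ENNReal.ofReal √|y.1 - y'.1|)⁻¹ ≤ ttk D W (y, y') := by
  unfold ttk
  simp only
  rw [Set.indicator_of_mem (s := Set.Icc (-D) D) (abs_le.mp h2), Pi.one_apply, mul_one]
  have h3 := h1
  rcases abs_cases (y.1 - y'.1) with ⟨h, h'⟩ | ⟨h, h'⟩
  · rw [h] at h3 ⊢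
    refine le_trans (le_of_eq ?_) le_self_add
    rw [isq, Set.indicator_of_mem (s := Set.Icc 0 W) ⟨h', h3⟩]
  · rw [h] at h3 ⊢
    rw [neg_sub] at h3 ⊢
    refine le_trans (le_of_eq ?_) le_add_self
    rw [isq, Set.indicator_of_mem (s := Set.Icc 0 W) ⟨by linarith, h3⟩]

/-- A dyadic piece of the kernel in the second variable, with one of the two exponentials of the
sine. -/
def vker (p : ℝ[X]) (γ ε δ : ℝ) (U E : Set ℝ) (x y : ℝ × ℝ) : ℂ :=
  Complex.exp (Complex.I * (γ * Psi p x y + ε * (bet (x.1 - y.1) *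
    ((x.2 + y.2 + p.derivative.eval (x.1 + y.1)) * (x.2 - y.2))) : ℝ)) *
  U.indicator (fun _ => 1) (x.2 + y.2 + p.derivative.eval (x.1 + y.1)) *
  (((bet (x.1 - y.1))⁻¹ * (dya ((x.2 - y.2) / δ) / δ) : ℝ) : ℂ) *
  E.indicator (fun _ => 1) (x.1 - y.1)

lemma vker_ne_zero {p : ℝ[X]} {γ ε δ : ℝ} {U E : Set ℝ} (hδ : 0 < δ) {x y : ℝ × ℝ}
    (h : vker p γ ε δ U E x y ≠ 0) : x.1 - y.1 ∈ E ∧ |x.2 - y.2| < 2 * δ := by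
  constructor
  · by_contra h1
    exact h (by simp [vker, h1])
  · by_contra! h1
    refine h ?_
    have : dya ((x.2 - y.2) / δ) = 0 := dya_eq_zero (by
      rw [abs_div, abs_of_pos hδ, le_div_iff₀ hδ]; exact h1)
    simp [vker, this]

lemma locBdd_vker (p : ℝ[X]) (γ ε δ : ℝ) {U E : Set ℝ} (hU : MeasurableSet U)
    (hE : MeasurableSet E) :
    LocBdd fun z : (ℝ × ℝ) × (ℝ × ℝ) => vker p γ ε δ U E z.1 z.2 := by
  have hb : Continuous fun z : (ℝ × ℝ) × (ℝ × ℝ) => bet (z.1.1 - z.2.1) :=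
    continuous_bet.comp (by fun_prop)
  have hp : ∀ q : ℝ[X], Continuous fun z : (ℝ × ℝ) × (ℝ × ℝ) => q.eval (z.1.1 + z.2.1) := fun q =>
    q.continuous.comp (by fun_prop)
  have hp0 := hp p
  have hp1 := hp p.derivative
  have hd : Continuous fun z : (ℝ × ℝ) × (ℝ × ℝ) => dya ((z.1.2 - z.2.2) / δ) :=
    contDiff_dya.continuous.comp (by fun_prop)
  have hbi : Continuous fun z : (ℝ × ℝ) × (ℝ × ℝ) => (bet (z.1.1 - z.2.1))⁻¹ :=
    hb.inv₀ fun z => (bet_pos _).ne'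
  unfold vker
  refine ((LocBdd.mul ?_ ?_).mul ?_).mul ?_
  · refine .of_continuous ?_
    unfold Psi
    fun_prop
  · exact (LocBdd.indicator hU).comp (by fun_prop)
  · refine .of_continuous ?_
    fun_prop
  · exact (LocBdd.indicator hE).comp (by fun_prop)

lemma band_vker (p : ℝ[X]) (γ ε : ℝ) {δ J : ℝ} (hδ : 0 < δ) {U E : Set ℝ} (hU : MeasurableSet U)
    (hE : MeasurableSet E) (hJ : ∀ t ∈ E, |t| ≤ J) : Band (vker p γ ε δ U E) :=
  ⟨locBdd_vker p γ ε δ hU hE, max J (2 * δ), fun x y h => by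
    obtain ⟨h1, h2⟩ := vker_ne_zero hδ h
    exact max_le_max (hJ _ h1) h2.le⟩

lemma vker_conj_mul (p : ℝ[X]) (γ ε δ : ℝ) (U E : Set ℝ) (y y' : ℝ × ℝ) (x₁ : ℝ) :
    ∃ ℓ k : ℝ, ∀ x₂, (starRingEnd ℂ) (vker p γ ε δ U E (x₁, x₂) y) * vker p γ ε δ U E (x₁, x₂) y' =
      (Complex.exp (Complex.I * k) * (((bet (x₁ - y.1))⁻¹ * (bet (x₁ - y'.1))⁻¹ / δ ^ 2 : ℝ) : ℂ) *
        (E.indicator (fun _ => 1) (x₁ - y.1) * E.indicator (fun _ => 1) (x₁ - y'.1))) *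
      (((fun x => x + y.2 + p.derivative.eval (x₁ + y.1)) ⁻¹' U ∩
        (fun x => x + y'.2 + p.derivative.eval (x₁ + y'.1)) ⁻¹' U).indicator (fun x =>
          ((dya ((x - y.2) / δ) * dya ((x - y'.2) / δ) : ℝ) : ℂ) * Complex.exp (Complex.I *
            ((γ * (y.1 - y'.1) + ε * (bet (x₁ - y'.1) - bet (x₁ - y.1))) * x ^ 2 + ℓ * x : ℝ)))
          x₂) := by
  refine ⟨γ * (p.eval (x₁ + y.1) - p.eval (x₁ + y'.1)) + ε * (bet (x₁ - y'.1) *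
    p.derivative.eval (x₁ + y'.1) - bet (x₁ - y.1) * p.derivative.eval (x₁ + y.1)),
    γ * ((x₁ - y'.1) * y'.2 ^ 2 + y'.2 * p.eval (x₁ + y'.1) - (x₁ - y.1) * y.2 ^ 2 -
      y.2 * p.eval (x₁ + y.1)) + ε * (bet (x₁ - y.1) * (y.2 ^ 2 +
      p.derivative.eval (x₁ + y.1) * y.2) - bet (x₁ - y'.1) * (y'.2 ^ 2 +
      p.derivative.eval (x₁ + y'.1) * y'.2)), fun x => ?_⟩
  have hexp : ∀ a b c d : ℝ, b - a = c + d → (starRingEnd ℂ) (Complex.exp (Complex.I * a)) *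
      Complex.exp (Complex.I * b) = Complex.exp (Complex.I * c) * Complex.exp (Complex.I * d) := by
    intro a b c d h
    rw [← Complex.exp_conj, ← Complex.exp_add, ← Complex.exp_add]
    congr 1
    rw [map_mul, Complex.conj_I, Complex.conj_ofReal]
    have : (b : ℂ) - a = c + d := by exact_mod_cast h
    linear_combination Complex.I * this
  have hconj : ∀ (S : Set ℝ) (z : ℝ), (starRingEnd ℂ) (S.indicator (fun _ => (1 : ℂ)) z) =
      S.indicator (fun _ => (1 : ℂ)) z := fun S z => by
    classical
    rw [Set.indicator_apply]; split_ifs <;> simp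
  have hind : ∀ F : ℝ → ℂ, (((fun x => x + y.2 + p.derivative.eval (x₁ + y.1)) ⁻¹' U ∩
        (fun x => x + y'.2 + p.derivative.eval (x₁ + y'.1)) ⁻¹' U).indicator F x) =
      U.indicator (fun _ => 1) (x + y.2 + p.derivative.eval (x₁ + y.1)) *
      U.indicator (fun _ => 1) (x + y'.2 + p.derivative.eval (x₁ + y'.1)) * F x := by
    classical
    intro F
    simp only [Set.indicator_apply, Set.mem_inter_iff, Set.mem_preimage]
    split_ifs <;> simp_all
  rw [hind]
  unfold vker
  simp only [map_mul, hconj, Complex.conj_ofReal]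
  have key := hexp (γ * Psi p (x₁, x) y + ε * (bet (x₁ - y.1) *
    ((x + y.2 + p.derivative.eval (x₁ + y.1)) * (x - y.2))))
    (γ * Psi p (x₁, x) y' + ε * (bet (x₁ - y'.1) *
    ((x + y'.2 + p.derivative.eval (x₁ + y'.1)) * (x - y'.2))))
    (γ * ((x₁ - y'.1) * y'.2 ^ 2 + y'.2 * p.eval (x₁ + y'.1) - (x₁ - y.1) * y.2 ^ 2 -
      y.2 * p.eval (x₁ + y.1)) + ε * (bet (x₁ - y.1) * (y.2 ^ 2 +
      p.derivative.eval (x₁ + y.1) * y.2) - bet (x₁ - y'.1) * (y'.2 ^ 2 +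
      p.derivative.eval (x₁ + y'.1) * y'.2)))
    ((γ * (y.1 - y'.1) + ε * (bet (x₁ - y'.1) - bet (x₁ - y.1))) * x ^ 2 +
      (γ * (p.eval (x₁ + y.1) - p.eval (x₁ + y'.1)) + ε * (bet (x₁ - y'.1) *
    p.derivative.eval (x₁ + y'.1) - bet (x₁ - y.1) * p.derivative.eval (x₁ + y.1))) * x)
    (by unfold Psi; ring)
  generalize Complex.exp (Complex.I * ((γ * Psi p (x₁, x) y + ε * (bet (x₁ - y.1) *
    ((x + y.2 + p.derivative.eval (x₁ + y.1)) * (x - y.2))) : ℝ) : ℂ)) = e1 at key ⊢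
  generalize Complex.exp (Complex.I * ((γ * Psi p (x₁, x) y' + ε * (bet (x₁ - y'.1) *
    ((x + y'.2 + p.derivative.eval (x₁ + y'.1)) * (x - y'.2))) : ℝ) : ℂ)) = e2 at key ⊢
  push_cast at key ⊢
  linear_combination (E.indicator (fun _ => (1 : ℂ)) (x₁ - y.1) *
    E.indicator (fun _ => (1 : ℂ)) (x₁ - y'.1) *
    U.indicator (fun _ => (1 : ℂ)) (x + y.2 + p.derivative.eval (x₁ + y.1)) *
    U.indicator (fun _ => (1 : ℂ)) (x + y'.2 + p.derivative.eval (x₁ + y'.1)) *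
    ((bet (x₁ - y.1) : ℂ)⁻¹ * (dya ((x - y.2) / δ) / δ)) *
    ((bet (x₁ - y'.1) : ℂ)⁻¹ * (dya ((x - y'.2) / δ) / δ))) * key

lemma abs_le_abs_add_of_mul_nonneg {a b : ℝ} (h : 0 ≤ a * b) : |a| ≤ |a + b| :=
  sq_le_sq.mp (by nlinarith [sq_nonneg b])

lemma half_abs_le_abs_coeff {γ ε σ t t' : ℝ} (hγ : 1 / 2 ≤ |γ|) (hσ : σ ^ 2 = 1)
    (h : 0 ≤ ε * γ * σ) (ht : 0 ≤ σ * t) (ht' : 0 ≤ σ * t') :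
    |t' - t| / 2 ≤ |γ * (t' - t) + ε * (bet t' - bet t)| := by
  have hm : 0 ≤ σ * ((t' - t) * (bet t' - bet t)) := by
    have hσ1 : |σ| = 1 := by
      rw [← abs_one]; exact (sq_eq_sq_iff_abs_eq_abs σ 1).mp (by rw [hσ, one_pow])
    have e1 : |t| = σ * t := by rw [← abs_of_nonneg ht, abs_mul, hσ1, one_mul]
    have e2 : |t'| = σ * t' := by rw [← abs_of_nonneg ht', abs_mul, hσ1, one_mul]
    rw [← mul_assoc, mul_sub σ, ← e1, ← e2]
    rcases le_total |t| |t'| with h1 | h1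
    · exact mul_nonneg (by linarith) (by linarith [bet_mono h1])
    · exact mul_nonneg_of_nonpos_of_nonpos (by linarith) (by linarith [bet_mono h1])
  refine le_trans ?_ (abs_le_abs_add_of_mul_nonneg ?_)
  · rw [abs_mul]
    nlinarith [abs_nonneg (t' - t)]
  · have e : γ * (t' - t) * (ε * (bet t' - bet t)) =
        (ε * γ * σ) * (σ * ((t' - t) * (bet t' - bet t))) := by
      linear_combination (-γ * (t' - t) * (ε * (bet t' - bet t))) * hσ
    rw [e]
    exact mul_nonneg h hm

lemma norm_vker_slice_le {B : ℝ} (hB : ∀ z, |dya z| ≤ B ∧ |deriv dya z| ≤ B) (p : ℝ[X])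
    {γ ε σ s δ : ℝ} {U E : Set ℝ} (hγ : 1 / 2 ≤ |γ|) (hσ : σ ^ 2 = 1)
    (h : 0 ≤ ε * γ * σ) (hs : 0 < s) (hδ : 0 < δ) (hU : U = Set.Ioi 0 ∨ U = Set.Iic 0)
    (hE : ∀ t ∈ E, s ^ 2 / 4 ≤ bet t) (hEσ : ∀ t ∈ E, 0 ≤ σ * t) {y y' : ℝ × ℝ}
    (hy : y.1 ≠ y'.1) (x₁ : ℝ) :
    ‖∫ x₂, (starRingEnd ℂ) (vker p γ ε δ U E (x₁, x₂) y) * vker p γ ε δ U E (x₁, x₂) y'‖ ≤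
      1024 * B ^ 2 / (s ^ 4 * δ ^ 2) * (√|y.1 - y'.1|)⁻¹ := by
  have hB0 : 0 ≤ B := (abs_nonneg _).trans (hB 0).1
  obtain ⟨ℓ, k, hk⟩ := vker_conj_mul p γ ε δ U E y y' x₁
  simp only [hk]
  rw [integral_const_mul]
  by_cases ht : x₁ - y.1 ∈ E ∧ x₁ - y'.1 ∈ E
  swap
  · have : E.indicator (fun _ => (1 : ℂ)) (x₁ - y.1) * E.indicator (fun _ => 1) (x₁ - y'.1) = 0 := by
      rcases not_and_or.mp ht with ht | ht <;> simp [ht]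
    rw [this]
    simp
    positivity
  obtain ⟨ht, ht'⟩ := ht
  have hc := half_abs_le_abs_coeff hγ hσ h (hEσ _ ht) (hEσ _ ht')
  have hv : 0 < |y.1 - y'.1| := abs_pos.mpr (sub_ne_zero.mpr hy)
  rw [show x₁ - y'.1 - (x₁ - y.1) = y.1 - y'.1 by ring] at hc
  set c := γ * (y.1 - y'.1) + ε * (bet (x₁ - y'.1) - bet (x₁ - y.1)) with hc_def
  have hc0 : 0 < |c| := lt_of_lt_of_le (by positivity) hc
  have hS : ∃ m, ((fun x => x + y.2 + p.derivative.eval (x₁ + y.1)) ⁻¹' U ∩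
        (fun x => x + y'.2 + p.derivative.eval (x₁ + y'.1)) ⁻¹' U) = Set.Ioi m ∨
      ((fun x => x + y.2 + p.derivative.eval (x₁ + y.1)) ⁻¹' U ∩
        (fun x => x + y'.2 + p.derivative.eval (x₁ + y'.1)) ⁻¹' U) = Set.Iic m := by
    rcases hU with rfl | rfl
    · refine ⟨max (-(y.2 + p.derivative.eval (x₁ + y.1)))
        (-(y'.2 + p.derivative.eval (x₁ + y'.1))), .inl ?_⟩
      ext x
      simp only [Set.mem_inter_iff, Set.mem_preimage, Set.mem_Ioi, max_lt_iff]
      constructor <;> rintro ⟨h1, h2⟩ <;> constructor <;> linarith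
    · refine ⟨min (-(y.2 + p.derivative.eval (x₁ + y.1)))
        (-(y'.2 + p.derivative.eval (x₁ + y'.1))), .inr ?_⟩
      ext x
      simp only [Set.mem_inter_iff, Set.mem_preimage, Set.mem_Iic, le_min_iff]
      constructor <;> rintro ⟨h1, h2⟩ <;> constructor <;> linarith
  have hSm : MeasurableSet ((fun x => x + y.2 + p.derivative.eval (x₁ + y.1)) ⁻¹' U ∩
        (fun x => x + y'.2 + p.derivative.eval (x₁ + y'.1)) ⁻¹' U) := by
    obtain ⟨m, h | h⟩ := hS <;> rw [h]
    · exact measurableSet_Ioi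
    · exact measurableSet_Iic
  have hscale : ∀ w x : ℝ, HasDerivAt (fun x => dya ((x - w) / δ)) (deriv dya ((x - w) / δ) / δ) x := by
    intro w x
    have h1 := (contDiff_dya.differentiable one_ne_zero ((x - w) / δ)).hasDerivAt
    have h2 : HasDerivAt (fun x : ℝ => (x - w) / δ) (1 / δ) x :=
      ((hasDerivAt_id x).sub_const w).div_const δ
    have h3 := HasDerivAt.comp x h1 h2
    simp only [Function.comp_def] at h3
    rwa [mul_one_div] at h3
  have hvdc := norm_setIntegral_mul_quadratic_le
    (a := fun x => dya ((x - y.2) / δ) * dya ((x - y'.2) / δ)) (D := 2 * B ^ 2 / δ)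
    ((contDiff_dya.comp (by fun_prop)).mul (contDiff_dya.comp (by fun_prop)))
    (fun x => by
      rw [((hscale y.2 x).fun_mul (hscale y'.2 x)).deriv]
      have e : deriv dya ((x - y.2) / δ) / δ * dya ((x - y'.2) / δ) +
          dya ((x - y.2) / δ) * (deriv dya ((x - y'.2) / δ) / δ) =
          (deriv dya ((x - y.2) / δ) * dya ((x - y'.2) / δ) +
          dya ((x - y.2) / δ) * deriv dya ((x - y'.2) / δ)) / δ := by ring
      rw [e, abs_div, abs_of_pos hδ]
      refine div_le_div_of_nonneg_right ?_ hδ.le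
      refine (abs_add_le _ _).trans ?_
      rw [abs_mul, abs_mul]
      nlinarith [mul_le_mul (hB ((x - y.2) / δ)).2 (hB ((x - y'.2) / δ)).1 (abs_nonneg _) hB0,
        mul_le_mul (hB ((x - y.2) / δ)).1 (hB ((x - y'.2) / δ)).2 (abs_nonneg _) hB0])
    (c := c) (abs_pos.mp hc0) ℓ (l := y.2 - 2 * δ) (u := y.2 + 2 * δ) (by linarith)
    (fun x hx => by
      rw [dya_eq_zero (z := (x - y.2) / δ), zero_mul]
      rw [abs_div, abs_of_pos hδ, le_div_iff₀ hδ]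
      by_contra! h1
      have := abs_lt.mp h1
      exact hx ⟨by linarith, by linarith⟩) hS
  rw [← integral_indicator hSm] at hvdc
  rw [norm_mul, norm_mul, norm_mul, norm_exp_I_mul, Set.indicator_of_mem ht,
    Set.indicator_of_mem ht', Complex.norm_real, Real.norm_eq_abs]
  simp only [one_mul, mul_one, norm_one]
  have hb := hE _ ht
  have hb' := hE _ ht'
  have hbp := bet_pos (x₁ - y.1)
  have hbp' := bet_pos (x₁ - y'.1)
  have h1 : |(bet (x₁ - y.1))⁻¹ * (bet (x₁ - y'.1))⁻¹ / δ ^ 2| ≤ 16 / (s ^ 4 * δ ^ 2) := by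
    rw [abs_of_nonneg (by positivity), div_le_div_iff₀ (by positivity) (by positivity),
      ← mul_inv, inv_mul_le_iff₀ (by positivity)]
    have := mul_le_mul hb hb' (by positivity) hbp.le
    have hd : 0 < δ ^ 2 := by positivity
    nlinarith
  have h2 : 4 / √|c| ≤ 8 * (√|y.1 - y'.1|)⁻¹ := by
    have h3 : √|y.1 - y'.1| ≤ 2 * √|c| := by
      rw [Real.sqrt_le_left (by positivity), mul_pow, Real.sq_sqrt (abs_nonneg _)]
      linarith
    have h4 : 0 < √|y.1 - y'.1| := Real.sqrt_pos.mpr hv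
    have h5 : 0 < √|c| := Real.sqrt_pos.mpr hc0
    rw [← div_eq_mul_inv, div_le_div_iff₀ h5 h4]
    linarith
  refine (mul_le_mul h1 (hvdc.trans (mul_le_mul_of_nonneg_right h2 ?_)) (norm_nonneg _)
    (by positivity)).trans_eq ?_
  · have : y.2 + 2 * δ - (y.2 - 2 * δ) = 4 * δ := by ring
    rw [this]; positivity
  · field_simp
    ring

lemma enorm_integral_vker_le {B : ℝ} (hB : ∀ z, |dya z| ≤ B ∧ |deriv dya z| ≤ B) (p : ℝ[X])
    {γ ε σ s δ : ℝ} {U E : Set ℝ} (hγ : 1 / 2 ≤ |γ|) (hσ : σ ^ 2 = 1)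
    (h : 0 ≤ ε * γ * σ) (hs : 0 < s) (hδ : 0 < δ) (hU : U = Set.Ioi 0 ∨ U = Set.Iic 0)
    (hEm : MeasurableSet E) (hB0 : 0 < B)
    (hE : ∀ t ∈ E, |t| ≤ s ^ 2 ∧ s ^ 2 / 4 ≤ bet t) (hEσ : ∀ t ∈ E, 0 ≤ σ * t) (y y' : ℝ × ℝ) :
    ‖∫ x, (starRingEnd ℂ) (vker p γ ε δ U E x y) * vker p γ ε δ U E x y'‖ₑ ≤
      ENNReal.ofReal (2048 * B ^ 2 / (s ^ 2 * δ ^ 2)) * ttk (4 * δ) (2 * s ^ 2) (y, y') := by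
  have hUm : MeasurableSet U := by
    rcases hU with rfl | rfl
    exacts [measurableSet_Ioi, measurableSet_Iic]
  have hK := band_vker p γ ε hδ hUm hEm fun t ht => (hE t ht).1
  by_cases hsupp : |y.1 - y'.1| ≤ 2 * s ^ 2 ∧ |y.2 - y'.2| ≤ 4 * δ
  swap
  · have : ∀ x, (starRingEnd ℂ) (vker p γ ε δ U E x y) * vker p γ ε δ U E x y' = 0 := by
      intro x
      by_contra h0
      obtain ⟨h1, h2⟩ := vker_ne_zero hδ (x := x) (y := y)
        (fun h => left_ne_zero_of_mul h0 (by rw [h, map_zero]))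
      obtain ⟨h3, h4⟩ := vker_ne_zero hδ (right_ne_zero_of_mul h0)
      refine hsupp ⟨?_, ?_⟩
      · have := abs_le.mp (hE _ h1).1
        have := abs_le.mp (hE _ h3).1
        exact abs_le.mpr ⟨by linarith, by linarith⟩
      · have := abs_lt.mp h2
        have := abs_lt.mp h4
        exact abs_le.mpr ⟨by linarith, by linarith⟩
    simp [this]
  obtain ⟨hv, hd⟩ := hsupp
  refine le_trans ?_ (mul_le_mul' le_rfl (le_ttk hv hd))
  rcases eq_or_ne y.1 y'.1 with heq | hy
  · rw [heq, sub_self, abs_zero, Real.sqrt_zero, ENNReal.ofReal_zero, ENNReal.inv_zero,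
      ENNReal.mul_top]
    · exact le_top
    · exact (ENNReal.ofReal_pos.mpr (by positivity)).ne'
  have hn : Nice fun x => (starRingEnd ℂ) (vker p γ ε δ U E x y) * vker p γ ε δ U E x y' := by
    have hs : ∀ y, LocBdd fun x => vker p γ ε δ U E x y := fun y =>
      hK.loc.comp (g := fun x => (x, y)) (by fun_prop)
    refine Nice.mul_left ⟨hs y', ?_⟩ (hs y).star
    obtain ⟨R, hR⟩ := hK.supp
    refine ⟨R + ‖y'‖, fun x hx => ?_⟩
    by_contra h0
    have := norm_le_norm_add_norm_sub' x y'
    linarith [hR x y' h0]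
  rw [Measure.volume_eq_prod, integral_prod _ hn.integrable]
  refine (enorm_integral_le_lintegral_enorm _).trans ?_
  have hpt : ∀ x₁, ‖∫ x₂, (starRingEnd ℂ) (vker p γ ε δ U E (x₁, x₂) y) *
      vker p γ ε δ U E (x₁, x₂) y'‖ₑ ≤ (Set.Icc (y.1 - s ^ 2) (y.1 + s ^ 2)).indicator
      (fun _ => ENNReal.ofReal (1024 * B ^ 2 / (s ^ 4 * δ ^ 2) * (√|y.1 - y'.1|)⁻¹)) x₁ := by
    intro x₁
    by_cases hx : x₁ ∈ Set.Icc (y.1 - s ^ 2) (y.1 + s ^ 2)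
    · rw [Set.indicator_of_mem hx, ← ofReal_norm]
      exact ENNReal.ofReal_le_ofReal (norm_vker_slice_le hB p hγ hσ h hs hδ hU
        (fun t ht => (hE t ht).2) hEσ hy x₁)
    · have : ∀ x₂, vker p γ ε δ U E (x₁, x₂) y = 0 := by
        intro x₂
        by_contra h0
        have := abs_le.mp (hE _ (vker_ne_zero hδ h0).1).1
        exact hx ⟨by simp only at this; linarith, by simp only at this; linarith⟩
      simp [this]
  refine (lintegral_mono hpt).trans_eq ?_
  have hv0 : 0 < √|y.1 - y'.1| := Real.sqrt_pos.mpr (abs_pos.mpr (sub_ne_zero.mpr hy))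
  rw [lintegral_indicator_const measurableSet_Icc, Real.volume_Icc,
    ← ENNReal.ofReal_mul (by positivity), ← ENNReal.ofReal_inv_of_pos hv0,
    ← ENNReal.ofReal_mul (by positivity)]
  congr 1
  field_simp
  ring

lemma exists_nsq_vker_good_le : ∃ C : ℝ, 0 < C ∧ ∀ (p : ℝ[X]) (γ ε σ s δ : ℝ) (U E : Set ℝ)
    (f : ℝ × ℝ → ℂ), 1 / 2 ≤ |γ| → σ ^ 2 = 1 → 0 ≤ ε * γ * σ → 0 < s → 0 < δ →
    (U = Set.Ioi 0 ∨ U = Set.Iic 0) → MeasurableSet E →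
    (∀ t ∈ E, |t| ≤ s ^ 2 ∧ s ^ 2 / 4 ≤ bet t) → (∀ t ∈ E, 0 ≤ σ * t) → Nice f →
    nsq (Iop (vker p γ ε δ U E) f) ≤ ENNReal.ofReal (C / (s * δ)) * nsq f := by
  obtain ⟨B, hB0, hB⟩ := exists_dya_bound
  refine ⟨2048 * B ^ 2 * 64, by positivity, fun p γ ε σ s δ U E f hγ hσ h hs hδ hU hEm hE hEσ hf => ?_⟩
  have hUm : MeasurableSet U := by
    rcases hU with rfl | rfl
    exacts [measurableSet_Ioi, measurableSet_Iic]
  have hA : ∀ y, ∫⁻ y', ENNReal.ofReal (2048 * B ^ 2 / (s ^ 2 * δ ^ 2)) *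
      ttk (4 * δ) (2 * s ^ 2) (y, y') ≤ ENNReal.ofReal (2048 * B ^ 2 * 64 / (s * δ)) := by
    intro y
    rw [lintegral_const_mul' _ _ (by finiteness), lintegral_ttk (by positivity),
      ← ENNReal.ofReal_mul (by positivity), ← ENNReal.ofReal_mul (by positivity)]
    refine ENNReal.ofReal_le_ofReal ?_
    have h1 : √(2 * s ^ 2) ≤ 2 * s := by
      rw [Real.sqrt_le_left (by positivity)]; nlinarith [sq_nonneg s]
    calc 2048 * B ^ 2 / (s ^ 2 * δ ^ 2) * (4 * √(2 * s ^ 2) * (2 * (4 * δ)))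
        ≤ 2048 * B ^ 2 / (s ^ 2 * δ ^ 2) * (4 * (2 * s) * (2 * (4 * δ))) := by gcongr
      _ = _ := by field_simp; norm_num
  refine nsq_Iop_le_of_adjoint_comp (band_vker p γ ε hδ hUm hEm fun t ht => (hE t ht).1)
    ((measurable_ttk _ _).const_mul _)
    (enorm_integral_vker_le hB p hγ hσ h hs hδ hU hEm hB0 hE hEσ) hA (fun y' => ?_) hf
  simp only [ttk_swap _ _ _ y']
  exact hA y'

/-- Both signs of the exponential are covered, by duality. -/
lemma exists_nsq_vker_le : ∃ C : ℝ, 0 < C ∧ ∀ (p : ℝ[X]) (γ ε σ s δ : ℝ) (U E : Set ℝ)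
    (f : ℝ × ℝ → ℂ), 1 / 2 ≤ |γ| → σ ^ 2 = 1 → 0 < s → 0 < δ →
    (U = Set.Ioi 0 ∨ U = Set.Iic 0) → MeasurableSet E →
    (∀ t ∈ E, |t| ≤ s ^ 2 ∧ s ^ 2 / 4 ≤ bet t) → (∀ t ∈ E, 0 ≤ σ * t) → Nice f →
    nsq (Iop (vker p γ ε δ U E) f) ≤ ENNReal.ofReal (C / (s * δ)) * nsq f := by
  obtain ⟨C, hC, key⟩ := exists_nsq_vker_good_le
  refine ⟨C, hC, fun p γ ε σ s δ U E f hγ hσ hs hδ hU hEm hE hEσ hf => ?_⟩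
  rcases le_total 0 (ε * γ * σ) with h | h
  · exact key p γ ε σ s δ U E f hγ hσ h hs hδ hU hEm hE hEσ hf
  have hUm : MeasurableSet U := by
    rcases hU with rfl | rfl
    exacts [measurableSet_Ioi, measurableSet_Iic]
  have hE' : ∀ t ∈ -E, |t| ≤ s ^ 2 ∧ s ^ 2 / 4 ≤ bet t := fun t ht => by
    have := hE (-t) ht
    rwa [abs_neg, bet_neg] at this
  have hK := band_vker p γ ε hδ hUm hEm.neg fun t ht => (hE' t ht).1
  have hker : vker p γ ε δ U E = fun x y => -1 * (starRingEnd ℂ) (vker p γ ε δ U (-E) y x) := by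
    have hconj : ∀ (S : Set ℝ) (z : ℝ), (starRingEnd ℂ) (S.indicator (fun _ => (1 : ℂ)) z) =
        S.indicator (fun _ => (1 : ℂ)) z := fun S z => by
      classical
      rw [Set.indicator_apply]; split_ifs <;> simp
    ext x y
    unfold vker
    simp only [map_mul, hconj, Complex.conj_ofReal]
    rw [← Complex.exp_conj, map_mul, Complex.conj_I, Complex.conj_ofReal]
    have e1 : (-E).indicator (fun _ => (1 : ℂ)) (y.1 - x.1) =
        E.indicator (fun _ => (1 : ℂ)) (x.1 - y.1) := by
      classical
      simp only [Set.indicator_apply, Set.mem_neg, neg_sub]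
    have e2 : bet (y.1 - x.1) = bet (x.1 - y.1) := by rw [← bet_neg, neg_sub]
    have e3 : dya ((y.2 - x.2) / δ) = -dya ((x.2 - y.2) / δ) := by
      rw [← dya_neg, ← neg_div, neg_sub]
    rw [e1, e2, e3, add_comm y.1 x.1, add_comm y.2 x.2]
    have e4 : -(γ * Psi p y x + ε * (bet (x.1 - y.1) * ((x.2 + y.2 + p.derivative.eval (x.1 + y.1))
        * (y.2 - x.2)))) = γ * Psi p x y + ε * (bet (x.1 - y.1) *
        ((x.2 + y.2 + p.derivative.eval (x.1 + y.1)) * (x.2 - y.2))) := by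
      unfold Psi
      rw [add_comm y.1 x.1]
      ring
    have e5 : ∀ a : ℝ, -Complex.I * (a : ℂ) = Complex.I * ((-a : ℝ) : ℂ) := fun a => by
      push_cast; ring
    rw [e5, e4]
    push_cast
    ring
  rw [hker, Iop_const_mul_kernel, nsq_const_mul]
  simp only [enorm_neg, enorm_one, one_pow, one_mul]
  exact nsq_Iop_adjoint_le hK (fun g hg => key p γ ε (-σ) s δ U (-E) g hγ (by rw [neg_sq, hσ])
    (by linarith) hs hδ hU hEm.neg hE' (fun t ht => by
      have := hEσ (-t) ht
      linarith) hg) hf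

/-- The `L²` norm as a real number. -/
def nrm {E : Type*} [MeasureSpace E] (f : E → ℂ) : ℝ := (eLpNorm f 2 volume).toReal

lemma nrm_nonneg {E : Type*} [MeasureSpace E] (f : E → ℂ) : 0 ≤ nrm f := ENNReal.toReal_nonneg

lemma nsq_eq_eLpNorm_sq {E : Type*} [MeasureSpace E] (f : E → ℂ) :
    nsq f = eLpNorm f 2 volume ^ 2 := by
  rw [eLpNorm_eq_lintegral_rpow_enorm_toReal two_ne_zero ENNReal.ofNat_ne_top,
    ← ENNReal.rpow_natCast, ← ENNReal.rpow_mul]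
  simp [nsq]

lemma Nice.sub {E : Type*} [NormedAddCommGroup E] [MeasureSpace E] {f g : E → ℂ} (hf : Nice f) (hg : Nice g) :
    Nice fun x => f x - g x := by
  have := hf.add (hg.const_mul (-1))
  simpa [sub_eq_add_neg] using this

section
variable {E : Type*} [NormedAddCommGroup E] [MeasureSpace E] [ProperSpace E]
  [IsFiniteMeasureOnCompacts (volume : Measure E)] {f g : E → ℂ}

lemma Nice.nsq_eq (hf : Nice f) : nsq f = ENNReal.ofReal (nrm f ^ 2) := by
  unfold nrm
  rw [nsq_eq_eLpNorm_sq, ENNReal.ofReal_pow ENNReal.toReal_nonneg,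
    ENNReal.ofReal_toReal (hf.memLp 2).eLpNorm_ne_top]

lemma Nice.nsq_le_iff (hg : Nice g) (hf : Nice f) {c : ℝ} (hc : 0 ≤ c) :
    nsq g ≤ ENNReal.ofReal (c ^ 2) * nsq f ↔ nrm g ≤ c * nrm f := by
  rw [hg.nsq_eq, hf.nsq_eq, ← ENNReal.ofReal_mul (by positivity),
    ENNReal.ofReal_le_ofReal_iff (by positivity), ← mul_pow,
    pow_le_pow_iff_left₀ (nrm_nonneg _) (mul_nonneg hc (nrm_nonneg _)) two_ne_zero]

lemma nrm_add_le (hf : Nice f) (hg : Nice g) : nrm (fun x => f x + g x) ≤ nrm f + nrm g := by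
  unfold nrm
  rw [← ENNReal.toReal_add (hf.memLp 2).eLpNorm_ne_top (hg.memLp 2).eLpNorm_ne_top]
  refine ENNReal.toReal_mono (ENNReal.add_ne_top.mpr
    ⟨(hf.memLp 2).eLpNorm_ne_top, (hg.memLp 2).eLpNorm_ne_top⟩) ?_
  exact eLpNorm_add_le hf.meas.aestronglyMeasurable hg.meas.aestronglyMeasurable (by norm_num)

lemma nrm_const_mul {E : Type*} [MeasureSpace E] (c : ℂ) (f : E → ℂ) :
    nrm (fun x => c * f x) = ‖c‖ * nrm f := by
  unfold nrm
  have := eLpNorm_const_smul c f 2 (volume : Measure E)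
  rw [← toReal_enorm, ← ENNReal.toReal_mul, ← this]
  rfl

lemma nrm_zero {E : Type*} [MeasureSpace E] : nrm (fun _ : E => (0 : ℂ)) = 0 := by
  unfold nrm; simp

lemma norm_integral_mul_conj_le (hf : Nice f) (hg : Nice g) :
    ‖∫ x, f x * (starRingEnd ℂ) (g x)‖ ≤ nrm f * nrm g := by
  have h := enorm_integral_mul_sq_le hf.meas.aemeasurable hg.star.meas.aemeasurable
  rw [nsq_star, hf.nsq_eq, hg.nsq_eq, ← ENNReal.ofReal_mul (by positivity), ← mul_pow,
    ← ofReal_norm, ← ENNReal.ofReal_pow (norm_nonneg _),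
    ENNReal.ofReal_le_ofReal_iff (by positivity)] at h
  exact (pow_le_pow_iff_left₀ (norm_nonneg _) (mul_nonneg (nrm_nonneg _) (nrm_nonneg _))
    two_ne_zero).mp h

lemma norm_integral_mul_conj_self (hf : Nice f) :
    ‖∫ x, f x * (starRingEnd ℂ) (f x)‖ = nrm f ^ 2 := by
  have h := nsq_eq_enorm_integral hf
  rw [hf.nsq_eq, ← ofReal_norm] at h
  exact ((ENNReal.ofReal_eq_ofReal_iff (by positivity) (norm_nonneg _)).mp h).symm

lemma nrm_sum_le {ι : Type*} (s : Finset ι) {F : ι → E → ℂ} (hF : ∀ i, Nice (F i)) :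
    Nice (fun x => ∑ i ∈ s, F i x) ∧ nrm (fun x => ∑ i ∈ s, F i x) ≤ ∑ i ∈ s, nrm (F i) := by
  classical
  induction s using Finset.induction_on with
  | empty => simpa [nrm_zero] using Nice.zero
  | insert a s ha ih =>
    simp only [Finset.sum_insert ha]
    exact ⟨(hF a).add ih.1, (nrm_add_le (hF a) ih.1).trans (add_le_add_right ih.2 _)⟩

end

lemma exists_nrm_vker_le : ∃ C : ℝ, 0 < C ∧ ∀ (p : ℝ[X]) (γ ε s δ : ℝ) (U E : Set ℝ)
    (f : ℝ × ℝ → ℂ), 1 / 2 ≤ |γ| → 0 < s → 0 < δ →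
    (U = Set.Ioi 0 ∨ U = Set.Iic 0) → MeasurableSet E →
    (∀ t ∈ E, |t| ≤ s ^ 2 ∧ s ^ 2 / 4 ≤ bet t) → Nice f →
    Band (vker p γ ε δ U E) ∧ nrm (Iop (vker p γ ε δ U E) f) ≤ C / √(s * δ) * nrm f := by
  obtain ⟨C, hC, key⟩ := exists_nsq_vker_le
  refine ⟨2 * √C, by positivity, fun p γ ε s δ U E f hγ hs hδ hU hEm hE hf => ?_⟩
  have hUm : MeasurableSet U := by
    rcases hU with rfl | rfl
    exacts [measurableSet_Ioi, measurableSet_Iic]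
  have hband : ∀ E, MeasurableSet E → (∀ t ∈ E, |t| ≤ s ^ 2 ∧ s ^ 2 / 4 ≤ bet t) →
      Band (vker p γ ε δ U E) := fun E hEm hE => band_vker p γ ε hδ hUm hEm fun t ht => (hE t ht).1
  refine ⟨hband E hEm hE, ?_⟩
  have half : ∀ σ : ℝ, σ ^ 2 = 1 → ∀ F ⊆ E, MeasurableSet F → (∀ t ∈ F, 0 ≤ σ * t) →
      nrm (Iop (vker p γ ε δ U F) f) ≤ √C / √(s * δ) * nrm f := by
    intro σ hσ F hF hFm hFσ
    have hF' := fun t ht => hE t (hF ht)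
    rw [← ((hband F hFm hF').nice hf).nsq_le_iff hf (by positivity), div_pow,
      Real.sq_sqrt hC.le, Real.sq_sqrt (by positivity)]
    exact key p γ ε σ s δ U F f hγ hσ hs hδ hU hFm hF' hFσ hf
  have hb1 := hband (E ∩ Set.Ici 0) (hEm.inter measurableSet_Ici) fun t ht => hE t ht.1
  have hb2 := hband (E ∩ Set.Iio 0) (hEm.inter measurableSet_Iio) fun t ht => hE t ht.1
  have hsplit : vker p γ ε δ U E = fun x y =>
      vker p γ ε δ U (E ∩ Set.Ici 0) x y + vker p γ ε δ U (E ∩ Set.Iio 0) x y := by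
    ext x y
    unfold vker
    rw [← mul_add]
    congr 1
    classical
    simp only [Set.indicator_apply, Set.mem_inter_iff, Set.mem_Ici, Set.mem_Iio]
    by_cases h1 : x.1 - y.1 ∈ E <;> by_cases h2 : 0 ≤ x.1 - y.1 <;>
      simp [h1, h2, not_lt.mpr, -sub_nonneg, -sub_neg, not_le.mp]
  rw [hsplit, Iop_add_kernel hb1 hb2 hf]
  refine (nrm_add_le (hb1.nice hf) (hb2.nice hf)).trans ?_
  have h1 := half 1 (one_pow 2) _ Set.inter_subset_left (hEm.inter measurableSet_Ici)
    fun t ht => by simpa using ht.2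
  have h2 := half (-1) (by norm_num) _ Set.inter_subset_left (hEm.inter measurableSet_Iio)
    fun t ht => by
      have : t < 0 := ht.2
      linarith
  refine (add_le_add h1 h2).trans_eq ?_
  ring

lemma pker_two_mul (p : ℝ[X]) (γ : ℝ) {δ : ℝ} (hδ : 0 < δ) (E : Set ℝ) :
    pker p γ (2 * δ) E = fun x y => pker p γ δ E x y + -(Complex.I / 2) * (
      (vker p γ 1 δ (Set.Ioi 0) E x y + -1 * vker p γ (-1) δ (Set.Ioi 0) E x y) +
      (-1 * vker p γ 1 δ (Set.Iic 0) E x y + vker p γ (-1) δ (Set.Iic 0) E x y)) := by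
  ext x y
  unfold pker vker
  set t := x.1 - y.1
  set d := x.2 - y.2
  set s := x.2 + y.2 + p.derivative.eval (x.1 + y.1)
  have hb := bet_pos t
  have h1 : chi (d / (2 * δ)) = chi (d / δ) + dya (d / δ) * (d / δ) := by
    rw [dya_mul, mul_comm 2 δ, ← div_div]; ring
  have h2 : SS (bet t) s d * (dya (d / δ) * (d / δ)) =
      Real.sin (bet t * |s| * d) * ((bet t)⁻¹ * (dya (d / δ) / δ)) := by
    rw [← SS_mul]
    field_simp
  have hexp : ∀ ε : ℝ, Complex.exp (Complex.I * (γ * Psi p x y + ε * (bet t * (s * d)) : ℝ)) =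
      Complex.exp (Complex.I * (γ * Psi p x y : ℝ)) *
      Complex.exp ((ε : ℂ) * ((bet t * (s * d) : ℝ) * Complex.I)) := fun ε => by
    rw [← Complex.exp_add]
    congr 1
    push_cast
    ring
  have hsin : (Real.sin (bet t * |s| * d) : ℂ) = -(Complex.I / 2) *
      (Complex.exp ((bet t * (s * d) : ℝ) * Complex.I) -
        Complex.exp (-((bet t * (s * d) : ℝ) * Complex.I))) *
      ((Set.Ioi 0).indicator (fun _ => 1) s - (Set.Iic 0).indicator (fun _ => 1) s) := by
    have h3 : Complex.exp ((bet t * (s * d) : ℝ) * Complex.I) -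
        Complex.exp (-((bet t * (s * d) : ℝ) * Complex.I)) =
        2 * Complex.I * (Real.sin (bet t * (s * d)) : ℂ) := by
      rw [Complex.ofReal_sin, Complex.sin, neg_mul]
      linear_combination (-Complex.exp ((bet t * (s * d) : ℝ) * Complex.I) +
        Complex.exp (-((bet t * (s * d) : ℝ) * Complex.I))) * (-1) * Complex.I_sq
    rw [h3]
    rcases lt_or_ge 0 s with hs | hs
    · rw [Set.indicator_of_mem (s := Set.Ioi 0) hs,
        Set.indicator_of_notMem (s := Set.Iic (0 : ℝ)) (not_le.mpr hs), abs_of_pos hs, mul_assoc (bet t)]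
      linear_combination (Real.sin (bet t * (s * d)) : ℂ) * Complex.I_sq
    · rw [Set.indicator_of_notMem (s := Set.Ioi (0 : ℝ)) (not_lt.mpr hs),
        Set.indicator_of_mem (s := Set.Iic 0) hs, abs_of_nonpos hs,
        show bet t * -s * d = -(bet t * (s * d)) by ring, Real.sin_neg]
      push_cast
      linear_combination (-Complex.sin (bet t * (s * d))) * Complex.I_sq
  rw [h1, hexp, hexp]
  have h2' : (SS (bet t) s d : ℂ) * ((dya (d / δ) : ℂ) * (d / δ)) =
      (Real.sin (bet t * |s| * d) : ℂ) * ((bet t : ℂ)⁻¹ * (dya (d / δ) / δ)) := by exact_mod_cast h2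
  rw [hsin] at h2'
  push_cast at h2' ⊢
  simp only [one_mul, neg_mul (1 : ℂ)]
  linear_combination (Complex.exp (Complex.I * (γ * Psi p x y)) *
    E.indicator (fun _ => (1 : ℂ)) t) * h2'

lemma exists_nrm_pker_two_mul_sub_le : ∃ C : ℝ, 0 < C ∧ ∀ (p : ℝ[X]) (γ s δ : ℝ) (E : Set ℝ)
    (f : ℝ × ℝ → ℂ), 1 / 2 ≤ |γ| → 0 < s → 0 < δ → MeasurableSet E →
    (∀ t ∈ E, |t| ≤ s ^ 2 ∧ s ^ 2 / 4 ≤ bet t) → Nice f →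
    nrm (fun x => Iop (pker p γ (2 * δ) E) f x - Iop (pker p γ δ E) f x) ≤
      C / √(s * δ) * nrm f := by
  obtain ⟨C, hC, key⟩ := exists_nrm_vker_le
  refine ⟨2 * C, by positivity, fun p γ s δ E f hγ hs hδ hE hE' hf => ?_⟩
  obtain ⟨b1, n1⟩ := key p γ 1 s δ (Set.Ioi 0) E f hγ hs hδ (.inl rfl) hE hE' hf
  obtain ⟨b2, n2⟩ := key p γ (-1) s δ (Set.Ioi 0) E f hγ hs hδ (.inl rfl) hE hE' hf
  obtain ⟨b3, n3⟩ := key p γ 1 s δ (Set.Iic 0) E f hγ hs hδ (.inr rfl) hE hE' hf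
  obtain ⟨b4, n4⟩ := key p γ (-1) s δ (Set.Iic 0) E f hγ hs hδ (.inr rfl) hE hE' hf
  have c2 := b2.const_mul (-1)
  have c3 := b3.const_mul (-1)
  have d1 := b1.add c2
  have d2 := c3.add b4
  have e := d1.add d2
  have hb := band_pker p γ hδ hE fun t ht => (hE' t ht).1
  rw [pker_two_mul p γ hδ E, Iop_add_kernel hb (e.const_mul _) hf, Iop_const_mul_kernel,
    Iop_add_kernel d1 d2 hf, Iop_add_kernel b1 c2 hf, Iop_add_kernel c3 b4 hf,
    Iop_const_mul_kernel, Iop_const_mul_kernel]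
  simp only [add_sub_cancel_left]
  rw [nrm_const_mul]
  have hI : ‖-(Complex.I / 2)‖ = 1 / 2 := by simp
  have a1 := nrm_add_le (b1.nice hf) ((b2.nice hf).const_mul (-1))
  have a2 := nrm_add_le ((b3.nice hf).const_mul (-1)) (b4.nice hf)
  have a := nrm_add_le ((b1.nice hf).add ((b2.nice hf).const_mul (-1)))
    (((b3.nice hf).const_mul (-1)).add (b4.nice hf))
  rw [nrm_const_mul, norm_neg, norm_one, one_mul] at a1 a2
  rw [hI, mul_div_assoc]
  linarith

lemma exists_nrm_pker_sub_le : ∃ C : ℝ, 0 < C ∧ ∀ (p : ℝ[X]) (γ s : ℝ) (E : Set ℝ)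
    (f : ℝ × ℝ → ℂ), 1 / 2 ≤ |γ| → 1 ≤ s → MeasurableSet E →
    (∀ t ∈ E, |t| ≤ s ^ 2 ∧ s ^ 2 / 4 ≤ bet t) → Nice f → ∀ r N : ℕ, r ≤ N →
    nrm (fun x => Iop (pker p γ (2 ^ N / s) E) f x - Iop (pker p γ (2 ^ r / s) E) f x) ≤
      C * √(1 / 2) ^ r * nrm f ∧
    nrm (Iop (pker p γ (2 ^ r / s) E) f) ≤ C * nrm f := by
  obtain ⟨C, hC, key⟩ := exists_nrm_pker_two_mul_sub_le
  obtain ⟨C', hC', base⟩ := exists_nsq_base_le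
  refine ⟨4 * C + C', by positivity, fun p γ s E f hγ hs hE hE' hf => ?_⟩
  have hs0 : 0 < s := by linarith
  set q := √(1 / 2) with hq
  have hq2 : q ^ 2 = 1 / 2 := Real.sq_sqrt (by norm_num)
  have hq0 : 0 ≤ q := Real.sqrt_nonneg _
  have hq1 : q ≤ 3 / 4 := by nlinarith
  have hN := nrm_nonneg f
  have nice : ∀ r : ℕ, Nice (Iop (pker p γ (2 ^ r / s) E) f) := fun r =>
    (band_pker p γ (by positivity) hE fun t ht => (hE' t ht).1).nice hf
  have step : ∀ r : ℕ, nrm (fun x => Iop (pker p γ (2 ^ (r + 1) / s) E) f x -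
      Iop (pker p γ (2 ^ r / s) E) f x) ≤ C * q ^ r * nrm f := by
    intro r
    have h := key p γ s (2 ^ r / s) E f hγ hs0 (by positivity) hE hE' hf
    have h1 : C / √(s * (2 ^ r / s)) = C * q ^ r := by
      rw [mul_div_cancel₀ _ hs0.ne', hq, Real.sqrt_div one_pos.le, Real.sqrt_one, div_pow, one_pow,
        div_eq_mul_one_div]
      congr 2
      rw [Real.sqrt_eq_iff_mul_self_eq (by positivity) (by positivity), ← mul_pow,
        Real.mul_self_sqrt (by norm_num)]
    rwa [h1, ← mul_div_assoc, ← pow_succ'] at h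
  have tele : ∀ r N : ℕ, r ≤ N → nrm (fun x => Iop (pker p γ (2 ^ N / s) E) f x -
      Iop (pker p γ (2 ^ r / s) E) f x) ≤ 4 * C * (q ^ r - q ^ N) * nrm f := by
    intro r N hrN
    induction N, hrN using Nat.le_induction with
    | base => simp [nrm_zero]
    | succ N hrN ih =>
      have h := nrm_add_le ((nice (N + 1)).sub (nice N)) ((nice N).sub (nice r))
      simp only [sub_add_sub_cancel] at h
      refine h.trans ((add_le_add (step N) ih).trans ?_)
      rw [← add_mul]
      refine mul_le_mul_of_nonneg_right ?_ hN
      have := mul_nonneg hC.le (pow_nonneg hq0 N)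
      rw [pow_succ]
      nlinarith
  have base' : nrm (Iop (pker p γ (2 ^ 0 / s) E) f) ≤ C' * nrm f := by
    rw [← (nice 0).nsq_le_iff hf hC'.le, pow_zero]
    exact base p γ s E f hs hE hE' hf
  intro r N hrN
  refine ⟨(tele r N hrN).trans (mul_le_mul_of_nonneg_right ?_ hN), ?_⟩
  · have h1 := mul_nonneg hC.le (pow_nonneg hq0 N)
    have h2 := mul_nonneg hC'.le (pow_nonneg hq0 r)
    nlinarith
  · have h := nrm_add_le ((nice r).sub (nice 0)) (nice 0)
    simp only [sub_add_cancel] at h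
    refine h.trans ((add_le_add (tele 0 r r.zero_le) base').trans ?_)
    rw [← add_mul]
    refine mul_le_mul_of_nonneg_right ?_ hN
    have h1 := mul_nonneg hC.le (pow_nonneg hq0 r)
    rw [pow_zero]
    nlinarith

lemma exists_norm_pairing_le (n : ℕ) (hn : 1 ≤ n) (Γ : ℝ) (hΓ : 0 ≤ Γ) : ∃ C : ℝ, 0 < C ∧
    ∀ (p : ℝ[X]) (γ s s' : ℝ) (m N : ℕ) (Ej Ek : Set ℝ) (f h : ℝ × ℝ → ℂ),
    p.natDegree ≤ n → 1 / 2 ≤ |γ| → |γ| ≤ Γ → 1 ≤ s → 1 ≤ s' → s' ^ 2 = 2 ^ m * s ^ 2 → m ≤ N →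
    MeasurableSet Ej → MeasurableSet Ek →
    (∀ t ∈ Ej, |t| ≤ s' ^ 2 ∧ s' ^ 2 / 4 ≤ bet t) → (∀ t ∈ Ek, |t| ≤ s ^ 2 ∧ s ^ 2 / 4 ≤ bet t) →
    Nice f → Nice h →
    ‖∫ y, Iop (pker p γ (2 ^ N / s') Ej) f y *
      (starRingEnd ℂ) (Iop (pker p γ (2 ^ N / s) Ek) h y)‖ ≤
    C * √(1 / 2) ^ (m / 480) * (nrm f * nrm h) := by
  obtain ⟨A, hA, keyA⟩ := exists_nrm_pker_sub_le
  obtain ⟨B, hB, keyB⟩ := exists_pairing_scales_le n hn Γ hΓ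
  refine ⟨2 * A ^ 2 + √B + A ^ 2 * (8 * n + 2 + 3 * Γ), by positivity, ?_⟩
  intro p γ s s' m N Ej Ek f h hp hγ hγΓ hs hs' hss hmN hEjm hEkm hEj hEk hf hh
  set r := m / 480 with hr
  set q := √(1 / 2) with hq
  have hq2 : q ^ 2 = 1 / 2 := Real.sq_sqrt (by norm_num)
  have hq0 : 0 < q := by positivity
  have hrN : r ≤ N := (Nat.div_le_self _ _).trans hmN
  have hr480 : (480 : ℝ) * r ≤ m := by exact_mod_cast Nat.mul_div_le m 480
  set X : ℝ := (2 : ℝ) ^ ((m : ℝ) / 24) with hX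
  have hX24 : X ^ 24 = 2 ^ m := by
    rw [hX, ← Real.rpow_natCast, ← Real.rpow_mul (by norm_num), ← Real.rpow_natCast]
    congr 1; push_cast; ring
  have hX0 : 0 < X := by positivity
  have hMX : ∀ a : ℕ, a ≤ 20 → ((2 : ℝ) ^ r) ^ a ≤ X := by
    intro a ha
    have ha' : (a : ℝ) ≤ 20 := by exact_mod_cast ha
    rw [hX, ← pow_mul, ← Real.rpow_natCast]
    refine Real.rpow_le_rpow_of_exponent_le (by norm_num) ?_
    push_cast
    have := mul_le_mul_of_nonneg_left ha' (Nat.cast_nonneg (α := ℝ) r)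
    linarith
  have hM1 : (1 : ℝ) ≤ 2 ^ r := one_le_pow₀ (by norm_num)
  have hs'X : s' = X ^ 12 * s := by
    rw [← sq_eq_sq₀ (by linarith) (by positivity), hss, mul_pow, ← pow_mul, ← hX24]
  have hf0 := nrm_nonneg f
  have hh0 := nrm_nonneg h
  have hfh := mul_nonneg hf0 hh0
  have niceJ : ∀ r : ℕ, Nice (Iop (pker p γ (2 ^ r / s') Ej) f) := fun r =>
    (band_pker p γ (by positivity) hEjm fun t ht => (hEj t ht).1).nice hf
  have niceK : ∀ r : ℕ, Nice (Iop (pker p γ (2 ^ r / s) Ek) h) := fun r =>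
    (band_pker p γ (by positivity) hEkm fun t ht => (hEk t ht).1).nice hh
  obtain ⟨J1, J2⟩ := keyA p γ s' Ej f hγ hs' hEjm hEj hf r N hrN
  obtain ⟨K1, -⟩ := keyA p γ s Ek h hγ hs hEkm hEk hh r N hrN
  obtain ⟨-, J3⟩ := keyA p γ s' Ej f hγ hs' hEjm hEj hf N N le_rfl
  obtain ⟨-, K3⟩ := keyA p γ s Ek h hγ hs hEkm hEk hh N N le_rfl
  have hqM : q ^ r * q ^ r * 2 ^ r = 1 := by
    rw [← mul_pow, ← sq, hq2, ← mul_pow]; norm_num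
  have hqr : 0 < q ^ r := by positivity
  by_cases hbig : 8 * n ≤ X ∧ 2 + 3 * Γ ≤ X ^ 2
  · have hBB : √(B * ((2 ^ r) ^ 9 / X)) ≤ √B * q ^ r := by
      rw [Real.sqrt_mul hB.le]
      refine mul_le_mul_of_nonneg_left ?_ (Real.sqrt_nonneg _)
      rw [Real.sqrt_le_left hqr.le, div_le_iff₀ hX0]
      have h1 := hMX 10 (by norm_num)
      calc ((2 : ℝ) ^ r) ^ 9 = (q ^ r * q ^ r * 2 ^ r) * (2 ^ r) ^ 9 := by rw [hqM, one_mul]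
        _ = (q ^ r) ^ 2 * (2 ^ r) ^ 10 := by ring
        _ ≤ _ := mul_le_mul_of_nonneg_left h1 (by positivity)
    have hJK : ‖∫ y, Iop (pker p γ (2 ^ r / s') Ej) f y *
        (starRingEnd ℂ) (Iop (pker p γ (2 ^ r / s) Ek) h y)‖ ≤ √B * q ^ r * (nrm f * nrm h) := by
      have hk := keyB p γ s X (2 ^ r) Ej Ek f h hp hγ hγΓ hs hbig.1 hbig.2 hM1
        (by simpa using hMX 1 (by norm_num)) hEjm hEkm
        (by rw [hX24, ← hss]; exact hEj) hEk hf hh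
      rw [← hs'X, hf.nsq_eq, hh.nsq_eq, ← ENNReal.ofReal_mul (by positivity),
        ← ENNReal.ofReal_mul (by positivity), ← ofReal_norm, ← ENNReal.ofReal_pow (norm_nonneg _),
        ENNReal.ofReal_le_ofReal_iff (by positivity)] at hk
      simp only [mul_comm ((starRingEnd ℂ) _)] at hk
      refine le_trans ?_ (mul_le_mul_of_nonneg_right hBB hfh)
      rw [← pow_le_pow_iff_left₀ (norm_nonneg _) (by positivity) two_ne_zero]
      refine hk.trans_eq ?_
      rw [mul_pow, Real.sq_sqrt (by positivity)]
      ring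
    set a := Iop (pker p γ (2 ^ N / s') Ej) f
    set a' := Iop (pker p γ (2 ^ r / s') Ej) f
    set b := Iop (pker p γ (2 ^ N / s) Ek) h
    set b' := Iop (pker p γ (2 ^ r / s) Ek) h
    have ha : Nice a := niceJ N
    have ha' : Nice a' := niceJ r
    have hb : Nice b := niceK N
    have hb' : Nice b' := niceK r
    have i1 := ((ha.sub ha').mul_right hb.star.toLocBdd).integrable
    have i2 := (ha'.mul_right (hb.sub hb').star.toLocBdd).integrable
    have i3 := (ha'.mul_right hb'.star.toLocBdd).integrable
    have hsplit : ∫ y, a y * (starRingEnd ℂ) (b y) =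
        (∫ y, (a y - a' y) * (starRingEnd ℂ) (b y)) +
        ((∫ y, a' y * (starRingEnd ℂ) (b y - b' y)) + ∫ y, a' y * (starRingEnd ℂ) (b' y)) := by
      rw [← integral_add i2 i3]
      refine Eq.trans ?_ (integral_add i1 (i2.add i3))
      congr 1; ext y
      rw [map_sub]
      ring
    have e1 := (norm_integral_mul_conj_le (ha.sub ha') hb).trans
      (mul_le_mul J1 K3 (nrm_nonneg _) (by positivity))
    have e2 := (norm_integral_mul_conj_le ha' (hb.sub hb')).trans
      (mul_le_mul J2 K1 (nrm_nonneg _) (by positivity))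
    rw [hsplit]
    refine (norm_add_le _ _).trans ((add_le_add e1 ((norm_add_le _ _).trans
      (add_le_add e2 hJK))).trans ?_)
    have : 0 ≤ A ^ 2 * (8 * n + 2 + 3 * Γ) * (q ^ r * (nrm f * nrm h)) := by positivity
    linarith
  · have hXle : X ≤ 8 * n + 2 + 3 * Γ := by
      by_contra! hlt
      have hn0 : (0 : ℝ) ≤ n := Nat.cast_nonneg n
      exact hbig ⟨by linarith, by nlinarith⟩
    have h1 : 1 ≤ (8 * n + 2 + 3 * Γ) * q ^ r := by
      have h2 : (q ^ r) * 2 ^ r ≤ (8 * n + 2 + 3 * Γ) * q ^ r := by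
        rw [mul_comm]
        refine mul_le_mul_of_nonneg_right ?_ hqr.le
        simpa using (hMX 1 (by norm_num)).trans hXle
      refine le_trans ?_ h2
      have h3 : q ^ r ≤ 1 := pow_le_one₀ hq0.le (by nlinarith)
      have h4 : 0 < q ^ r * (2 : ℝ) ^ r := by positivity
      nlinarith
    refine (norm_integral_mul_conj_le (niceJ N) (niceK N)).trans
      ((mul_le_mul J3 K3 (nrm_nonneg _) (by positivity)).trans ?_)
    have h2 : 0 ≤ (2 * A ^ 2 + √B) * q ^ r := by positivity
    calc A * nrm f * (A * nrm h) = A ^ 2 * 1 * (nrm f * nrm h) := by ring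
      _ ≤ A ^ 2 * ((8 * n + 2 + 3 * Γ) * q ^ r) * (nrm f * nrm h) := by gcongr
      _ ≤ ((2 * A ^ 2 + √B) * q ^ r + A ^ 2 * ((8 * n + 2 + 3 * Γ) * q ^ r)) * (nrm f * nrm h) := by
        gcongr
        linarith
      _ = _ := by ring

lemma Band.zero : Band fun _ _ => (0 : ℂ) := ⟨.const 0, 0, fun _ _ h => absurd rfl h⟩

lemma Band.sum {ι : Type*} {K : ι → ℝ × ℝ → ℝ × ℝ → ℂ} (s : Finset ι) (hK : ∀ i, Band (K i)) :
    Band fun x y => ∑ i ∈ s, K i x y := by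
  classical
  induction s using Finset.induction_on with
  | empty => simpa using Band.zero
  | insert a s ha ih =>
    simp only [Finset.sum_insert ha]
    exact (hK a).add ih

lemma Iop_sum_kernel {ι : Type*} {K : ι → ℝ × ℝ → ℝ × ℝ → ℂ} (s : Finset ι) (hK : ∀ i, Band (K i))
    {f : ℝ × ℝ → ℂ} (hf : Nice f) :
    Iop (fun x y => ∑ i ∈ s, K i x y) f = fun x => ∑ i ∈ s, Iop (K i) f x := by
  ext x
  unfold Iop
  rw [← integral_finsetSum _ fun i _ => (hK i).integrable hf x]
  simp only [Finset.sum_mul]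

lemma Iop_sum {ι : Type*} {K : ℝ × ℝ → ℝ × ℝ → ℂ} (s : Finset ι) (hK : Band K)
    {F : ι → ℝ × ℝ → ℂ} (hF : ∀ i, Nice (F i)) :
    Iop K (fun x => ∑ i ∈ s, F i x) = fun x => ∑ i ∈ s, Iop K (F i) x := by
  ext x
  unfold Iop
  rw [← integral_finsetSum _ fun i _ => hK.integrable (hF i) x]
  simp only [Finset.mul_sum]

lemma nrm_Iop_sq_le {K : ℝ × ℝ → ℝ × ℝ → ℂ} (hK : Band K)
    (hsa : ∀ x y, (starRingEnd ℂ) (K y x) = K x y) {f : ℝ × ℝ → ℂ} (hf : Nice f) :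
    nrm (Iop K f) ^ 2 ≤ nrm (Iop K (Iop K f)) * nrm f := by
  rw [← norm_integral_mul_conj_self (hK.nice hf), integral_Iop_mul_conj hK hf (hK.nice hf)]
  simp only [hsa]
  rw [mul_comm]
  exact norm_integral_mul_conj_le hf (hK.nice (hK.nice hf))

/-- A log-convex sequence grows at least as fast as its first ratio. -/
lemma le_mul_of_sq_le_mul {u : ℕ → ℝ} {B D : ℝ} (hu : ∀ m, 0 ≤ u m) (hB : 0 < B)
    (hconv : ∀ m, u (m + 1) ^ 2 ≤ u (m + 2) * u m) (hD : ∀ m, u (m + 1) ≤ D * B ^ m) :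
    u 1 ≤ B * u 0 := by
  by_contra! hlt
  have h0 : 0 < u 0 := by
    rcases (hu 0).eq_or_lt with h | h
    · have := hconv 0
      rw [← h, mul_zero] at this hlt
      nlinarith
    · exact h
  have h1 : 0 < u 1 := by nlinarith
  have hpos : ∀ m, 0 < u m ∧ u 1 * u m ≤ u (m + 1) * u 0 := by
    intro m
    induction m with
    | zero => exact ⟨h0, by simp⟩
    | succ m ih =>
      obtain ⟨a, b⟩ := ih
      have c : 0 < u (m + 1) := by
        by_contra! h
        nlinarith [mul_pos h1 a]
      refine ⟨c, ?_⟩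
      have := hconv m
      have h3 : u 1 * u (m + 1) * u m ≤ u (m + 2) * u 0 * u m := by nlinarith
      exact le_of_mul_le_mul_right h3 a
  have hgrow : ∀ m, (u 1 / u 0) ^ m * u 1 ≤ u (m + 1) := by
    intro m
    induction m with
    | zero => simp
    | succ m ih =>
      have := (hpos (m + 1)).2
      rw [pow_succ', mul_assoc, div_mul_eq_mul_div, div_le_iff₀ h0]
      nlinarith
  have hr : 1 < u 1 / u 0 / B := by
    rw [lt_div_iff₀ hB, lt_div_iff₀ h0, one_mul]; exact hlt
  obtain ⟨m, hm⟩ := pow_unbounded_of_one_lt (D / u 1) hr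
  have h2 := (hgrow m).trans (hD m)
  rw [div_pow, lt_div_iff₀ (by positivity), div_mul_eq_mul_div, div_lt_iff₀ h1] at hm
  linarith

section CotlarStein

variable {ι : Type*} (K : ι → ℝ × ℝ → ℝ × ℝ → ℂ)

/-- The composition of the operators in a word, the head acting first. -/
def wordOp : List ι → (ℝ × ℝ → ℂ) → ℝ × ℝ → ℂ
  | [], f => f
  | i :: w, f => wordOp w (Iop (K i) f)

/-- The product of the weights of adjacent letters. -/
def wordAdj (a : ι → ι → ℝ) : List ι → ℝ
  | [] => 1
  | [_] => 1
  | i :: k :: w => a k i * wordAdj a (k :: w)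

/-- The bound for a word obtained by pairing letters from the head. -/
def wordPair (A : ℝ) (a : ι → ι → ℝ) : List ι → ℝ
  | [] => 1
  | [_] => A
  | i :: k :: w => a k i ^ 2 * wordPair A a w

variable {K} {A : ℝ} {a : ι → ι → ℝ} {f : ℝ × ℝ → ℂ}

lemma nice_wordOp (hK : ∀ i, Band (K i)) (w : List ι) : ∀ {f}, Nice f → Nice (wordOp K w f) := by
  induction w with
  | nil => exact id
  | cons i w ih => exact fun hf => ih ((hK i).nice hf)

lemma wordOp_sum {κ : Type*} (s : Finset κ) (hK : ∀ i, Band (K i)) (w : List ι) :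
    ∀ {F : κ → ℝ × ℝ → ℂ}, (∀ k, Nice (F k)) →
      wordOp K w (fun x => ∑ k ∈ s, F k x) = fun x => ∑ k ∈ s, wordOp K w (F k) x := by
  induction w with
  | nil => exact fun _ => rfl
  | cons i w ih =>
    intro F hF
    simp only [wordOp, Iop_sum s (hK i) hF]
    exact ih fun k => (hK i).nice (hF k)

lemma wordAdj_nonneg (ha : ∀ i k, 0 ≤ a i k) (w : List ι) : 0 ≤ wordAdj a w := by
  induction w using wordAdj.induct with
  | case1 => simp [wordAdj]
  | case2 => simp [wordAdj]
  | case3 i k w ih => exact mul_nonneg (ha _ _) ih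

lemma wordPair_nonneg (hA : 0 ≤ A) (w : List ι) : 0 ≤ wordPair A a w := by
  induction w using wordPair.induct with
  | case1 => simp [wordPair]
  | case2 => simpa [wordPair]
  | case3 i k w ih => exact mul_nonneg (sq_nonneg _) ih

lemma wordPair_mul_wordPair (i : ι) (w : List ι) :
    wordPair A a (i :: w) * wordPair A a w = A * wordAdj a (i :: w) ^ 2 := by
  induction w generalizing i with
  | nil => simp [wordPair, wordAdj]
  | cons k w ih =>
    have := ih k
    simp only [wordPair, wordAdj] at this ⊢
    linear_combination a k i ^ 2 * this

lemma nrm_wordOp_le_wordPair (hK : ∀ i, Band (K i)) (hA : 0 ≤ A)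
    (h1 : ∀ i f, Nice f → nrm (Iop (K i) f) ≤ A * nrm f)
    (h2 : ∀ i k f, Nice f → nrm (Iop (K i) (Iop (K k) f)) ≤ a i k ^ 2 * nrm f) (w : List ι) :
    ∀ {f}, Nice f → nrm (wordOp K w f) ≤ wordPair A a w * nrm f := by
  induction w using wordPair.induct with
  | case1 => simp [wordPair, wordOp]
  | case2 i => exact fun hf => h1 i _ hf
  | case3 i k w ih =>
    intro f hf
    refine (ih ((hK k).nice ((hK i).nice hf))).trans ?_
    refine (mul_le_mul_of_nonneg_left (h2 k i f hf) (wordPair_nonneg hA w)).trans_eq ?_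
    simp only [wordPair]
    ring

lemma nrm_wordOp_le (hK : ∀ i, Band (K i)) (hA : 0 ≤ A) (ha : ∀ i k, 0 ≤ a i k)
    (h1 : ∀ i f, Nice f → nrm (Iop (K i) f) ≤ A * nrm f)
    (h2 : ∀ i k f, Nice f → nrm (Iop (K i) (Iop (K k) f)) ≤ a i k ^ 2 * nrm f)
    (i : ι) (w : List ι) (hf : Nice f) :
    nrm (wordOp K (i :: w) f) ≤ A * wordAdj a (i :: w) * nrm f := by
  have e1 := nrm_wordOp_le_wordPair hK hA h1 h2 (i :: w) hf
  have e2 : nrm (wordOp K (i :: w) f) ≤ wordPair A a w * (A * nrm f) :=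
    (nrm_wordOp_le_wordPair hK hA h1 h2 w ((hK i).nice hf)).trans
      (mul_le_mul_of_nonneg_left (h1 i f hf) (wordPair_nonneg hA w))
  have h0 := wordAdj_nonneg ha (i :: w)
  have hf0 := nrm_nonneg f
  rw [← pow_le_pow_iff_left₀ (nrm_nonneg _) (by positivity) two_ne_zero]
  have e3 := mul_le_mul e1 e2 (nrm_nonneg _)
    (mul_nonneg (wordPair_nonneg hA (i :: w)) hf0)
  calc nrm (wordOp K (i :: w) f) ^ 2 = nrm (wordOp K (i :: w) f) * nrm (wordOp K (i :: w) f) := sq _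
    _ ≤ _ := e3
    _ = wordPair A a (i :: w) * wordPair A a w * (A * nrm f ^ 2) := by ring
    _ = _ := by rw [wordPair_mul_wordPair]; ring

/-- The Cotlar–Stein lemma for self-adjoint integral operators. -/
lemma nrm_sum_Iop_le [Fintype ι] {B : ℝ} (hK : ∀ i, Band (K i))
    (hsa : ∀ i x y, (starRingEnd ℂ) (K i y x) = K i x y) (hA : 0 ≤ A) (hB : 0 < B)
    (ha : ∀ i k, 0 ≤ a i k)
    (h1 : ∀ i f, Nice f → nrm (Iop (K i) f) ≤ A * nrm f)
    (h2 : ∀ i k f, Nice f → nrm (Iop (K i) (Iop (K k) f)) ≤ a i k ^ 2 * nrm f)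
    (h3 : ∀ i, ∑ k, a i k ≤ B) (hf : Nice f) :
    nrm (fun x => ∑ i, Iop (K i) f x) ≤ B * nrm f := by
  have hS := Band.sum Finset.univ hK
  set S := Iop fun x y => ∑ i, K i x y with hSdef
  have hS' : ∀ g, Nice g → S g = fun x => ∑ i, Iop (K i) g x := fun g hg =>
    Iop_sum_kernel Finset.univ hK hg
  have nice : ∀ m, Nice (S^[m] f) := by
    intro m
    induction m with
    | zero => exact hf
    | succ m ih =>
      rw [Function.iterate_succ_apply']
      exact hS.nice ih
  have hword : ∀ m i w, nrm (wordOp K (i :: w) (S^[m] f)) ≤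
      A * wordAdj a (i :: w) * (B ^ m * nrm f) := by
    intro m
    induction m with
    | zero => simpa using fun i w => nrm_wordOp_le hK hA ha h1 h2 i w hf
    | succ m ih =>
      intro i w
      rw [Function.iterate_succ_apply', hS' _ (nice m),
        wordOp_sum Finset.univ hK _ fun k => (hK k).nice (nice m)]
      have h0 := wordAdj_nonneg ha (i :: w)
      have hf0 := nrm_nonneg f
      refine (nrm_sum_le _ fun k => nice_wordOp hK _ ((hK k).nice (nice m))).2.trans ?_
      calc ∑ k, nrm (wordOp K (i :: w) (Iop (K k) (S^[m] f)))
          ≤ ∑ k, a i k * (A * wordAdj a (i :: w) * (B ^ m * nrm f)) := by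
            refine Finset.sum_le_sum fun k _ => (ih k (i :: w)).trans_eq ?_
            simp only [wordAdj]
            ring
        _ ≤ B * (A * wordAdj a (i :: w) * (B ^ m * nrm f)) := by
            rw [← Finset.sum_mul]
            refine mul_le_mul_of_nonneg_right ?_ (by positivity)
            exact h3 i
        _ = _ := by rw [pow_succ]; ring
  have hu := le_mul_of_sq_le_mul (u := fun m => nrm (S^[m] f)) (B := B)
    (D := Fintype.card ι * (A * nrm f)) (fun m => nrm_nonneg _) hB ?_ ?_
  · simpa [hS' f hf] using hu
  · intro m
    simp only [Function.iterate_succ_apply']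
    refine nrm_Iop_sq_le hS (fun x y => ?_) (nice m)
    rw [map_sum]
    exact Finset.sum_congr rfl fun i _ => hsa i x y
  · intro m
    rw [Function.iterate_succ_apply', hS' _ (nice m)]
    refine (nrm_sum_le _ fun k => (hK k).nice (nice m)).2.trans ?_
    refine (Finset.sum_le_card_nsmul _ _ (A * (B ^ m * nrm f)) fun i _ => ?_).trans_eq ?_
    · simpa [wordAdj, wordOp] using hword m i []
    · rw [nsmul_eq_mul, Finset.card_univ]
      ring

end CotlarStein

lemma nrm_Iop_Iop_le {K L : ℝ × ℝ → ℝ × ℝ → ℂ} (hK : Band K) (hL : Band L)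
    (hsa : ∀ x y, (starRingEnd ℂ) (K y x) = K x y) {c : ℝ} (hc : 0 ≤ c)
    (h : ∀ f h, Nice f → Nice h →
      ‖∫ y, Iop L f y * (starRingEnd ℂ) (Iop K h y)‖ ≤ c * (nrm f * nrm h))
    {f : ℝ × ℝ → ℂ} (hf : Nice f) : nrm (Iop K (Iop L f)) ≤ c * nrm f := by
  have hg := hK.nice (hL.nice hf)
  have h1 := h f _ hf hg
  have h2 := integral_Iop_mul_conj hK (hL.nice hf) hg
  simp only [hsa] at h2
  rw [← h2, norm_integral_mul_conj_self hg] at h1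
  rcases (nrm_nonneg (Iop K (Iop L f))).eq_or_lt with h0 | h0
  · rw [← h0]
    exact mul_nonneg hc (nrm_nonneg f)
  · exact le_of_mul_le_mul_right (by linarith) h0

lemma norm_integral_mul_conj_comm (f g : ℝ × ℝ → ℂ) :
    ‖∫ y, f y * (starRingEnd ℂ) (g y)‖ = ‖∫ y, g y * (starRingEnd ℂ) (f y)‖ := by
  rw [← RCLike.norm_conj, ← integral_conj]
  simp only [map_mul, Complex.conj_conj, mul_comm]

lemma sum_range_pow_div_le {t : ℝ} (ht : 0 ≤ t) (ht' : t < 1) (n : ℕ) :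
    ∑ d ∈ Finset.range n, t ^ (d / 480) ≤ 480 / (1 - t) := by
  have h : ∀ L : ℕ, (∑ d ∈ Finset.range (480 * L), t ^ (d / 480)) * (1 - t) = 480 * (1 - t ^ L) := by
    intro L
    induction L with
    | zero => simp
    | succ L ih =>
      rw [mul_add, mul_one, Finset.sum_range_add, add_mul, ih]
      have h1 : ∀ e ∈ Finset.range 480, t ^ ((480 * L + e) / 480) = t ^ L := by
        intro e he
        rw [Nat.mul_add_div (by norm_num), Nat.div_eq_of_lt (Finset.mem_range.mp he), add_zero]
      rw [Finset.sum_congr rfl h1, Finset.sum_const, Finset.card_range, nsmul_eq_mul]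
      push_cast
      ring
  rw [le_div_iff₀ (by linarith)]
  have h1 : ∑ d ∈ Finset.range n, t ^ (d / 480) ≤ ∑ d ∈ Finset.range (480 * n), t ^ (d / 480) :=
    Finset.sum_le_sum_of_subset_of_nonneg (Finset.range_mono (by omega))
      fun _ _ _ => pow_nonneg ht _
  have h2 := mul_le_mul_of_nonneg_right h1 (by linarith : 0 ≤ 1 - t)
  have h3 := pow_nonneg ht n
  linarith [h n]

lemma sum_fin_pow_dist_div_le {t : ℝ} (ht : 0 ≤ t) (ht' : t < 1) {n : ℕ} (i : Fin n) :
    ∑ k : Fin n, t ^ ((i - k + (k - i) : ℕ) / 480) ≤ 2 * (480 / (1 - t)) := by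
  rw [Fin.sum_univ_eq_sum_range (fun k => t ^ (((i : ℕ) - k + (k - i)) / 480)) n]
  obtain ⟨i, hi⟩ := i
  obtain ⟨e, rfl⟩ := Nat.exists_eq_add_of_lt hi
  simp only [add_assoc]
  rw [Finset.sum_range_add, two_mul]
  refine add_le_add ?_ ?_
  · have h1 : ∀ k ∈ Finset.range i, t ^ ((i - k + (k - i)) / 480) =
        t ^ ((i - 1 - k + 1) / 480) := by
      intro k hk
      have := Finset.mem_range.mp hk
      congr 2
      omega
    rw [Finset.sum_congr rfl h1,
      Finset.sum_range_reflect (fun k => t ^ ((k + 1) / 480)) i]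
    refine le_trans ?_ (sum_range_pow_div_le ht ht' (i + 1))
    rw [Finset.sum_range_succ']
    exact le_add_of_nonneg_right (pow_nonneg ht _)
  · refine (Finset.sum_congr rfl fun k _ => ?_).trans_le (sum_range_pow_div_le ht ht' (e + 1))
    congr 2
    omega

/-- The dyadic shells of `[-R, R]`. -/
def shell (R : ℝ) (j : ℕ) : Set ℝ := {t | |t| ≤ R} ∩ {t | |t| ≤ 2 ^ j} ∩ {t | j = 0 ∨ 2 ^ j < 2 * |t|}

lemma measurableSet_shell (R : ℝ) (j : ℕ) : MeasurableSet (shell R j) := by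
  have h1 : ∀ a : ℝ, MeasurableSet {t : ℝ | |t| ≤ a} := fun a =>
    measurableSet_le (by fun_prop) (by fun_prop)
  have h2 : MeasurableSet {t : ℝ | 2 ^ j < 2 * |t|} :=
    measurableSet_lt (by fun_prop) (by fun_prop)
  exact ((h1 _).inter (h1 _)).inter ((MeasurableSet.const (j = 0)).union h2)

lemma neg_mem_shell {R t : ℝ} {j : ℕ} (h : t ∈ shell R j) : -t ∈ shell R j := by
  simpa [shell] using h

lemma shell_bounds {R : ℝ} {j : ℕ} : ∀ t ∈ shell R j,
    |t| ≤ √(2 ^ j) ^ 2 ∧ √(2 ^ j) ^ 2 / 4 ≤ bet t := by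
  rintro t ⟨⟨-, h1⟩, h2⟩
  rw [Real.sq_sqrt (by positivity)]
  refine ⟨h1, ?_⟩
  rcases h2 with rfl | h2
  · have := one_le_bet t
    norm_num
    linarith
  · have := abs_le_two_bet t
    linarith

lemma sum_indicator_shell {R : ℝ} {J : ℕ} (hJ : R ≤ 2 ^ J) (t : ℝ) :
    ∑ j : Fin (J + 1), (shell R j).indicator (fun _ => (1 : ℂ)) t = if |t| ≤ R then 1 else 0 := by
  classical
  split_ifs with h
  · have hex : ∃ j : ℕ, |t| ≤ 2 ^ j := ⟨J, h.trans hJ⟩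
    have hj := Nat.find_spec hex
    have hjJ : Nat.find hex ≤ J := Nat.find_min' hex (h.trans hJ)
    have hmin := fun {k} => Nat.find_min (m := k) hex
    generalize Nat.find hex = j at hj hjJ hmin
    rw [Finset.sum_eq_single (⟨j, by omega⟩ : Fin (J + 1))]
    · refine Set.indicator_of_mem (s := shell R j) ⟨⟨h, hj⟩, ?_⟩ _
      rcases j with _ | j
      · exact .inl rfl
      · have := hmin (Nat.lt_succ_self j)
        rw [not_le] at this
        exact .inr (by rw [pow_succ']; linarith)
    · intro k _ hk
      refine Set.indicator_of_notMem (s := shell R k) ?_ _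
      rintro ⟨⟨-, h1⟩, h2⟩
      have hk' : (k : ℕ) ≠ j := fun h => hk (Fin.ext h)
      rcases lt_or_gt_of_ne hk' with h3 | h3
      · exact hmin h3 h1
      · rcases h2 with h2 | h2
        · omega
        · have : (2 : ℝ) ^ (j + 1) ≤ 2 ^ (k : ℕ) := pow_le_pow_right₀ (by norm_num) h3
          rw [pow_succ'] at this
          linarith
    · exact fun h => absurd (Finset.mem_univ _) h
  · refine Finset.sum_eq_zero fun j _ => Set.indicator_of_notMem (s := shell R j) ?_ _
    exact fun h' => h h'.1.1

/-- The truncation of the kernel to a shell. -/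
def shellKer (p : ℝ[X]) (γ R : ℝ) (N i : ℕ) : ℝ × ℝ → ℝ × ℝ → ℂ :=
  pker p γ (2 ^ N / √(2 ^ i)) (shell R i)

lemma band_shellKer (p : ℝ[X]) (γ R : ℝ) (N i : ℕ) : Band (shellKer p γ R N i) :=
  band_pker p γ (by positivity) (measurableSet_shell R i) fun t ht => (shell_bounds t ht).1

lemma shellKer_conj (p : ℝ[X]) (γ R : ℝ) (N i : ℕ) (x y : ℝ × ℝ) :
    (starRingEnd ℂ) (shellKer p γ R N i y x) = shellKer p γ R N i x y :=
  pker_conj p γ _ (fun _ ht => neg_mem_shell ht) x y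

lemma one_le_sqrt_two_pow (i : ℕ) : 1 ≤ √((2 : ℝ) ^ i) :=
  Real.one_le_sqrt.mpr (one_le_pow₀ (by norm_num))

lemma exists_nrm_shellKer_le : ∃ A : ℝ, 0 < A ∧ ∀ (p : ℝ[X]) (γ R : ℝ) (N i : ℕ) (f : ℝ × ℝ → ℂ),
    1 / 2 ≤ |γ| → Nice f → nrm (Iop (shellKer p γ R N i) f) ≤ A * nrm f := by
  obtain ⟨A, hA, keyA⟩ := exists_nrm_pker_sub_le
  exact ⟨A, hA, fun p γ R N i f hγ hf => (keyA p γ _ _ f hγ (one_le_sqrt_two_pow i)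
    (measurableSet_shell R i) shell_bounds hf N N le_rfl).2⟩

lemma exists_norm_pairing_shellKer_le (n : ℕ) (hn : 1 ≤ n) (Γ : ℝ) (hΓ : 0 ≤ Γ) : ∃ C : ℝ, 0 < C ∧
    ∀ (p : ℝ[X]) (γ R : ℝ) (N i k : ℕ) (f h : ℝ × ℝ → ℂ), p.natDegree ≤ n → 1 / 2 ≤ |γ| → |γ| ≤ Γ →
    k ≤ i → i ≤ N → Nice f → Nice h →
    ‖∫ y, Iop (shellKer p γ R N i) f y * (starRingEnd ℂ) (Iop (shellKer p γ R N k) h y)‖ ≤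
      C * √(1 / 2) ^ ((i - k) / 480) * (nrm f * nrm h) := by
  obtain ⟨C, hC, keyC⟩ := exists_norm_pairing_le n hn Γ hΓ
  refine ⟨C, hC, fun p γ R N i k f h hp hγ hγΓ hki hiN hf hh => ?_⟩
  refine keyC p γ _ _ (i - k) N _ _ f h hp hγ hγΓ (one_le_sqrt_two_pow k) (one_le_sqrt_two_pow i)
    ?_ (by omega) (measurableSet_shell R i) (measurableSet_shell R k) shell_bounds shell_bounds hf hh
  rw [Real.sq_sqrt (by positivity), Real.sq_sqrt (by positivity), ← pow_add, Nat.sub_add_cancel hki]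

lemma exists_nrm_sum_shellKer_le (n : ℕ) (hn : 1 ≤ n) (Γ : ℝ) (hΓ : 0 ≤ Γ) : ∃ B : ℝ, 0 < B ∧
    ∀ (p : ℝ[X]) (γ R : ℝ) (J N : ℕ) (f : ℝ × ℝ → ℂ), p.natDegree ≤ n → 1 / 2 ≤ |γ| → |γ| ≤ Γ →
    J ≤ N → Nice f →
    nrm (fun x => ∑ i : Fin (J + 1), Iop (shellKer p γ R N i) f x) ≤ B * nrm f := by
  obtain ⟨A, hA, keyA⟩ := exists_nrm_shellKer_le
  obtain ⟨C, hC, keyC⟩ := exists_norm_pairing_shellKer_le n hn Γ hΓ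
  set q := √(1 / 2) with hq
  have hq2 : q ^ 2 = 1 / 2 := Real.sq_sqrt (by norm_num)
  have hq0 : 0 < q := by positivity
  have hq1 : q < 1 := by nlinarith
  set t := √q with ht
  have ht2 : t ^ 2 = q := Real.sq_sqrt hq0.le
  have ht0 : 0 < t := by positivity
  have ht1 : t < 1 := by nlinarith
  have h1t : 0 < 1 - t := by linarith
  clear_value q t
  refine ⟨√C * (2 * (480 / (1 - t))), by positivity, ?_⟩
  intro p γ R J N f hp hγ hγΓ hJN hf
  refine nrm_sum_Iop_le (K := fun i : Fin (J + 1) => shellKer p γ R N i) (A := A)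
    (a := fun i k => √C * t ^ ((i - k + (k - i) : ℕ) / 480))
    (fun i => band_shellKer p γ R N i) (fun i => shellKer_conj p γ R N i) hA.le
    (by positivity) (fun i k => by positivity) (fun i f hf => keyA p γ R N i f hγ hf) ?_ ?_ hf
  · intro i k f hf
    have e : (√C * t ^ ((i - k + (k - i) : ℕ) / 480)) ^ 2 =
        C * q ^ ((i - k + (k - i) : ℕ) / 480) := by
      rw [mul_pow, Real.sq_sqrt hC.le, ← pow_mul, mul_comm _ 2, pow_mul, ht2]
    rw [e]
    refine nrm_Iop_Iop_le (band_shellKer p γ R N i) (band_shellKer p γ R N k)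
      (shellKer_conj p γ R N i) (by positivity) (fun f h hf hh => ?_) hf
    rcases le_total (k : ℕ) i with hki | hik
    · rw [norm_integral_mul_conj_comm, mul_comm (nrm f), Nat.sub_eq_zero_of_le hki, add_zero]
      exact keyC p γ R N i k h f hp hγ hγΓ hki (by omega) hh hf
    · rw [Nat.sub_eq_zero_of_le hik, zero_add]
      exact keyC p γ R N k i f h hp hγ hγΓ hik (by omega) hf hh
  · intro i
    rw [← Finset.mul_sum]
    exact mul_le_mul_of_nonneg_left (sum_fin_pow_dist_div_le ht0.le ht1 i) (Real.sqrt_nonneg _)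

lemma Nice.eLpNorm_eq {f : ℝ × ℝ → ℂ} (hf : Nice f) :
    eLpNorm f 2 volume = ENNReal.ofReal (nrm f) :=
  (ENNReal.ofReal_toReal (hf.memLp 2).eLpNorm_ne_top).symm

lemma Nice.of_continuous {f : ℝ × ℝ → ℂ} (hf : Continuous f) (hs : HasCompactSupport f) : Nice f := by
  obtain ⟨R, hR⟩ := hs.isCompact.isBounded.subset_closedBall 0
  refine ⟨.of_continuous hf, R, fun x hx => ?_⟩
  by_contra h
  have := hR (subset_tsupport f h)
  rw [mem_closedBall_zero_iff] at this
  linarith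

lemma sinq_mul_bet_inv (p : ℝ[X]) (x y : ℝ × ℝ) : sinq p x y * (bet (x.1 - y.1))⁻¹ =
    SS (bet (x.1 - y.1)) (x.2 + y.2 + p.derivative.eval (x.1 + y.1)) (x.2 - y.2) := by
  have hb := (bet_pos (x.1 - y.1)).ne'
  unfold sinq
  split_ifs with h
  · rw [h, sub_self]
    unfold SS
    rw [mul_zero, Real.sinc_zero]
    field_simp
  · have hd : x.2 - y.2 ≠ 0 := sub_ne_zero.mpr h
    unfold theta
    rw [← SS_mul]
    field_simp

lemma sum_shellKer_eq_Oker (p : ℝ[X]) (γ : ℝ) {R : ℝ} {J N : ℕ} (hJ : R ≤ 2 ^ J) {x y : ℝ × ℝ}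
    (h : 2 * √(2 ^ J) * |x.2 - y.2| ≤ 2 ^ N) :
    ∑ i : Fin (J + 1), shellKer p γ R N i x y = Oker p γ R x y := by
  have hchi : ∀ i : Fin (J + 1), chi ((x.2 - y.2) / (2 ^ N / √(2 ^ (i : ℕ)))) = 1 := by
    intro i
    have h1 : √((2 : ℝ) ^ (i : ℕ)) ≤ √(2 ^ J) :=
      Real.sqrt_le_sqrt (pow_le_pow_right₀ (by norm_num) (by omega))
    refine chi_eq_one ?_
    rw [abs_div, abs_of_pos (by positivity : (0 : ℝ) < 2 ^ N / √(2 ^ (i : ℕ))),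
      div_le_iff₀ (by positivity), ← mul_div_assoc, le_div_iff₀ (by positivity)]
    have h2 := mul_le_mul_of_nonneg_left h1 (abs_nonneg (x.2 - y.2))
    linarith
  unfold shellKer pker Oker
  simp only [hchi]
  rw [← Finset.mul_sum, sum_indicator_shell hJ, ← sinq_mul_bet_inv]
  push_cast
  ring

lemma exists_eLpNorm_Oop_le (n : ℕ) (hn : 1 ≤ n) (Γ : ℝ) (hΓ : 0 ≤ Γ) : ∃ B : ℝ, 0 < B ∧
    ∀ (p : ℝ[X]) (γ R : ℝ) (f : ℝ × ℝ → ℂ), p.natDegree ≤ n → 1 / 2 ≤ |γ| → |γ| ≤ Γ → Nice f →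
    eLpNorm (Oop p γ R f) 2 volume ≤ ENNReal.ofReal B * eLpNorm f 2 volume := by
  obtain ⟨B, hB, key⟩ := exists_nrm_sum_shellKer_le n hn Γ hΓ
  refine ⟨B, hB, fun p γ R f hp hγ hγΓ hf => ?_⟩
  obtain ⟨J, hJ⟩ := pow_unbounded_of_one_lt R (one_lt_two : (1 : ℝ) < 2)
  have nice : ∀ N, Nice fun x => ∑ i : Fin (J + 1), Iop (shellKer p γ R N i) f x := fun N =>
    (nrm_sum_le Finset.univ fun i : Fin (J + 1) => (band_shellKer p γ R N i).nice hf).1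
  have hlim : ∀ x, Filter.Tendsto
      (fun N => ∑ i : Fin (J + 1), Iop (shellKer p γ R (N + J) i) f x) Filter.atTop
      (nhds (Oop p γ R f x)) := by
    intro x
    obtain ⟨Rf, hRf⟩ := hf.supp
    obtain ⟨N₀, hN₀⟩ := pow_unbounded_of_one_lt (2 * √(2 ^ J) * (‖x‖ + Rf))
      (one_lt_two : (1 : ℝ) < 2)
    refine tendsto_const_nhds.congr' ?_
    filter_upwards [Filter.eventually_ge_atTop N₀] with N hN
    refine Eq.trans ?_ (congrFun (Iop_sum_kernel (K := fun i : Fin (J + 1) =>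
      shellKer p γ R (N + J) i) Finset.univ (fun i => band_shellKer p γ R (N + J) i) hf) x)
    unfold Oop Iop
    congr 1
    ext y
    by_cases hy : Rf < ‖y‖
    · simp [hRf y hy]
    · beta_reduce
      rw [sum_shellKer_eq_Oker p γ hJ.le]
      have h1 : |x.2 - y.2| ≤ ‖x‖ + Rf := by
        have a1 := norm_snd_le x
        have a2 := norm_snd_le y
        have a3 := norm_sub_le x.2 y.2
        rw [Real.norm_eq_abs (x.2 - y.2)] at a3
        linarith [not_lt.mp hy]
      have h2 : (2 : ℝ) ^ N₀ ≤ 2 ^ (N + J) := pow_le_pow_right₀ (by norm_num) (by omega)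
      have h3 := mul_le_mul_of_nonneg_left h1 (by positivity : 0 ≤ 2 * √((2 : ℝ) ^ J))
      linarith
  refine (Lp.eLpNorm_lim_le_liminf_eLpNorm (fun N => (nice (N + J)).meas.aestronglyMeasurable) _
    (Filter.Eventually.of_forall hlim)).trans ?_
  refine Filter.liminf_le_of_le (by isBoundedDefault) fun b hb => ?_
  obtain ⟨N, hN⟩ := hb.exists
  refine hN.trans ?_
  rw [(nice (N + J)).eLpNorm_eq, hf.eLpNorm_eq, ← ENNReal.ofReal_mul hB.le]
  exact ENNReal.ofReal_le_ofReal (key p γ R J (N + J) f hp hγ hγΓ (by omega) hf)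

lemma one_le_log_log {R : ℝ} (hR : 100 ≤ R) : 1 ≤ Real.log (Real.log (10 + R)) := by
  have he := Real.exp_one_lt_d9
  rw [Real.le_log_iff_exp_le (Real.log_pos (by linarith)), Real.le_log_iff_exp_le (by linarith)]
  calc Real.exp (Real.exp 1) ≤ Real.exp (3 : ℕ) := Real.exp_le_exp.mpr (by norm_num; linarith)
    _ = Real.exp 1 ^ 3 := by rw [← Real.exp_nat_mul, mul_one]
    _ ≤ 2.8 ^ 3 := pow_le_pow_left₀ (Real.exp_pos 1).le (by linarith) 3
    _ ≤ _ := by norm_num; linarith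

theorem stmt3 (n : ℕ) (hn : 1 ≤ n) (Γ : ℝ) (hΓ : 1 / 2 < Γ) :
    ∃ C > 0,
      (∀ p : Polynomial ℝ, p.natDegree ≤ n →
        ∀ γ : ℝ, min 1 ((n : ℝ) / 2) ≤ |γ| → |γ| ≤ Γ →
        ∀ R : ℝ, 100 ≤ R →
        ∀ f : ℝ × ℝ → ℂ, ContDiff ℝ (⊤ : ℕ∞) f → HasCompactSupport f →
          eLpNorm (Oop p γ R f) 2 volume ≤
            ENNReal.ofReal (C * Real.log (Real.log (10 + R))) * eLpNorm f 2 volume) ∧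
      (n = 1 →
        ∀ p : Polynomial ℝ, p.natDegree ≤ n →
        ∀ γ : ℝ, min 1 ((n : ℝ) / 2) ≤ |γ| → |γ| ≤ Γ →
        ∀ R : ℝ, 100 ≤ R →
        ∀ f : ℝ × ℝ → ℂ, ContDiff ℝ (⊤ : ℕ∞) f → HasCompactSupport f →
          eLpNorm (Oop p γ R f) 2 volume ≤ ENNReal.ofReal C * eLpNorm f 2 volume) := by
  have hmin : ∀ γ : ℝ, min 1 ((n : ℝ) / 2) ≤ |γ| → 1 / 2 ≤ |γ| := fun γ h => by
    have : (1 : ℝ) ≤ n := by exact_mod_cast hn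
    exact (le_min (by norm_num) (by linarith)).trans h
  obtain ⟨B, hB, key⟩ := exists_eLpNorm_Oop_le n hn Γ (by linarith)
  refine ⟨B, hB, fun p hp γ hγ hγΓ R hR f hf hs => ?_, fun _ p hp γ hγ hγΓ R _ f hf hs =>
    key p γ R f hp (hmin γ hγ) hγΓ (.of_continuous hf.continuous hs)⟩
  refine (key p γ R f hp (hmin γ hγ) hγΓ (.of_continuous hf.continuous hs)).trans ?_
  gcongr
  exact le_mul_of_one_le_right hB.le (one_le_log_log hR)

end
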